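/- Let C = A ∪ B be an ℓ-critical set with no ℓ-divided 5-hole in C, with |A| ≥ 6 and |B| ≥ 6, and such that exactly two points of A lie on the boundary of the convex hull of C. Then |B| ≤ |A| − 1. -/

import Mathlib

noncomputable section

/-- Points of the plane. -/
abbrev Pt : Type := ℝ × ℝ

/-- The cross product (signed area) of two planar vectors. -/
def cross2 (u v : Pt) : ℝ := u.1 * v.2 - u.2 * v.1

/-- The dot product of two planar vectors. -/
def dotp (v p : Pt) : ℝ := v.1 * p.1 + v.2 * p.2

/-- A set of points in the plane is in general position if no three of its points
are collinear. -/
def GenPos (P : Set Pt) : Prop :=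
  ∀ p ∈ P, ∀ q ∈ P, ∀ r ∈ P, p ≠ q → p ≠ r → q ≠ r →
    ¬ Collinear ℝ ({p, q, r} : Set Pt)

/-- A set of points is in convex position if no point of the set lies in the convex
hull of the other points. -/
def ConvexPos (S : Set Pt) : Prop :=
  ∀ p ∈ S, p ∉ convexHull ℝ (S \ {p})

/-- `H` is a `k`-hole in `P`: a subset of `P` of size `k` in convex position whose
convex hull contains no point of `P \ H`. -/
def IsKHole (k : ℕ) (P H : Finset Pt) : Prop :=
  H ⊆ P ∧ H.card = k ∧ ConvexPos (↑H : Set Pt) ∧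
    ∀ p ∈ P, p ∉ H → p ∉ convexHull ℝ (↑H : Set Pt)

/-- The number of `k`-holes in `P`. -/
def numKHoles (k : ℕ) (P : Finset Pt) : ℕ :=
  Set.ncard {H : Finset Pt | IsKHole k P H}

/-- For an `ℓ`-divided set `P = A ∪ B`, an `ℓ`-divided 5-hole is a 5-hole in `A ∪ B`
containing points of both `A` and `B`. -/
def DividedFiveHole (A B H : Finset Pt) : Prop :=
  IsKHole 5 (A ∪ B) H ∧ (↑H ∩ ↑A : Set Pt).Nonempty ∧ (↑H ∩ ↑B : Set Pt).Nonempty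

/-- `x` is an extremal point of `P`: it lies on the boundary of the convex hull of `P`. -/
def OnHullBoundary (P : Finset Pt) (x : Pt) : Prop :=
  x ∈ frontier (convexHull ℝ (↑P : Set Pt))

/-- An `ℓ`-divided set `C = A ∪ B` is `ℓ`-critical if neither part is in convex position
and, for every extremal point `x` of `C`, one of the sets `(C \ {x}) ∩ A` and
`(C \ {x}) ∩ B` is in convex position. -/
def LCritical (A B : Finset Pt) : Prop :=
  ¬ ConvexPos (↑A : Set Pt) ∧ ¬ ConvexPos (↑B : Set Pt) ∧
    ∀ x ∈ A ∪ B, OnHullBoundary (A ∪ B) x →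
      (ConvexPos (↑(A.erase x) : Set Pt) ∨ ConvexPos (↑(B.erase x) : Set Pt))

/-- The closed wedge with apex `a` swept clockwise from the ray `a→p` to the ray `a→q`.
If the clockwise angle from `a→p` to `a→q` is at most `π` the wedge is convex, otherwise
it is the corresponding reflex region. -/
def Wedge (a p q : Pt) : Set Pt :=
  if cross2 (p - a) (q - a) ≤ 0 then
    {x | cross2 (p - a) (x - a) ≤ 0 ∧ 0 ≤ cross2 (q - a) (x - a)}
  else
    {x | cross2 (p - a) (x - a) ≤ 0 ∨ 0 ≤ cross2 (q - a) (x - a)}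

/-- `W` is an `a`-wedge of `A`: one of the closed regions into which the rays from `a`
through the other points of `A` partition the plane, i.e. a wedge spanned by two
points of `A \ {a}` that are angularly consecutive around `a` (no other point of `A`
lies in the wedge). -/
def IsAWedge (A : Finset Pt) (a : Pt) (W : Set Pt) : Prop :=
  ∃ p ∈ A.erase a, ∃ q ∈ A.erase a, p ≠ q ∧ W = Wedge a p q ∧
    (↑A : Set Pt) ∩ Wedge a p q ⊆ {a, p, q}

/-- The combinatorial data of the `a*`-wedges of an `ℓ`-divided set `P = A ∪ B`, where
`ℓ` is the vertical line `x = x0` and `A` lies to its left: `aStar` is the rightmost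
interior point `a*` of `A`; `lbl` is the clockwise cyclic labeling `a_0, a_1, …` of
`A \ {a*}` (period `|A| - 1`), so that the `k`-th wedge `W_k` is swept clockwise from
the ray through `lbl (k-1)` to the ray through `lbl k` and contains no other point
of `A`; the wedges `W_1, …, W_t` are exactly those meeting `ℓ`, in top-to-bottom
order along `ℓ`. -/
structure StarSetup (x0 : ℝ) (A : Finset Pt) where
  aStar : Pt
  lbl : ℕ → Pt
  t : ℕ
  aStar_mem : aStar ∈ A
  aStar_interior : aStar ∈ interior (convexHull ℝ (↑A : Set Pt))
  aStar_rightmost : ∀ p ∈ A, p ∈ interior (convexHull ℝ (↑A : Set Pt)) → p.1 ≤ aStar.1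
  lbl_mem : ∀ k, lbl k ∈ A.erase aStar
  lbl_periodic : ∀ k, lbl (k + (A.card - 1)) = lbl k
  lbl_bij : ∀ p ∈ A.erase aStar, ∃! k, k ∈ Finset.Icc 1 (A.card - 1) ∧ lbl k = p
  consec : ∀ k ∈ Finset.Icc 1 (A.card - 1),
    (↑A : Set Pt) ∩ Wedge aStar (lbl (k - 1)) (lbl k) ⊆ {aStar, lbl (k - 1), lbl k}
  t_pos : 1 ≤ t
  t_le : t ≤ A.card - 1
  inter_iff : ∀ k ∈ Finset.Icc 1 (A.card - 1),
    ((Wedge aStar (lbl (k - 1)) (lbl k)) ∩ {p : Pt | p.1 = x0}).Nonempty ↔ k ≤ t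
  ordered : ∀ k ∈ Finset.Icc 1 t, ∀ k' ∈ Finset.Icc 1 t, k < k' →
    ∀ p ∈ (Wedge aStar (lbl (k - 1)) (lbl k)) ∩ {q : Pt | q.1 = x0},
    ∀ p' ∈ (Wedge aStar (lbl (k' - 1)) (lbl k')) ∩ {q : Pt | q.1 = x0},
      p'.2 ≤ p.2

/-- The `k`-th `a*`-wedge `W_k`. -/
def StarSetup.W {x0 : ℝ} {A : Finset Pt} (S : StarSetup x0 A) (k : ℕ) : Set Pt :=
  Wedge S.aStar (S.lbl (k - 1)) (S.lbl k)

/-- `w_k`, the number of points of `B` in the `k`-th `a*`-wedge. -/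
def StarSetup.w {x0 : ℝ} {A : Finset Pt} (S : StarSetup x0 A) (B : Finset Pt) (k : ℕ) : ℕ :=
  Set.ncard ((↑B : Set Pt) ∩ S.W k)



/-! ### Orientation of triples -/

/-- Orientation determinant: positive for counterclockwise triples. -/
def D (p q r : Pt) : ℝ := (q.1 - p.1) * (r.2 - p.2) - (q.2 - p.2) * (r.1 - p.1)

lemma D_rot (p q r : Pt) : D q r p = D p q r := by unfold D; ring
lemma D_rot' (p q r : Pt) : D r p q = D p q r := by unfold D; ring
lemma D_swap (p q r : Pt) : D q p r = - D p q r := by unfold D; ring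
lemma D_swap' (p q r : Pt) : D p r q = - D p q r := by unfold D; ring
lemma D_swap'' (p q r : Pt) : D r q p = - D p q r := by unfold D; ring
lemma D_self1 (p q : Pt) : D p p q = 0 := by unfold D; ring
lemma D_self2 (p q : Pt) : D p q q = 0 := by unfold D; ring
lemma D_self3 (p q : Pt) : D p q p = 0 := by unfold D; ring

/-- Interiority: `D` is additive over a subdivision of a triangle. -/
lemma D_add (p q r t : Pt) : D p q r = D t q r + D p t r + D p q t := by unfold D; ring

/-- Three-term Grassmann–Plücker relation around `t`. -/
lemma D_gp (t u p q r : Pt) : D t u q * D t p r = D t u p * D t q r + D t u r * D t p q := by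
  unfold D; ring

lemma D_trans {t u p q r : Pt} (h1 : D t u p < 0) (h2 : D t u q < 0) (h3 : D t u r < 0)
    (h4 : D t p q < 0) (h5 : D t q r < 0) : D t p r < 0 := by
  have := D_gp t u p q r
  by_contra h
  push Not at h
  nlinarith [mul_pos_of_neg_of_neg h1 h5, mul_pos_of_neg_of_neg h3 h4]

lemma D_trans' {t u p q r : Pt} (h1 : 0 < D t u p) (h2 : 0 < D t u q) (h3 : 0 < D t u r)
    (h4 : D t p q < 0) (h5 : D t q r < 0) : D t p r < 0 := by
  have := D_gp t u p q r
  by_contra h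
  push Not at h
  nlinarith [mul_neg_of_pos_of_neg h1 h5, mul_neg_of_pos_of_neg h3 h4]

lemma D_bary1 (v a b c x : Pt) :
    D b c x * dotp v a + D c a x * dotp v b + D a b x * dotp v c = D a b c * dotp v x := by
  unfold D dotp; ring

lemma D_bary0 (a b c x : Pt) : D b c x + D c a x + D a b x = D a b c := by
  unfold D; ring

/-- A point strictly inside a triangle is on the same side of a line. -/
lemma sep_tri {v : Pt} {c : ℝ} {p q r x : Pt} (hp : dotp v p < c) (hq : dotp v q < c)
    (hr : dotp v r < c) (hx : c < dotp v x) (h1 : D p q x < 0) (h2 : D q r x < 0)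
    (h3 : D r p x < 0) : False := by
  have e1 := D_bary1 v p q r x
  have e0 := D_bary0 p q r x
  have e2 : D q r x * (dotp v p - c) + D r p x * (dotp v q - c) + D p q x * (dotp v r - c)
      = D p q r * (dotp v x - c) := by linear_combination e1 - c * e0
  nlinarith [mul_pos_of_neg_of_neg h2 (sub_neg.2 hp), mul_pos_of_neg_of_neg h3 (sub_neg.2 hq),
    mul_pos_of_neg_of_neg h1 (sub_neg.2 hr),
    mul_neg_of_neg_of_pos (by linarith : D p q r < 0) (sub_pos.2 hx)]

lemma dotp_neg' (v p : Pt) : dotp (-v) p = - dotp v p := by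
  unfold dotp; simp; ring

lemma sep_tri' {v : Pt} {c : ℝ} {p q r x : Pt} (hp : c < dotp v p) (hq : c < dotp v q)
    (hr : c < dotp v r) (hx : dotp v x < c) (h1 : D p q x < 0) (h2 : D q r x < 0)
    (h3 : D r p x < 0) : False := by
  refine sep_tri (v := -v) (c := -c) (p := p) (q := q) (r := r) (x := x) ?_ ?_ ?_ ?_ h1 h2 h3 <;>
    rw [dotp_neg'] <;> linarith

/-- Segments on different sides of a line do not cross. -/
lemma sep_seg {v : Pt} {e : ℝ} {a b c d : Pt} (ha : dotp v a < e) (hb : dotp v b < e)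
    (hc : e < dotp v c) (hd : e < dotp v d) (h1 : D a b c < 0) (h2 : D b a d < 0)
    (h3 : D d c a < 0) (h4 : D c d b < 0) : False := by
  have e1 : D b c d * dotp v a - D a c d * dotp v b + D a b d * dotp v c - D a b c * dotp v d = 0 := by
    unfold D dotp; ring
  have e0 : D b c d - D a c d + D a b d - D a b c = 0 := by unfold D; ring
  have k2 : 0 < D a b d := by have := D_swap a b d; linarith
  have k3 : 0 < D a c d := by have := D_swap'' d c a; linarith
  have k4 : D b c d < 0 := by have := D_rot b c d; linarith
  have e2 : D b c d * (dotp v a - e) - D a c d * (dotp v b - e) + D a b d * (dotp v c - e)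
      - D a b c * (dotp v d - e) = 0 := by linear_combination e1 - e * e0
  nlinarith [mul_pos_of_neg_of_neg k4 (sub_neg.2 ha), mul_neg_of_pos_of_neg k3 (sub_neg.2 hb),
    mul_pos k2 (sub_pos.2 hc), mul_neg_of_neg_of_pos h1 (sub_pos.2 hd)]

/-! ### Half-planes, hulls, general position -/

lemma D_comb (u w x y : Pt) (a b : ℝ) (hab : a + b = 1) :
    D u w (a • x + b • y) = a * D u w x + b * D u w y := by
  obtain rfl : b = 1 - a := by linarith
  unfold D; simp; ring

lemma dotp_comb (v x y : Pt) (a b : ℝ) :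
    dotp v (a • x + b • y) = a * dotp v x + b * dotp v y := by
  unfold dotp; simp; ring

lemma hull_D_le {u w : Pt} {S : Set Pt} (h : ∀ x ∈ S, D u w x ≤ 0) {x : Pt}
    (hx : x ∈ convexHull ℝ S) : D u w x ≤ 0 := by
  have hc : Convex ℝ {x : Pt | D u w x ≤ 0} := by
    intro x hx y hy a b ha hb hab
    simp only [Set.mem_ofPred_eq] at *
    rw [D_comb _ _ _ _ _ _ hab]
    nlinarith [mul_nonneg ha (neg_nonneg.2 hx), mul_nonneg hb (neg_nonneg.2 hy)]
  exact convexHull_min (fun x hx => h x hx) hc hx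

lemma hull_dotp_lt {v : Pt} {c : ℝ} {S : Set Pt} (h : ∀ x ∈ S, dotp v x < c) {x : Pt}
    (hx : x ∈ convexHull ℝ S) : dotp v x < c := by
  have hc : Convex ℝ {x : Pt | dotp v x < c} := by
    intro x hx y hy a b ha hb hab
    simp only [Set.mem_ofPred_eq] at *
    rw [dotp_comb]
    rcases eq_or_lt_of_le ha with rfl | ha'
    · obtain rfl : b = 1 := by linarith
      simpa using hy
    · have : c = a * c + b * c := by rw [← add_mul, hab, one_mul]
      nlinarith [mul_pos ha' (sub_pos.2 hx), mul_nonneg hb (sub_pos.2 hy).le]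
  exact convexHull_min (fun x hx => h x hx) hc hx

lemma D_eq_zero_collinear {p q r : Pt} (hpq : p ≠ q) (h : D p q r = 0) :
    Collinear ℝ ({p, q, r} : Set Pt) := by
  rw [collinear_iff_of_mem (p₀ := p) (by simp)]
  refine ⟨q - p, ?_⟩
  have hn : 0 < (q.1 - p.1) ^ 2 + (q.2 - p.2) ^ 2 := by
    by_contra hcon
    apply hpq
    have h1 : (q.1 - p.1) = 0 := by nlinarith [sq_nonneg (q.1 - p.1), sq_nonneg (q.2 - p.2)]
    have h2 : (q.2 - p.2) = 0 := by nlinarith [sq_nonneg (q.1 - p.1), sq_nonneg (q.2 - p.2)]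
    ext <;> linarith
  intro x hx
  simp only [Set.mem_insert_iff, Set.mem_singleton_iff] at hx
  rcases hx with rfl | rfl | rfl
  · exact ⟨0, by simp⟩
  · exact ⟨1, by simp⟩
  · refine ⟨((q.1 - p.1) * (x.1 - p.1) + (q.2 - p.2) * (x.2 - p.2)) /
      ((q.1 - p.1) ^ 2 + (q.2 - p.2) ^ 2), ?_⟩
    unfold D at h
    ext
    · simp
      field_simp
      linear_combination (-(q.2 - p.2)) * h
    · simp
      field_simp
      linear_combination (q.1 - p.1) * h

lemma GenPos.D_ne {P : Set Pt} (hP : GenPos P) {p q r : Pt} (hp : p ∈ P) (hq : q ∈ P)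
    (hr : r ∈ P) (h1 : p ≠ q) (h2 : p ≠ r) (h3 : q ≠ r) : D p q r ≠ 0 := fun h =>
  hP p hp q hq r hr h1 h2 h3 (D_eq_zero_collinear h1 h)

/-- Orientation certificate of membership in a triangle. -/
lemma mem_tri {p q r x : Pt} (h1 : D p q x ≤ 0) (h2 : D q r x ≤ 0) (h3 : D r p x ≤ 0)
    (h : D p q r < 0) : x ∈ convexHull ℝ ({p, q, r} : Set Pt) := by
  have e0 := D_bary0 p q r x
  have hcv : Convex ℝ (convexHull ℝ ({p, q, r} : Set Pt)) := convex_convexHull ℝ _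
  have hp : p ∈ convexHull ℝ ({p, q, r} : Set Pt) := subset_convexHull ℝ _ (by simp)
  have hq : q ∈ convexHull ℝ ({p, q, r} : Set Pt) := subset_convexHull ℝ _ (by simp)
  have hr : r ∈ convexHull ℝ ({p, q, r} : Set Pt) := subset_convexHull ℝ _ (by simp)
  have hx : x = (D q r x / D p q r) • p + (D r p x / D p q r) • q + (D p q x / D p q r) • r := by
    have hne := h.ne
    ext
    · simp
      field_simp
      unfold D; ring
    · simp
      field_simp
      unfold D; ring
  rw [hx]
  have := hcv.sum_mem (t := Finset.univ) (w := ![D q r x / D p q r, D r p x / D p q r, D p q x / D p q r])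
    (z := ![p, q, r]) ?_ ?_ ?_
  · simpa [Fin.sum_univ_three] using this
  · intro i _
    fin_cases i <;> simp <;> exact div_nonneg_of_nonpos (by assumption) h.le
  · simp [Fin.sum_univ_three]
    field_simp [h.ne]
    linarith
  · intro i _
    fin_cases i <;> simp [hp, hq, hr]


/-! ### Holes -/

/-- Ten negative orientations: a convex pentagon listed clockwise. -/
def Pent (a b c d e : Pt) : Prop :=
  D a b c < 0 ∧ D a b d < 0 ∧ D a b e < 0 ∧ D a c d < 0 ∧ D a c e < 0 ∧ D a d e < 0 ∧
  D b c d < 0 ∧ D b c e < 0 ∧ D b d e < 0 ∧ D c d e < 0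

lemma Pent.rot {a b c d e : Pt} (h : Pent a b c d e) : Pent b c d e a := by
  obtain ⟨h1, h2, h3, h4, h5, h6, h7, h8, h9, h10⟩ := h
  refine ⟨h7, h8, ?_, h9, ?_, ?_, h10, ?_, ?_, ?_⟩ <;> rw [D_rot] <;> assumption

lemma D_lt_ne {a b c : Pt} (h : D a b c < 0) : a ≠ b ∧ a ≠ c ∧ b ≠ c := by
  refine ⟨?_, ?_, ?_⟩ <;> rintro rfl
  · simp [D_self1] at h
  · simp [D_self3] at h
  · simp [D_self2] at h

lemma Pent.notMem {a b c d e : Pt} (h : Pent a b c d e) :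
    a ∉ convexHull ℝ ({b, c, d, e} : Set Pt) := by
  obtain ⟨h1, h2, h3, h4, h5, h6, h7, h8, h9, h10⟩ := h
  intro ha
  have := hull_D_le (u := e) (w := b) (S := {b, c, d, e}) ?_ ha
  · have e1 := D_rot' e b a
    have e2 := D_swap' a b e
    linarith
  · intro x hx
    simp only [Set.mem_insert_iff, Set.mem_singleton_iff] at hx
    rcases hx with rfl | rfl | rfl | rfl
    · rw [D_self2]
    · rw [← D_rot]; exact h8.le
    · rw [← D_rot]; exact h9.le
    · rw [D_self3]

lemma Pent.convexPos {a b c d e : Pt} (h : Pent a b c d e) :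
    ConvexPos ({a, b, c, d, e} : Set Pt) := by
  have r1 := h.rot
  have r2 := r1.rot
  have r3 := r2.rot
  have r4 := r3.rot
  intro p hp hmem
  simp only [Set.mem_insert_iff, Set.mem_singleton_iff] at hp
  rcases hp with rfl | rfl | rfl | rfl | rfl
  · refine h.notMem (convexHull_mono ?_ hmem)
    intro x hx
    simp only [Set.mem_diff, Set.mem_insert_iff, Set.mem_singleton_iff] at hx ⊢
    tauto
  · refine r1.notMem (convexHull_mono ?_ hmem)
    intro x hx
    simp only [Set.mem_diff, Set.mem_insert_iff, Set.mem_singleton_iff] at hx ⊢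
    tauto
  · refine r2.notMem (convexHull_mono ?_ hmem)
    intro x hx
    simp only [Set.mem_diff, Set.mem_insert_iff, Set.mem_singleton_iff] at hx ⊢
    tauto
  · refine r3.notMem (convexHull_mono ?_ hmem)
    intro x hx
    simp only [Set.mem_diff, Set.mem_insert_iff, Set.mem_singleton_iff] at hx ⊢
    tauto
  · refine r4.notMem (convexHull_mono ?_ hmem)
    intro x hx
    simp only [Set.mem_diff, Set.mem_insert_iff, Set.mem_singleton_iff] at hx ⊢
    tauto

lemma no_hole {A B : Finset Pt} (hnh : ¬ ∃ H : Finset Pt, DividedFiveHole A B H)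
    {a b c d e : Pt} (h : Pent a b c d e) (hC : ({a, b, c, d, e} : Finset Pt) ⊆ A ∪ B)
    (h1 : ∃ x ∈ ({a, b, c, d, e} : Finset Pt), x ∈ A)
    (h2 : ∃ x ∈ ({a, b, c, d, e} : Finset Pt), x ∈ B)
    (hemp : ∀ x ∈ A ∪ B, x ∉ ({a, b, c, d, e} : Finset Pt) →
      x ∉ convexHull ℝ ({a, b, c, d, e} : Set Pt)) : False := by
  apply hnh
  have hco : ((({a, b, c, d, e} : Finset Pt) : Set Pt)) = ({a, b, c, d, e} : Set Pt) := by
    push_cast; rfl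
  refine ⟨{a, b, c, d, e}, ⟨hC, ?_, ?_, ?_⟩, ?_, ?_⟩
  · obtain ⟨h1, h2, h3, h4, h5, h6, h7, h8, h9, h10⟩ := h
    have k1 := D_lt_ne h1
    have k2 := D_lt_ne h2
    have k3 := D_lt_ne h3
    have k4 := D_lt_ne h10
    have k5 := D_lt_ne h7
    have k6 := D_lt_ne h8
    rw [Finset.card_insert_of_notMem, Finset.card_insert_of_notMem, Finset.card_insert_of_notMem,
      Finset.card_insert_of_notMem, Finset.card_singleton] <;>
      simp only [Finset.mem_insert, Finset.mem_singleton] <;> tauto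
  · rw [hco]; exact h.convexPos
  · intro p hp hp'
    rw [hco]; exact hemp p hp hp'
  · obtain ⟨x, hx, hx'⟩ := h1
    exact ⟨x, hx, hx'⟩
  · obtain ⟨x, hx, hx'⟩ := h2
    exact ⟨x, hx, hx'⟩

/-- A separating line (given by two points) excludes a point from a pentagon. -/
lemma pent_sep {a b c d e u w x : Pt} (ha : D u w a ≤ 0) (hb : D u w b ≤ 0) (hc : D u w c ≤ 0)
    (hd : D u w d ≤ 0) (he : D u w e ≤ 0) (hx : 0 < D u w x) :
    x ∉ convexHull ℝ ({a, b, c, d, e} : Set Pt) := by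
  intro hm
  have := hull_D_le (u := u) (w := w) (S := {a, b, c, d, e}) ?_ hm
  · linarith
  · intro y hy
    simp only [Set.mem_insert_iff, Set.mem_singleton_iff] at hy
    rcases hy with rfl | rfl | rfl | rfl | rfl <;> assumption

lemma Pent.sep_edge {a b c d e x : Pt} (h : Pent a b c d e) (hx : 0 < D a b x) :
    x ∉ convexHull ℝ ({a, b, c, d, e} : Set Pt) := by
  obtain ⟨h1, h2, h3, -⟩ := h
  exact pent_sep (D_self3 _ _).le (D_self2 _ _).le h1.le h2.le h3.le hx


/-! ### A small verified checker for orientation case analyses -/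

/-- Case-analysis certificates: the leaves are instances of valid clauses, a split branches on
the orientation of a triple of indices. -/
inductive Ct : Type
  | I (p q r t : ℕ)
  | T (t u p q r : ℕ)
  | V (t u p q r : ℕ)
  | X (a b c d : ℕ)
  | S (a b c x : ℕ)
  | H (a b c d e : ℕ)
  | sp (i j k : ℕ) (l r : Ct)

/-- Read a bit of a mask. -/
def bt (m c : ℕ) : Bool := Nat.beq (Nat.land (Nat.shiftRight m c) 1) 1

/-- Code of a triple of indices. -/
def cd (i j k : ℕ) : ℕ := Nat.add i (Nat.add (Nat.mul 16 j) (Nat.mul 256 k))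

/-- Set the bit of a triple. -/
def st (m i j k : ℕ) : ℕ := Nat.lor m (Nat.shiftLeft 1 (cd i j k))

/-- Is the triple `i j k` known to be clockwise? -/
def rd (u : ℕ → ℕ → ℕ → Bool) (m i j k : ℕ) : Bool :=
  u i j k || (u j k i || (u k i j || (bt m (cd i j k) || (bt m (cd j k i) || bt m (cd k i j)))))

/-- Strict comparison of numerals. -/
def lt' (a b : ℕ) : Bool := Nat.ble (Nat.succ a) b

/-- Every index below `x` is a vertex of the pentagon or cut off by one of its edges. -/
def emp (u : ℕ → ℕ → ℕ → Bool) (m a b c d e : ℕ) : ℕ → Bool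
  | 0 => true
  | x + 1 => (Nat.beq x a || (Nat.beq x b || (Nat.beq x c || (Nat.beq x d || (Nat.beq x e ||
      (rd u m b a x || (rd u m c b x || (rd u m d c x || (rd u m e d x || rd u m a e x)))))))))
      && emp u m a b c d e x

/-- The certificate checker. -/
def chk (n na : ℕ) (u : ℕ → ℕ → ℕ → Bool) : Ct → ℕ → Bool
  | .I p q r t, m => lt' p n && (lt' q n && (lt' r n && (lt' t n &&
      (rd u m t q r && (rd u m p t r && (rd u m p q t && rd u m q p r))))))
  | .T t v p q r, m => lt' p n && (lt' q n && (lt' r n && (lt' t n && (lt' v n &&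
      (rd u m t v p && (rd u m t v q && (rd u m t v r && (rd u m t p q && (rd u m t q r &&
        rd u m p t r)))))))))
  | .V t v p q r, m => lt' p n && (lt' q n && (lt' r n && (lt' t n && (lt' v n &&
      (rd u m v t p && (rd u m v t q && (rd u m v t r && (rd u m t p q && (rd u m t q r &&
        rd u m p t r)))))))))
  | .X a b c d, m => lt' a na && (lt' b na && (lt' a n && (lt' b n &&
      (lt' c n && (lt' d n && (Nat.ble na c && (Nat.ble na d &&
      (rd u m a b c && (rd u m b a d && (rd u m d c a && rd u m c d b))))))))))
  | .S a b c x, m => lt' a n && (lt' b n && (lt' c n && (lt' x n &&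
      (((lt' a na && (lt' b na && (lt' c na && Nat.ble na x))) ||
        (Nat.ble na a && (Nat.ble na b && (Nat.ble na c && lt' x na)))) &&
      (rd u m a b x && (rd u m b c x && rd u m c a x))))))
  | .H a b c d e, m => lt' a n && (lt' b n && (lt' c n && (lt' d n && (lt' e n &&
      ((lt' a na || (lt' b na || (lt' c na || (lt' d na || lt' e na)))) &&
      ((Nat.ble na a || (Nat.ble na b || (Nat.ble na c || (Nat.ble na d || Nat.ble na e)))) &&
      (rd u m a b c && (rd u m a b d && (rd u m a b e && (rd u m a c d && (rd u m a c e &&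
      (rd u m a d e && (rd u m b c d && (rd u m b c e && (rd u m b d e && (rd u m c d e &&
        emp u m a b c d e n))))))))))))))))
  | .sp i j k l r, m => lt' i n && (lt' j n && (lt' k n && (!(Nat.beq i j) && (!(Nat.beq i k) &&
      (!(Nat.beq j k) && (chk n na u l (st m i j k) && chk n na u r (st m j i k)))))))

lemma bt_iff (m c : ℕ) : bt m c = true ↔ m.testBit c = true := by
  unfold bt
  rw [Nat.testBit]
  show Nat.beq ((m >>> c) &&& 1) 1 = true ↔ _
  rw [Nat.beq_eq, Nat.and_comm, Nat.one_and_eq_mod_two]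
  rcases Nat.mod_two_eq_zero_or_one (m >>> c) with h | h <;> simp [h]

/-- The geometric facts behind a checker run. -/
structure Cfg (n na : ℕ) (u : ℕ → ℕ → ℕ → Bool) (f : ℕ → Pt) : Prop where
  hn : n ≤ 16
  gp : ∀ i j k, i < n → j < n → k < n → i ≠ j → i ≠ k → j ≠ k → D (f i) (f j) (f k) ≠ 0
  sep : ∃ v c, (∀ i, i < na → i < n → dotp v (f i) < c) ∧ ∀ i, na ≤ i → i < n → c < dotp v (f i)
  unit : ∀ i j k, i < n → j < n → k < n → u i j k = true → D (f i) (f j) (f k) < 0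
  hole : ∀ a b c d e, a < n → b < n → c < n → d < n → e < n →
    Pent (f a) (f b) (f c) (f d) (f e) →
    (a < na ∨ b < na ∨ c < na ∨ d < na ∨ e < na) →
    (na ≤ a ∨ na ≤ b ∨ na ≤ c ∨ na ≤ d ∨ na ≤ e) →
    (∀ x, x < n → x ≠ a → x ≠ b → x ≠ c → x ≠ d → x ≠ e →
      f x ∉ convexHull ℝ ({f a, f b, f c, f d, f e} : Set Pt)) → False

/-- All bits of the mask are true facts. -/
def MaskOK (f : ℕ → Pt) (m : ℕ) : Prop :=
  ∀ i j k, i < 16 → j < 16 → k < 16 → bt m (cd i j k) = true → D (f i) (f j) (f k) < 0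

lemma MaskOK.zero (f : ℕ → Pt) : MaskOK f 0 := by
  intro i j k _ _ _ h
  rw [bt_iff] at h
  simp at h

lemma MaskOK.st {f : ℕ → Pt} {m i j k : ℕ} (h : MaskOK f m) (hi : i < 16) (hj : j < 16)
    (hk : k < 16) (hD : D (f i) (f j) (f k) < 0) : MaskOK f (st m i j k) := by
  intro a b c ha hb hc hb'
  rw [bt_iff] at hb'
  unfold _root_.st at hb'
  have e : Nat.lor m (Nat.shiftLeft 1 (cd i j k)) = m ||| (1 <<< cd i j k) := rfl
  rw [e, Nat.testBit_or, Nat.shiftLeft_eq, one_mul, Nat.testBit_two_pow] at hb'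
  rcases Bool.or_eq_true _ _ |>.mp hb' with h1 | h1
  · exact h a b c ha hb hc ((bt_iff _ _).2 h1)
  · have h2 : cd i j k = cd a b c := by simpa using h1
    have h3 : i + (16 * j + 256 * k) = a + (16 * b + 256 * c) := h2
    have h4 : i = a ∧ j = b ∧ k = c := by omega
    obtain ⟨rfl, rfl, rfl⟩ := h4
    exact hD

lemma lt'_iff (a b : ℕ) : lt' a b = true ↔ a < b := by
  unfold lt'; rw [Nat.ble_eq]; omega

lemma rd_sound {n na : ℕ} {u : ℕ → ℕ → ℕ → Bool} {f : ℕ → Pt} (C : Cfg n na u f) {m : ℕ}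
    (hm : MaskOK f m) {i j k : ℕ} (hi : i < n) (hj : j < n) (hk : k < n)
    (h : rd u m i j k = true) : D (f i) (f j) (f k) < 0 := by
  have hn := C.hn
  unfold rd at h
  simp only [Bool.or_eq_true] at h
  rcases h with h | h | h | h | h | h
  · exact C.unit _ _ _ hi hj hk h
  · rw [← D_rot]; exact C.unit _ _ _ hj hk hi h
  · rw [← D_rot']; exact C.unit _ _ _ hk hi hj h
  · exact hm _ _ _ (by omega) (by omega) (by omega) h
  · rw [← D_rot]; exact hm _ _ _ (by omega) (by omega) (by omega) h
  · rw [← D_rot']; exact hm _ _ _ (by omega) (by omega) (by omega) h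

lemma rot5 (a b c d e : Pt) : ({a, b, c, d, e} : Set Pt) = {b, c, d, e, a} := by
  rw [Set.insert_comm a b, Set.insert_comm a c, Set.insert_comm a d, Set.pair_comm a e]

lemma emp_sound {n na : ℕ} {u : ℕ → ℕ → ℕ → Bool} {f : ℕ → Pt} (C : Cfg n na u f) {m : ℕ}
    (hm : MaskOK f m) {a b c d e : ℕ} (ha : a < n) (hb : b < n) (hc : c < n) (hd : d < n)
    (he : e < n) (P : Pent (f a) (f b) (f c) (f d) (f e)) :
    ∀ N, N ≤ n → emp u m a b c d e N = true → ∀ x, x < N → x ≠ a → x ≠ b → x ≠ c → x ≠ d → x ≠ e →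
      f x ∉ convexHull ℝ ({f a, f b, f c, f d, f e} : Set Pt) := by
  intro N
  induction N with
  | zero => intro _ _ x hx; omega
  | succ N ih =>
    intro hN h x hx na nb nc nd ne
    simp only [emp, Bool.and_eq_true, Bool.or_eq_true, Nat.beq_eq] at h
    obtain ⟨h1, h2⟩ := h
    rcases Nat.lt_succ_iff_lt_or_eq.1 hx with h3 | rfl
    · exact ih (by omega) h2 x h3 na nb nc nd ne
    · have hx' : x < n := by omega
      have key : ∀ {i j : ℕ}, i < n → j < n → rd u m j i x = true → 0 < D (f i) (f j) (f x) := by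
        intro i j hi hj h
        have := rd_sound C hm hj hi hx' h
        rw [D_swap]; linarith
      rcases h1 with h | h | h | h | h | h | h | h | h | h
      · exact absurd h na
      · exact absurd h nb
      · exact absurd h nc
      · exact absurd h nd
      · exact absurd h ne
      · exact P.sep_edge (key ha hb h)
      · rw [rot5]; exact P.rot.sep_edge (key hb hc h)
      · rw [rot5, rot5]; exact P.rot.rot.sep_edge (key hc hd h)
      · rw [rot5, rot5, rot5]; exact P.rot.rot.rot.sep_edge (key hd he h)
      · rw [rot5, rot5, rot5, rot5]; exact P.rot.rot.rot.rot.sep_edge (key he ha h)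

lemma chk_sound {n na : ℕ} {u : ℕ → ℕ → ℕ → Bool} {f : ℕ → Pt} (C : Cfg n na u f) (t : Ct) :
    ∀ m, MaskOK f m → chk n na u t m = true → False := by
  have hn := C.hn
  obtain ⟨v, c0, hs1, hs2⟩ := C.sep
  induction t with
  | I p q r t =>
    intro m hm h
    simp only [chk, Bool.and_eq_true, lt'_iff] at h
    obtain ⟨hp, hq, hr, ht, h1, h2, h3, h4⟩ := h
    have k1 := rd_sound C hm ht hq hr h1
    have k2 := rd_sound C hm hp ht hr h2
    have k3 := rd_sound C hm hp hq ht h3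
    have k4 := rd_sound C hm hq hp hr h4
    have := D_add (f p) (f q) (f r) (f t)
    rw [D_swap] at k4
    linarith
  | T t w p q r =>
    intro m hm h
    simp only [chk, Bool.and_eq_true, lt'_iff] at h
    obtain ⟨hp, hq, hr, ht, hv, h1, h2, h3, h4, h5, h6⟩ := h
    have k := D_trans (rd_sound C hm ht hv hp h1) (rd_sound C hm ht hv hq h2)
      (rd_sound C hm ht hv hr h3) (rd_sound C hm ht hp hq h4) (rd_sound C hm ht hq hr h5)
    have k6 := rd_sound C hm hp ht hr h6
    rw [D_swap] at k6
    linarith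
  | V t w p q r =>
    intro m hm h
    simp only [chk, Bool.and_eq_true, lt'_iff] at h
    obtain ⟨hp, hq, hr, ht, hv, h1, h2, h3, h4, h5, h6⟩ := h
    have k1 := rd_sound C hm hv ht hp h1
    have k2 := rd_sound C hm hv ht hq h2
    have k3 := rd_sound C hm hv ht hr h3
    rw [D_swap] at k1 k2 k3
    have k := D_trans' (neg_neg_iff_pos.1 k1) (neg_neg_iff_pos.1 k2) (neg_neg_iff_pos.1 k3)
      (rd_sound C hm ht hp hq h4) (rd_sound C hm ht hq hr h5)
    have k6 := rd_sound C hm hp ht hr h6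
    rw [D_swap] at k6
    linarith
  | X a b c d =>
    intro m hm h
    simp only [chk, Bool.and_eq_true, lt'_iff, Nat.ble_eq] at h
    obtain ⟨ha', hb', ha, hb, hc, hd, hc', hd', h1, h2, h3, h4⟩ := h
    exact sep_seg (hs1 a ha' ha) (hs1 b hb' hb) (hs2 c hc' hc) (hs2 d hd' hd)
      (rd_sound C hm ha hb hc h1) (rd_sound C hm hb ha hd h2) (rd_sound C hm hd hc ha h3)
      (rd_sound C hm hc hd hb h4)
  | S a b c x =>
    intro m hm h
    simp only [chk, Bool.and_eq_true, lt'_iff, Nat.ble_eq, Bool.or_eq_true] at h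
    obtain ⟨ha, hb, hc, hx, h0, h1, h2, h3⟩ := h
    have k1 := rd_sound C hm ha hb hx h1
    have k2 := rd_sound C hm hb hc hx h2
    have k3 := rd_sound C hm hc ha hx h3
    rcases h0 with ⟨g1, g2, g3, g4⟩ | ⟨g1, g2, g3, g4⟩
    · exact sep_tri (hs1 a g1 ha) (hs1 b g2 hb) (hs1 c g3 hc) (hs2 x g4 hx) k1 k2 k3
    · exact sep_tri' (hs2 a g1 ha) (hs2 b g2 hb) (hs2 c g3 hc) (hs1 x g4 hx) k1 k2 k3
  | H a b c d e =>
    intro m hm h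
    simp only [chk, Bool.and_eq_true, lt'_iff, Nat.ble_eq, Bool.or_eq_true] at h
    obtain ⟨ha, hb, hc, hd, he, g1, g2, h1, h2, h3, h4, h5, h6, h7, h8, h9, h10, h11⟩ := h
    have P : Pent (f a) (f b) (f c) (f d) (f e) :=
      ⟨rd_sound C hm ha hb hc h1, rd_sound C hm ha hb hd h2, rd_sound C hm ha hb he h3,
        rd_sound C hm ha hc hd h4, rd_sound C hm ha hc he h5, rd_sound C hm ha hd he h6,
        rd_sound C hm hb hc hd h7, rd_sound C hm hb hc he h8, rd_sound C hm hb hd he h9,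
        rd_sound C hm hc hd he h10⟩
    exact C.hole a b c d e ha hb hc hd he P g1 g2
      (emp_sound C hm ha hb hc hd he P n le_rfl h11)
  | sp i j k l r ihl ihr =>
    intro m hm h
    simp only [chk, Bool.and_eq_true, lt'_iff, Bool.not_eq_true'] at h
    obtain ⟨hi, hj, hk, hij, hik, hjk, h1, h2⟩ := h
    have hij := Nat.ne_of_beq_eq_false hij
    have hik := Nat.ne_of_beq_eq_false hik
    have hjk := Nat.ne_of_beq_eq_false hjk
    rcases lt_or_gt_of_ne (C.gp i j k hi hj hk hij hik hjk) with g | g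
    · exact ihl _ (hm.st (by omega) (by omega) (by omega) g) h1
    · refine ihr _ (hm.st (by omega) (by omega) (by omega) ?_) h2
      rw [D_swap]; linarith

/-- Entry of a list of small numbers. -/
def nth : List ℕ → ℕ → ℕ
  | [], _ => 0
  | x :: _, 0 => x
  | _ :: l, k + 1 => nth l k

/-- The orientations known in advance in a window of three wedges: index `0` is the apex, indices
`1, …, 4` are the consecutive points `p`, and the remaining indices are points of `B` in the wedges
given by `ws`. -/
def uW (ws : List ℕ) (a b c : ℕ) : Bool :=
  match a with
  | 0 => lt' 0 b && (lt' 0 c && (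
      bif lt' b 5 then
        (bif lt' c 5 then lt' b c else Nat.ble b (Nat.succ (nth ws (Nat.sub c 5))))
      else
        (bif lt' c 5 then lt' (Nat.succ (nth ws (Nat.sub b 5))) c else lt' b c)))
  | a' + 1 => lt' a' 4 && (lt' 0 b && (lt' b 5 && (
      bif lt' c 5 then lt' (Nat.succ a') b && lt' b c
      else Nat.beq a' b && (Nat.ble b (Nat.add (nth ws (Nat.sub c 5)) 2) &&
        Nat.ble (nth ws (Nat.sub c 5)) b))))


/-! ### Certificates for windows of three wedges -/

/-- Certificate for wedge sizes `(0, 3, 0)`. -/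
def ct030 : Ct :=
    .sp 3 1 6 (.sp 4 2 5 (.sp 4 2 6 (.sp 4 1 5 (.sp 4 5 6 (.sp 3 5 6 (.sp 3 6 7 (.sp 3 5 7 (.sp 5
  2 6 (.sp 6 5 7 (.sp 5 2 7 (.sp 5 1 6 (.sp 6 2 7 (.sp 5 1 7 (.sp 6 1 7 (.H 1 7 6 5 2) (.V 6 1 0 5
  7)) (.T 5 7 0 1 6)) (.V 6 2 0 5 7)) (.V 5 1 0 2 6)) (.H 0 2 5 7 3)) (.H 0 5 6 7 3)) (.H 0 2 5 6
  3)) (.T 3 0 5 6 7)) (.sp 6 4 7 (.sp 2 6 7 (.sp 1 6 7 (.sp 5 6 7 (.sp 2 5 7 (.sp 5 3 7 (.sp 5 4 7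
  (.H 3 7 5 6 4) (.V 5 0 3 7 4)) (.H 0 2 5 7 3)) (.sp 5 1 7 (.sp 5 2 6 (.sp 1 5 6 (.V 1 0 5 6 7)
  (.H 1 6 7 5 2)) (.V 2 0 5 6 7)) (.V 5 1 0 2 7))) (.T 6 3 0 5 7)) (.T 6 3 0 1 7)) (.T 6 3 0 2 7))
  (.V 6 0 3 7 4))) (.V 5 0 3 6 4)) (.sp 1 5 6 (.sp 2 5 6 (.sp 3 6 7 (.sp 5 3 6 (.sp 6 2 7 (.sp 6 5
  7 (.sp 6 1 7 (.sp 4 6 7 (.sp 4 5 7 (.sp 3 5 7 (.H 3 6 5 7 4) (.V 5 0 3 7 4)) (.sp 1 5 7 (.sp 2 5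
  7 (.H 1 5 7 6 2) (.T 5 4 0 2 7)) (.T 5 4 0 1 7))) (.T 6 4 0 2 7)) (.V 6 1 0 2 7)) (.T 6 7 0 5
  3)) (.H 0 2 6 7 3)) (.H 0 2 5 6 3)) (.sp 6 4 7 (.sp 2 6 7 (.sp 5 4 7 (.sp 2 5 7 (.sp 6 5 7 (.sp
  5 3 7 (.sp 5 3 6 (.H 3 7 6 5 4) (.V 5 0 3 7 6)) (.H 0 2 5 7 3)) (.H 0 2 5 6 7)) (.V 2 0 5 6 7))
  (.T 4 0 5 7 6)) (.T 6 3 0 2 7)) (.V 6 0 3 7 4))) (.T 5 4 0 2 6)) (.T 5 4 0 1 6))) (.V 1 0 2 4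
  5)) (.I 2 3 6 4)) (.I 2 3 5 4)) (.I 1 2 6 3)

lemma ct030_ok : chk 8 5 (uW [1, 1, 1]) ct030 0 = true := by decide +kernel

/-- Certificate for wedge sizes `(0, 0, 4)`. -/
def ct004 : Ct :=
    .sp 4 2 5 (.sp 4 2 6 (.sp 4 2 7 (.sp 4 2 8 (.sp 4 1 5 (.sp 4 1 6 (.sp 4 1 7 (.sp 4 1 8 (.sp 4
  6 7 (.sp 4 7 8 (.sp 4 6 8 (.sp 7 6 8 (.sp 5 6 7 (.sp 4 5 6 (.sp 5 4 7 (.sp 3 5 7 (.sp 6 3 7 (.T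
  7 0 3 5 6) (.H 0 3 6 7 4)) (.T 5 4 0 3 7)) (.H 0 5 6 7 4)) (.T 6 7 0 5 4)) (.sp 6 5 8 (.sp 7 5 8
  (.sp 6 3 7 (.sp 7 3 8 (.sp 6 2 7 (.sp 6 3 8 (.sp 6 1 7 (.sp 7 2 8 (.sp 7 1 8 (.sp 6 2 8 (.sp 3 5
  7 (.sp 3 5 6 (.sp 5 4 6 (.sp 3 1 6 (.sp 1 5 6 (.sp 2 5 6 (.sp 3 1 5 (.sp 3 1 7 (.sp 5 2 7 (.sp 5
  3 8 (.sp 5 1 7 (.sp 5 2 8 (.sp 5 1 8 (.sp 1 2 6 (.sp 2 1 5 (.sp 2 1 8 (.sp 1 2 7 (.H 1 2 7 6 3)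
  (.H 1 8 7 5 2)) (.V 1 0 2 8 5)) (.H 1 2 5 6 3)) (.sp 2 1 5 (.sp 2 1 7 (.sp 2 1 8 (.H 1 8 7 5 2)
  (.T 2 8 0 1 6)) (.T 2 7 0 1 6)) (.V 1 0 2 5 6))) (.V 5 1 0 3 8)) (.V 5 2 0 3 8)) (.H 1 5 7 6 3))
  (.H 3 5 8 7 6)) (.H 2 5 7 6 3)) (.V 3 6 1 2 7)) (.V 1 0 3 5 6)) (.T 5 4 0 2 6)) (.T 5 4 0 1 6))
  (.H 0 1 3 6 4)) (.H 0 3 5 6 4)) (.T 5 7 0 3 6)) (.sp 5 2 7 (.sp 5 3 8 (.sp 2 5 8 (.V 5 2 0 3 8)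
  (.H 2 8 7 5 3)) (.T 5 8 0 3 7)) (.V 5 2 0 3 7))) (.V 6 2 0 3 8)) (.H 0 1 7 8 4)) (.V 7 2 0 3 8))
  (.H 0 1 6 7 4)) (.T 6 8 0 3 7)) (.V 6 2 0 3 7)) (.H 0 3 7 8 4)) (.H 0 3 6 7 4)) (.V 7 5 0 6 8))
  (.T 6 8 0 5 7))) (.H 0 6 7 8 4)) (.sp 3 6 8 (.sp 7 6 8 (.sp 3 6 7 (.sp 5 6 7 (.sp 4 5 7 (.sp 5 4
  6 (.T 6 7 0 5 4) (.H 0 5 6 7 4)) (.H 0 3 6 7 4)) (.H 0 3 6 7 4)) (.T 6 8 0 3 7)) (.V 8 7 0 6 4))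
  (.T 6 4 0 3 8))) (.sp 3 7 8 (.sp 1 7 8 (.sp 2 7 8 (.sp 6 7 8 (.sp 3 6 7 (.sp 3 6 8 (.sp 5 6 7
  (.sp 5 7 8 (.sp 6 5 8 (.V 5 0 6 7 8) (.H 0 5 6 7 8)) (.V 7 6 0 5 8)) (.H 0 3 6 7 8)) (.V 3 0 6 7
  8)) (.sp 6 2 7 (.sp 2 5 7 (.sp 3 5 7 (.sp 6 5 7 (.sp 2 5 6 (.sp 3 5 6 (.H 2 5 7 6 3) (.T 5 7 0 3
  6)) (.T 5 7 0 2 6)) (.T 7 0 3 5 6)) (.V 5 2 0 3 7)) (.sp 4 5 7 (.sp 5 7 8 (.sp 5 6 7 (.sp 5 6 8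
  (.H 0 5 6 7 8) (.V 5 0 6 7 8)) (.sp 3 5 6 (.sp 3 6 8 (.sp 3 5 8 (.sp 6 5 8 (.sp 5 4 6 (.sp 6 4 8
  (.sp 4 5 8 (.V 8 5 0 6 4) (.H 4 8 6 5 7)) (.H 0 3 6 8 4)) (.H 0 3 5 6 4)) (.H 0 3 5 6 8)) (.V 3
  0 5 6 8)) (.sp 6 2 8 (.sp 4 6 8 (.sp 3 1 6 (.sp 3 1 7 (.sp 5 6 8 (.sp 4 5 6 (.sp 4 5 8 (.H 0 5 6
  8 4) (.V 8 6 0 5 4)) (.T 6 8 0 5 4)) (.sp 6 1 8 (.sp 5 4 6 (.sp 6 1 7 (.sp 1 5 6 (.sp 2 5 6 (.sp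
  3 1 5 (.sp 3 1 8 (.sp 3 5 8 (.sp 5 3 7 (.sp 5 2 8 (.sp 5 1 8 (.sp 5 1 7 (.sp 1 2 6 (.sp 2 1 5
  (.sp 2 1 8 (.sp 1 2 7 (.H 1 2 7 6 3) (.H 1 7 8 5 2)) (.V 1 0 2 8 5)) (.H 1 2 5 6 3)) (.sp 2 1 5
  (.sp 2 1 7 (.sp 2 1 8 (.H 1 7 8 5 2) (.T 2 8 0 1 6)) (.T 2 7 0 1 6)) (.V 1 0 2 5 6))) (.V 5 1 0
  3 7)) (.H 1 5 8 6 3)) (.H 2 5 8 6 3)) (.H 3 5 7 8 6)) (.sp 5 2 8 (.sp 5 3 7 (.H 2 7 8 5 3) (.T 5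
  7 0 3 8)) (.V 5 2 0 3 8))) (.H 0 1 3 8 4)) (.V 1 0 3 5 6)) (.T 5 4 0 2 6)) (.T 5 4 0 1 6)) (.V 1
  0 6 7 8)) (.H 0 3 5 6 4)) (.H 0 1 6 8 4))) (.V 3 6 1 2 7)) (.H 0 1 3 6 4)) (.T 6 4 0 3 8)) (.V 6
  2 0 3 8))) (.sp 5 2 6 (.sp 5 3 7 (.H 2 7 6 5 3) (.T 5 7 0 3 6)) (.V 5 2 0 3 6)))) (.V 7 2 0 5
  8)) (.T 5 4 0 2 7))) (.V 6 2 0 3 7))) (.sp 3 6 8 (.sp 3 6 7 (.sp 5 6 7 (.sp 4 5 7 (.sp 4 5 6 (.H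
  0 5 6 7 4) (.T 6 7 0 5 4)) (.H 0 3 6 7 4)) (.H 0 3 6 7 4)) (.T 6 8 0 3 7)) (.T 8 0 3 7 6))) (.T
  7 4 0 2 8)) (.T 7 4 0 1 8)) (.T 7 4 0 3 8))) (.sp 3 6 7 (.sp 1 6 7 (.sp 2 6 7 (.sp 3 5 7 (.sp 5
  7 8 (.sp 3 5 8 (.sp 3 7 8 (.sp 3 5 6 (.sp 3 6 8 (.sp 6 5 7 (.sp 7 6 8 (.V 7 5 0 6 8) (.H 0 3 6 7
  8)) (.H 0 3 5 6 7)) (.V 3 0 6 7 8)) (.H 0 3 5 7 8)) (.V 7 5 0 3 8)) (.T 5 7 0 3 8)) (.sp 5 4 7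
  (.sp 1 5 7 (.sp 2 5 7 (.sp 6 7 8 (.sp 6 5 7 (.sp 7 4 8 (.sp 3 7 8 (.sp 3 6 8 (.H 0 3 6 7 8) (.V
  3 0 6 7 8)) (.T 7 4 0 3 8)) (.T 7 8 0 6 4)) (.V 7 6 0 5 8)) (.sp 4 7 8 (.sp 7 3 8 (.sp 3 1 7
  (.sp 7 2 8 (.sp 7 1 8 (.sp 3 1 5 (.sp 3 1 6 (.sp 3 1 8 (.sp 5 6 7 (.sp 5 3 6 (.sp 5 2 6 (.sp 4 5
  6 (.sp 5 1 6 (.sp 2 6 8 (.sp 3 6 8 (.sp 5 6 8 (.sp 2 5 8 (.sp 3 5 8 (.H 2 5 8 7 3) (.V 5 2 0 3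
  8)) (.sp 4 5 8 (.sp 3 5 8 (.sp 5 1 8 (.sp 6 4 8 (.sp 1 6 8 (.sp 1 2 8 (.sp 1 2 5 (.sp 1 2 7 (.sp
  2 1 6 (.H 1 2 5 7 3) (.H 1 2 6 8 5)) (.V 1 0 2 8 7)) (.V 1 0 2 8 5)) (.sp 2 1 6 (.sp 1 2 5 (.sp
  2 1 7 (.V 1 0 2 5 7) (.H 1 2 5 7 3)) (.H 1 6 8 5 2)) (.V 1 0 2 6 8))) (.T 6 4 0 1 8)) (.H 4 7 5
  6 8)) (.H 1 5 8 7 3)) (.H 2 6 8 5 3)) (.T 5 4 0 2 8))) (.V 6 2 0 5 8)) (.V 6 2 0 3 8)) (.sp 5 2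
  8 (.sp 4 6 8 (.sp 4 5 8 (.sp 6 5 8 (.sp 6 3 8 (.sp 3 5 8 (.V 3 0 5 8 6) (.H 2 8 6 5 3)) (.V 6 3
  0 5 8)) (.H 4 7 5 6 8)) (.T 5 4 0 2 8)) (.T 6 4 0 2 8)) (.V 2 0 5 8 6))) (.H 0 1 5 6 7)) (.T 5 4
  0 3 6)) (.V 5 2 0 3 6)) (.H 0 3 5 6 7)) (.sp 2 5 6 (.sp 3 5 6 (.sp 1 5 6 (.sp 5 4 6 (.sp 6 5 8
  (.sp 2 6 8 (.sp 3 6 8 (.H 2 6 8 7 3) (.V 6 2 0 3 8)) (.sp 4 6 8 (.sp 5 4 8 (.sp 1 5 8 (.sp 2 5 8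
  (.sp 3 5 8 (.sp 3 6 8 (.sp 6 1 8 (.sp 1 2 6 (.sp 2 1 5 (.sp 2 1 7 (.sp 1 2 8 (.V 1 0 2 8 7) (.H
  1 5 8 7 2)) (.H 1 2 6 7 3)) (.H 1 2 5 6 3)) (.sp 2 1 5 (.sp 2 1 8 (.H 1 5 8 6 2) (.T 2 8 0 1 6))
  (.V 1 0 2 5 6))) (.H 1 6 8 7 3)) (.H 2 5 8 6 3)) (.V 5 1 0 3 8)) (.T 5 4 0 2 8)) (.T 5 4 0 1 8))
  (.H 4 7 6 5 8)) (.T 6 4 0 2 8))) (.T 6 8 0 5 7)) (.T 6 4 0 5 7)) (.V 6 1 0 5 7)) (.T 5 7 0 3 6))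
  (.T 5 7 0 2 6))) (.H 0 1 3 8 4)) (.V 1 0 3 6 7)) (.V 1 0 3 5 7)) (.H 0 1 7 8 4)) (.V 7 2 0 3 8))
  (.H 0 1 3 7 4)) (.H 0 3 7 8 4)) (.sp 3 7 8 (.sp 6 4 8 (.sp 5 4 8 (.sp 3 6 8 (.sp 5 6 7 (.sp 5 3
  6 (.sp 4 5 6 (.sp 5 6 8 (.H 4 8 7 5 6) (.V 6 3 0 5 8)) (.T 5 4 0 3 6)) (.H 0 3 5 6 7)) (.sp 5 4
  6 (.sp 5 6 8 (.T 6 8 0 5 7) (.H 4 8 7 6 5)) (.T 6 4 0 5 7))) (.V 3 0 6 7 8)) (.V 8 5 0 7 4)) (.T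
  4 0 6 8 7)) (.T 7 4 0 3 8)))) (.T 5 4 0 2 7)) (.T 5 4 0 1 7)) (.H 0 3 5 7 4))) (.sp 5 2 7 (.sp 5
  6 7 (.sp 5 2 6 (.sp 5 3 6 (.sp 6 7 8 (.sp 5 7 8 (.sp 6 5 8 (.V 5 0 6 7 8) (.H 0 5 6 7 8)) (.V 7
  6 0 5 8)) (.H 2 6 7 5 3)) (.T 5 6 0 3 7)) (.V 2 0 5 6 7)) (.T 7 0 3 6 5)) (.V 5 2 0 3 7))) (.T 6
  4 0 2 7)) (.T 6 4 0 1 7)) (.T 6 4 0 3 7))) (.T 4 0 1 3 8)) (.T 4 0 1 3 7)) (.T 4 0 1 3 6)) (.T 4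
  0 1 3 5)) (.I 2 3 8 4)) (.I 2 3 7 4)) (.I 2 3 6 4)) (.I 2 3 5 4)

lemma ct004_ok : chk 9 5 (uW [2, 2, 2, 2]) ct004 0 = true := by decide +kernel

/-- Certificate for wedge sizes `(4, 0, 0)`. -/
def ct400 : Ct :=
    .sp 3 1 5 (.sp 3 1 6 (.sp 3 1 7 (.sp 4 1 5 (.sp 4 1 6 (.sp 4 1 7 (.sp 1 6 7 (.sp 1 5 6 (.sp 5
  6 7 (.sp 1 5 7 (.H 0 1 5 6 7) (.T 5 6 0 1 7)) (.sp 1 7 8 (.sp 1 6 8 (.sp 7 6 8 (.sp 6 5 8 (.sp 7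
  5 8 (.sp 6 2 7 (.sp 7 2 8 (.sp 5 2 6 (.sp 5 2 8 (.sp 6 2 8 (.sp 5 3 6 (.sp 5 3 8 (.sp 3 6 8 (.V
  6 0 2 8 3) (.H 2 8 6 5 3)) (.V 5 0 2 8 3)) (.V 5 0 2 6 3)) (.T 2 0 6 8 7)) (.V 8 5 0 7 2)) (.H 0
  1 5 6 2)) (.H 0 1 7 8 2)) (.H 0 1 6 7 2)) (.V 7 5 0 6 8)) (.T 6 8 0 5 7)) (.H 0 1 6 7 8)) (.V 1
  0 6 7 8)) (.sp 2 7 8 (.sp 3 7 8 (.sp 4 7 8 (.sp 6 7 8 (.sp 2 6 7 (.sp 2 6 8 (.H 0 6 7 8 2) (.V 8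
  7 0 6 2)) (.T 7 8 0 6 2)) (.sp 6 5 8 (.sp 7 5 8 (.sp 6 2 7 (.sp 5 2 6 (.sp 6 3 7 (.sp 5 2 7 (.sp
  5 3 6 (.sp 1 5 7 (.sp 4 2 7 (.sp 4 2 6 (.sp 4 2 8 (.sp 6 4 7 (.sp 5 4 6 (.sp 2 6 8 (.sp 5 2 8
  (.sp 5 3 8 (.sp 5 4 8 (.sp 6 3 8 (.sp 6 4 8 (.sp 3 4 8 (.sp 3 4 7 (.H 2 7 8 3 4) (.V 3 8 0 7 4))
  (.sp 4 3 5 (.sp 4 3 6 (.H 3 8 6 5 4) (.V 3 6 0 8 4)) (.V 3 5 0 8 4))) (.H 2 7 6 8 4)) (.H 2 7 6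
  8 3)) (.T 8 4 0 5 2)) (.V 5 0 2 8 3)) (.H 2 7 6 5 8)) (.sp 6 3 8 (.sp 5 2 8 (.sp 3 5 8 (.V 8 5 0
  6 3) (.H 2 8 6 5 3)) (.V 8 5 0 6 2)) (.V 6 0 2 8 3))) (.T 6 4 0 5 2)) (.T 7 4 0 6 2)) (.T 4 0 2
  7 8)) (.V 2 6 0 7 4)) (.H 0 1 7 2 4)) (.T 5 2 0 1 7)) (.V 5 0 2 6 3)) (.V 7 5 0 6 2)) (.V 6 0 2
  7 3)) (.H 0 1 5 6 2)) (.H 0 1 6 7 2)) (.V 7 5 0 6 8)) (.T 6 8 0 5 7))) (.T 7 4 0 1 8)) (.T 7 3 0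
  1 8)) (.T 7 2 0 1 8)))) (.sp 2 5 6 (.sp 3 5 6 (.sp 4 5 6 (.sp 5 6 7 (.sp 2 5 8 (.sp 2 7 8 (.sp 2
  6 7 (.sp 2 5 7 (.sp 6 7 8 (.sp 2 6 8 (.H 0 6 7 8 2) (.V 8 7 0 6 2)) (.H 0 5 6 7 2)) (.V 7 6 0 5
  2)) (.sp 6 3 7 (.sp 7 6 8 (.sp 5 7 8 (.sp 5 2 7 (.sp 5 3 7 (.H 2 7 5 6 3) (.V 5 0 2 7 3)) (.H 0
  5 7 8 2)) (.sp 7 1 8 (.sp 3 7 8 (.sp 4 7 8 (.sp 3 6 8 (.sp 2 6 8 (.H 2 7 6 8 3) (.V 6 0 2 8 3))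
  (.sp 1 6 8 (.sp 5 6 8 (.sp 1 5 7 (.sp 5 2 7 (.sp 4 2 7 (.sp 5 3 7 (.sp 4 2 5 (.sp 5 4 7 (.sp 5 3
  8 (.sp 4 2 8 (.sp 5 4 8 (.sp 6 4 8 (.sp 3 4 8 (.sp 3 4 7 (.H 2 7 8 3 4) (.V 3 8 0 7 4)) (.sp 4 3
  5 (.sp 4 3 6 (.H 3 8 5 6 4) (.V 3 6 0 8 4)) (.V 3 5 0 8 4))) (.T 4 0 5 6 8)) (.H 2 7 5 8 4)) (.T
  4 0 2 7 8)) (.H 2 7 5 8 3)) (.T 7 4 0 5 2)) (.V 2 5 0 7 4)) (.V 5 0 2 7 3)) (.H 0 1 7 2 4)) (.H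
  0 1 5 7 2)) (.sp 5 1 8 (.H 1 6 8 7 5) (.V 1 0 5 8 7))) (.T 6 3 0 5 8)) (.T 6 3 0 1 8))) (.T 7 4
  0 1 8)) (.T 7 3 0 1 8)) (.H 0 1 7 8 2))) (.T 7 8 0 6 2)) (.V 6 0 2 7 3))) (.sp 7 3 8 (.sp 5 7 8
  (.sp 5 6 8 (.sp 7 6 8 (.sp 6 2 7 (.sp 6 3 7 (.sp 6 2 8 (.sp 6 3 8 (.H 2 8 7 6 3) (.V 8 6 0 7 3))
  (.V 8 6 0 7 2)) (.T 7 3 0 6 8)) (.T 7 2 0 6 8)) (.H 0 5 6 7 8)) (.V 5 0 6 7 8)) (.V 8 5 0 7 2))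
  (.V 7 0 2 8 3))) (.sp 5 3 8 (.sp 6 3 8 (.sp 5 6 8 (.sp 6 2 8 (.sp 5 7 8 (.sp 7 6 8 (.sp 7 2 8
  (.sp 6 2 7 (.sp 7 3 8 (.sp 3 6 7 (.V 6 0 2 7 3) (.H 2 8 7 6 3)) (.V 7 0 2 8 3)) (.T 7 2 0 6 8))
  (.V 8 7 0 5 2)) (.H 0 5 6 7 8)) (.H 2 8 5 6 3)) (.V 8 6 0 5 2)) (.V 5 0 3 8 6)) (.T 3 0 5 6 8))
  (.V 5 0 2 8 3))) (.V 6 1 0 5 7)) (.T 5 4 0 1 6)) (.T 5 3 0 1 6)) (.T 5 2 0 1 6))) (.sp 2 6 7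
  (.sp 3 6 7 (.sp 4 6 7 (.sp 2 6 8 (.sp 1 6 8 (.sp 6 7 8 (.sp 5 6 8 (.sp 7 2 8 (.sp 2 5 6 (.sp 2 5
  8 (.sp 5 6 7 (.sp 5 7 8 (.H 0 5 6 7 8) (.V 8 5 0 7 2)) (.H 0 5 6 8 2)) (.V 8 6 0 5 2)) (.T 6 8 0
  5 2)) (.H 0 6 7 8 2)) (.H 0 1 6 8 2)) (.T 6 8 0 1 7)) (.sp 3 6 8 (.sp 4 6 8 (.sp 5 6 7 (.sp 2 5
  6 (.sp 2 5 7 (.sp 6 7 8 (.sp 7 2 8 (.sp 5 7 8 (.sp 5 6 8 (.H 0 5 6 7 8) (.V 5 0 6 7 8)) (.T 7 2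
  0 5 8)) (.H 0 6 7 8 2)) (.H 0 5 6 7 2)) (.V 7 6 0 5 2)) (.T 6 7 0 5 2)) (.sp 5 6 8 (.sp 2 5 6
  (.sp 2 5 8 (.H 0 5 6 8 2) (.V 8 6 0 5 2)) (.T 6 8 0 5 2)) (.sp 1 5 6 (.sp 5 2 6 (.sp 4 2 6 (.sp
  5 3 6 (.sp 4 2 5 (.sp 5 4 6 (.sp 4 2 8 (.sp 4 2 7 (.sp 6 7 8 (.sp 7 2 8 (.sp 7 3 8 (.sp 1 7 8
  (.sp 7 4 8 (.sp 3 5 8 (.sp 2 5 8 (.H 2 6 5 8 3) (.V 5 0 2 8 3)) (.sp 1 5 8 (.sp 5 7 8 (.sp 5 1 7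
  (.sp 2 5 7 (.sp 3 5 7 (.sp 4 5 7 (.sp 2 5 8 (.sp 5 4 8 (.sp 3 4 8 (.sp 4 3 6 (.V 3 8 0 6 4) (.H
  2 6 8 3 4)) (.sp 4 3 5 (.sp 4 3 7 (.H 3 8 5 7 4) (.V 3 7 0 8 4)) (.V 3 5 0 8 4))) (.H 2 6 5 8
  4)) (.H 2 8 5 7 3)) (.T 5 4 0 1 7)) (.T 5 3 0 1 7)) (.T 5 2 0 1 7)) (.H 1 5 7 8 6)) (.sp 5 2 7
  (.sp 5 3 7 (.sp 5 2 8 (.H 2 8 7 5 3) (.V 8 5 0 7 2)) (.T 7 3 0 5 8)) (.T 7 2 0 5 8))) (.T 5 3 0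
  1 8))) (.H 0 6 7 8 4)) (.T 7 2 0 1 8)) (.V 7 0 2 8 3)) (.H 0 6 7 8 2)) (.sp 2 7 8 (.sp 3 7 8
  (.sp 7 5 8 (.sp 7 1 8 (.sp 4 7 8 (.sp 2 5 7 (.sp 5 3 7 (.sp 5 4 7 (.sp 1 5 7 (.sp 5 1 8 (.sp 3 5
  8 (.sp 4 5 8 (.sp 3 4 7 (.sp 3 4 6 (.sp 4 3 8 (.H 2 6 7 3 4) (.H 2 7 8 3 4)) (.V 3 7 0 6 4))
  (.sp 4 3 5 (.sp 4 3 8 (.H 3 7 5 8 4) (.V 3 8 0 7 4)) (.V 3 5 0 7 4))) (.T 5 4 0 1 8)) (.T 5 3 0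
  1 8)) (.H 1 5 8 7 6)) (.T 5 3 0 1 7)) (.H 2 6 5 7 4)) (.H 2 6 5 7 3)) (.sp 5 3 7 (.sp 1 5 7 (.sp
  5 1 8 (.sp 2 5 8 (.sp 3 5 8 (.H 2 7 5 8 3) (.T 5 3 0 1 8)) (.T 5 2 0 1 8)) (.H 1 5 8 7 6)) (.T 5
  2 0 1 7)) (.V 5 0 2 7 3))) (.T 7 4 0 1 8)) (.H 0 1 7 8 2)) (.V 7 5 0 6 8)) (.T 7 3 0 6 8)) (.T 7
  2 0 6 8))) (.T 4 0 2 6 7)) (.T 4 0 2 6 8)) (.T 6 4 0 5 2)) (.V 2 5 0 6 4)) (.V 5 0 2 6 3)) (.H 0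
  1 6 2 4)) (.H 0 1 5 6 2)) (.sp 5 1 8 (.sp 5 1 7 (.sp 2 5 7 (.sp 2 7 8 (.sp 7 6 8 (.sp 7 5 8 (.sp
  1 7 8 (.H 0 1 7 8 2) (.H 1 8 7 6 5)) (.V 7 5 0 6 8)) (.H 0 6 7 8 2)) (.sp 7 3 8 (.sp 1 7 8 (.sp
  5 7 8 (.sp 6 7 8 (.sp 7 4 8 (.H 1 7 8 6 5) (.H 0 6 7 8 4)) (.T 7 2 0 6 8)) (.T 7 2 0 5 8)) (.T 7
  2 0 1 8)) (.V 7 0 2 8 3))) (.T 5 2 0 1 7)) (.T 5 7 0 1 6)) (.V 1 0 5 8 6))))) (.T 6 4 0 1 8))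
  (.T 6 3 0 1 8))) (.sp 6 3 8 (.sp 1 6 8 (.sp 7 3 8 (.sp 6 7 8 (.sp 7 2 8 (.sp 6 5 8 (.sp 3 5 7
  (.sp 5 2 6 (.sp 5 3 6 (.sp 5 2 8 (.sp 5 3 8 (.H 2 8 6 5 3) (.V 8 5 0 6 3)) (.V 8 5 0 6 2)) (.T 6
  3 0 5 8)) (.T 6 2 0 5 8)) (.H 2 8 6 7 3)) (.H 2 8 6 7 3)) (.V 8 7 0 6 2)) (.T 6 8 0 1 7)) (.T 3
  0 6 7 8)) (.T 6 2 0 1 8)) (.V 6 0 2 8 3))) (.T 6 4 0 1 7)) (.T 6 3 0 1 7)) (.T 6 2 0 1 7))) (.V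
  1 0 2 4 7)) (.V 1 0 2 4 6)) (.V 1 0 2 4 5)) (.I 1 2 7 3)) (.I 1 2 6 3)) (.I 1 2 5 3)

lemma ct400_ok : chk 9 5 (uW [0, 0, 0, 0]) ct400 0 = true := by decide +kernel

/-- Certificate for wedge sizes `(1, 0, 3)`. -/
def ct103 : Ct :=
    .sp 3 1 5 (.sp 4 2 6 (.sp 4 2 7 (.sp 4 2 8 (.sp 4 1 5 (.sp 2 5 6 (.sp 2 5 7 (.sp 2 5 8 (.sp 3
  5 6 (.sp 3 5 7 (.sp 3 5 8 (.sp 4 1 6 (.sp 4 1 7 (.sp 4 1 8 (.sp 3 6 7 (.sp 4 7 8 (.sp 6 4 7 (.sp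
  7 3 8 (.sp 3 1 7 (.sp 1 6 7 (.sp 2 6 7 (.sp 7 6 8 (.sp 7 2 8 (.sp 3 1 8 (.sp 7 1 8 (.sp 7 5 8
  (.sp 6 5 8 (.sp 3 1 6 (.sp 6 5 7 (.sp 1 5 6 (.sp 5 4 6 (.sp 5 4 7 (.sp 2 6 8 (.sp 3 6 8 (.H 2 6
  8 7 3) (.V 6 2 0 3 8)) (.sp 4 6 8 (.sp 3 6 8 (.sp 6 1 8 (.sp 5 4 8 (.sp 1 5 8 (.sp 1 2 6 (.sp 1
  2 7 (.H 1 2 6 7 3) (.V 1 0 2 6 7)) (.sp 2 1 8 (.H 1 5 8 6 2) (.V 1 0 2 8 6))) (.T 5 4 0 1 8))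
  (.H 4 7 6 5 8)) (.H 1 6 8 7 3)) (.H 2 5 8 6 3)) (.T 6 4 0 2 8))) (.V 7 5 0 6 4)) (.T 6 4 0 5 7))
  (.V 6 1 0 5 7)) (.H 2 5 6 7 3)) (.V 1 0 3 6 7)) (.H 2 5 8 7 3)) (.V 7 5 0 3 8)) (.V 7 1 0 3 8))
  (.V 3 7 1 2 8)) (.V 7 2 0 3 8)) (.T 7 8 0 6 4)) (.T 6 4 0 2 7)) (.T 6 4 0 1 7)) (.H 0 1 3 7 4))
  (.H 0 3 7 8 4)) (.H 0 3 6 7 4)) (.sp 3 7 8 (.sp 2 7 8 (.sp 3 6 8 (.sp 7 6 8 (.sp 7 5 8 (.sp 2 6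
  7 (.sp 6 4 8 (.sp 6 4 7 (.sp 6 5 7 (.sp 6 5 8 (.sp 5 4 7 (.sp 5 4 8 (.sp 4 5 6 (.T 6 4 0 5 8)
  (.H 4 8 7 6 5)) (.V 8 5 0 7 4)) (.T 7 4 0 5 8)) (.V 5 0 6 8 7)) (.H 2 5 6 7 3)) (.V 6 0 4 8 7))
  (.H 0 3 6 8 4)) (.V 7 2 0 6 8)) (.H 2 5 7 8 3)) (.H 0 3 6 7 8)) (.V 3 0 6 7 8)) (.T 7 4 0 2 8))
  (.T 7 4 0 3 8))) (.sp 6 2 7 (.sp 6 5 7 (.sp 5 7 8 (.sp 7 6 8 (.V 7 5 0 6 8) (.H 2 5 7 6 3)) (.H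
  2 5 7 6 3)) (.V 6 5 0 3 7)) (.V 6 2 0 3 7))) (.T 4 0 1 3 8)) (.T 4 0 1 3 7)) (.T 4 0 1 3 6)) (.V
  3 5 0 2 8)) (.V 3 5 0 2 7)) (.V 3 5 0 2 6)) (.T 2 8 0 5 3)) (.T 2 7 0 5 3)) (.T 2 6 0 5 3)) (.V
  1 0 2 4 5)) (.I 2 3 8 4)) (.I 2 3 7 4)) (.I 2 3 6 4)) (.I 1 2 5 3)

lemma ct103_ok : chk 9 5 (uW [0, 2, 2, 2]) ct103 0 = true := by decide +kernel

/-- Certificate for wedge sizes `(3, 0, 1)`. -/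
def ct301 : Ct :=
    .sp 3 1 5 (.sp 3 1 6 (.sp 4 1 5 (.sp 4 1 6 (.sp 4 1 7 (.sp 2 5 8 (.sp 2 6 8 (.sp 2 7 8 (.sp 3
  5 8 (.sp 3 6 8 (.sp 3 7 8 (.sp 6 7 8 (.sp 2 6 7 (.sp 3 6 7 (.sp 5 2 6 (.sp 5 6 7 (.T 6 7 0 5 2)
  (.H 2 6 7 8 3)) (.H 2 6 7 8 3)) (.V 6 0 3 7 8)) (.V 6 0 2 7 8)) (.sp 2 6 7 (.sp 5 6 7 (.sp 2 5 6
  (.sp 2 5 7 (.H 0 5 6 7 2) (.V 7 6 0 5 2)) (.T 6 7 0 5 2)) (.sp 6 5 8 (.sp 7 5 8 (.sp 6 1 7 (.sp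
  3 6 7 (.sp 4 6 7 (.sp 6 1 8 (.sp 7 1 8 (.sp 4 7 8 (.sp 1 5 6 (.sp 5 2 6 (.sp 5 3 6 (.sp 4 2 6
  (.sp 5 4 6 (.sp 4 2 5 (.sp 4 2 7 (.sp 3 5 7 (.sp 5 2 7 (.V 5 0 2 7 3) (.H 2 6 5 7 3)) (.sp 2 5 7
  (.sp 1 5 7 (.sp 5 4 7 (.sp 5 1 8 (.sp 4 5 8 (.sp 3 4 7 (.sp 4 3 6 (.V 3 7 0 6 4) (.H 2 6 7 3 4))
  (.sp 4 3 5 (.H 3 7 5 8 4) (.V 3 5 0 7 4))) (.T 5 4 0 1 8)) (.H 1 5 8 7 6)) (.H 2 6 5 7 4)) (.T 5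
  3 0 1 7)) (.H 2 7 5 8 3))) (.H 0 1 7 2 4)) (.V 2 5 0 6 4)) (.H 0 1 5 6 4)) (.H 0 1 6 2 4)) (.V 5
  0 2 6 3)) (.H 0 1 5 6 2)) (.sp 5 1 7 (.sp 5 1 8 (.H 1 8 7 6 5) (.T 5 8 0 1 6)) (.T 5 7 0 1 6)))
  (.T 7 4 0 6 8)) (.V 7 1 0 6 8)) (.T 6 8 0 1 7)) (.T 6 4 0 1 7)) (.T 6 3 0 1 7)) (.H 0 1 6 7 2))
  (.V 7 5 0 6 8)) (.T 6 8 0 5 7))) (.sp 6 3 7 (.sp 6 5 7 (.sp 5 6 8 (.T 6 8 0 5 7) (.H 2 7 6 8 3))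
  (.H 2 7 6 8 3)) (.V 6 0 2 7 3)))) (.V 3 7 0 2 8)) (.V 3 6 0 2 8)) (.V 3 5 0 2 8)) (.T 2 8 0 7
  3)) (.T 2 8 0 6 3)) (.T 2 8 0 5 3)) (.V 1 0 2 4 7)) (.V 1 0 2 4 6)) (.V 1 0 2 4 5)) (.I 1 2 6
  3)) (.I 1 2 5 3)

lemma ct301_ok : chk 9 5 (uW [0, 0, 0, 2]) ct301 0 = true := by decide +kernel

/-- Certificate for wedge sizes `(0, 1, 3)`. -/
def ct013 : Ct :=
    .sp 3 1 5 (.sp 4 2 6 (.sp 4 2 7 (.sp 4 2 8 (.sp 3 5 6 (.sp 3 5 7 (.sp 3 5 8 (.sp 4 1 7 (.sp 4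
  1 8 (.sp 4 2 5 (.sp 4 1 5 (.sp 4 1 6 (.sp 4 7 8 (.sp 6 7 8 (.sp 4 6 8 (.sp 6 4 7 (.V 6 0 4 7 8)
  (.H 0 6 7 8 4)) (.V 8 7 0 6 4)) (.sp 7 3 8 (.sp 7 2 8 (.sp 7 5 8 (.sp 3 6 7 (.sp 6 4 7 (.sp 3 1
  7 (.sp 1 6 7 (.sp 2 6 7 (.sp 3 1 6 (.sp 2 6 8 (.sp 3 6 8 (.sp 5 2 6 (.sp 5 6 8 (.sp 6 5 7 (.V 6
  2 0 5 7) (.H 3 5 6 8 7)) (.H 2 6 8 7 3)) (.H 2 6 8 7 3)) (.V 6 2 0 3 8)) (.sp 4 6 8 (.sp 1 2 6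
  (.sp 1 2 7 (.H 1 2 6 7 3) (.T 2 6 0 1 7)) (.sp 2 1 8 (.sp 6 1 8 (.sp 2 5 6 (.sp 2 5 7 (.sp 6 5 7
  (.sp 1 5 6 (.sp 5 4 6 (.sp 6 5 8 (.sp 5 4 7 (.sp 5 4 8 (.sp 1 5 8 (.sp 2 5 8 (.H 1 5 8 6 2) (.T
  5 4 0 2 8)) (.T 5 4 0 1 8)) (.H 4 7 6 5 8)) (.V 7 5 0 6 4)) (.T 6 8 0 5 7)) (.T 6 4 0 5 7)) (.V
  6 1 0 5 7)) (.H 2 5 6 7 3)) (.V 2 0 5 6 7)) (.sp 5 1 6 (.sp 5 6 7 (.sp 5 6 8 (.sp 3 6 8 (.H 3 5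
  6 8 7) (.V 6 5 0 3 8)) (.sp 5 1 8 (.sp 5 2 8 (.H 1 8 6 5 2) (.T 5 8 0 2 6)) (.T 5 8 0 1 6))) (.V
  6 2 0 5 7)) (.V 5 1 0 2 6))) (.T 8 0 1 6 2)) (.T 2 8 0 1 6))) (.T 6 4 0 2 8))) (.V 1 0 3 6 7))
  (.T 6 4 0 2 7)) (.T 6 4 0 1 7)) (.H 0 1 3 7 4)) (.H 0 3 6 7 4)) (.sp 6 5 7 (.sp 6 3 8 (.sp 5 6 8
  (.T 6 8 0 5 7) (.H 3 5 8 7 6)) (.T 6 8 0 3 7)) (.V 6 5 0 3 7))) (.V 7 5 0 3 8)) (.V 7 2 0 3 8))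
  (.H 0 3 7 8 4))) (.sp 3 7 8 (.sp 2 7 8 (.sp 4 6 8 (.sp 6 7 8 (.sp 6 3 8 (.sp 6 3 7 (.sp 6 2 8
  (.sp 6 5 8 (.sp 6 2 7 (.sp 5 7 8 (.sp 6 5 7 (.H 3 5 7 8 6) (.V 6 5 0 3 7)) (.H 2 7 8 6 3)) (.V 6
  2 0 3 7)) (.V 6 5 0 3 8)) (.V 6 2 0 3 8)) (.T 6 7 0 3 8)) (.H 0 3 6 8 4)) (.V 8 6 0 7 4)) (.sp 3
  6 8 (.sp 2 6 8 (.sp 3 1 8 (.sp 3 1 6 (.sp 3 6 7 (.sp 7 6 8 (.sp 6 4 7 (.sp 1 6 7 (.sp 2 6 7 (.sp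
  2 5 6 (.sp 2 5 7 (.sp 6 5 7 (.sp 5 4 6 (.sp 6 5 8 (.sp 5 4 7 (.sp 7 5 8 (.sp 4 5 8 (.V 8 5 0 6
  4) (.H 4 8 7 6 5)) (.V 7 5 0 6 8)) (.V 7 5 0 6 4)) (.T 6 8 0 5 7)) (.T 6 4 0 5 7)) (.H 2 5 6 7
  3)) (.V 2 0 5 6 7)) (.sp 2 1 6 (.sp 5 1 6 (.sp 4 5 6 (.sp 5 6 7 (.sp 5 6 8 (.sp 2 5 7 (.sp 5 7 8
  (.sp 5 2 8 (.T 5 7 0 2 8) (.H 2 5 7 8 3)) (.sp 5 4 7 (.sp 5 4 8 (.H 4 8 7 5 6) (.V 8 5 0 7 4))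
  (.T 7 4 0 5 8))) (.sp 5 1 7 (.sp 2 1 7 (.H 1 6 7 5 2) (.T 2 7 0 1 5)) (.V 5 1 0 2 7))) (.V 6 2 0
  5 8)) (.V 6 2 0 5 7)) (.T 5 4 0 2 6)) (.V 5 1 0 2 6)) (.T 2 6 0 1 5))) (.T 6 4 0 2 7)) (.T 6 4 0
  1 7)) (.H 0 3 6 7 4)) (.H 0 3 6 7 8)) (.sp 6 2 7 (.sp 4 6 7 (.sp 6 1 7 (.sp 6 5 7 (.sp 6 7 8
  (.sp 2 5 6 (.sp 5 2 7 (.sp 4 5 7 (.sp 5 7 8 (.sp 5 6 8 (.sp 5 2 8 (.T 5 6 0 2 8) (.H 2 5 6 8 3))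
  (.sp 5 4 6 (.sp 5 4 8 (.H 4 8 6 5 7) (.V 8 5 0 6 4)) (.T 6 4 0 5 8))) (.V 7 2 0 5 8)) (.V 7 2 0
  5 4)) (.H 2 5 7 6 3)) (.sp 2 1 6 (.sp 5 1 6 (.sp 5 2 7 (.sp 2 1 7 (.sp 1 5 7 (.T 5 7 0 1 6) (.H
  1 7 6 5 2)) (.T 2 7 0 1 6)) (.V 2 0 5 7 6)) (.V 5 1 0 2 6)) (.T 2 6 0 1 5))) (.T 6 8 0 3 7)) (.V
  6 5 0 3 7)) (.V 6 1 0 3 7)) (.T 6 4 0 3 7)) (.V 6 2 0 3 7))) (.T 3 6 0 1 8)) (.H 0 1 3 8 4)) (.T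
  6 4 0 2 8)) (.T 6 4 0 3 8))) (.T 7 4 0 2 8)) (.T 7 4 0 3 8))) (.T 4 0 1 3 6)) (.V 1 0 2 4 5))
  (.I 2 3 5 4)) (.T 4 0 1 3 8)) (.T 4 0 1 3 7)) (.V 3 5 0 2 8)) (.V 3 5 0 2 7)) (.V 3 5 0 2 6))
  (.I 2 3 8 4)) (.I 2 3 7 4)) (.I 2 3 6 4)) (.I 1 2 5 3)

lemma ct013_ok : chk 9 5 (uW [1, 2, 2, 2]) ct013 0 = true := by decide +kernel

/-- Certificate for wedge sizes `(3, 1, 0)`. -/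
def ct310 : Ct :=
    .sp 3 1 5 (.sp 3 1 6 (.sp 3 1 7 (.sp 4 1 5 (.sp 4 1 6 (.sp 4 1 7 (.sp 2 5 8 (.sp 2 7 8 (.sp 2
  6 8 (.sp 4 2 8 (.sp 1 5 6 (.sp 5 6 7 (.sp 1 5 7 (.sp 1 6 7 (.H 0 1 5 6 7) (.V 6 5 0 1 7)) (.T 5
  6 0 1 7)) (.sp 5 2 6 (.sp 5 3 6 (.sp 6 5 8 (.sp 5 4 6 (.sp 1 6 7 (.sp 1 5 7 (.sp 6 2 7 (.sp 5 2
  7 (.sp 7 6 8 (.sp 7 5 8 (.H 2 7 6 5 8) (.V 5 0 2 7 8)) (.V 6 0 2 7 8)) (.H 0 1 5 7 2)) (.H 0 1 6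
  7 2)) (.T 7 0 1 6 5)) (.sp 2 6 7 (.sp 3 6 7 (.sp 4 6 7 (.sp 4 2 6 (.sp 4 2 5 (.sp 4 2 7 (.sp 3 5
  7 (.sp 2 5 7 (.sp 5 7 8 (.sp 7 6 8 (.V 7 5 0 6 8) (.H 2 6 5 7 8)) (.H 2 6 5 7 3)) (.V 5 0 2 7
  3)) (.sp 1 5 7 (.sp 5 7 8 (.sp 2 5 7 (.sp 7 6 8 (.V 7 5 0 6 8) (.H 2 6 5 7 8)) (.V 5 0 2 7 8))
  (.sp 3 7 8 (.sp 3 6 8 (.sp 7 6 8 (.sp 6 1 8 (.sp 7 1 8 (.sp 5 1 8 (.sp 4 7 8 (.sp 3 5 8 (.sp 4 5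
  8 (.sp 2 5 7 (.sp 5 4 7 (.sp 3 4 7 (.sp 4 3 6 (.V 3 7 0 6 4) (.H 2 6 7 3 4)) (.sp 3 4 5 (.T 4 0
  3 7 5) (.H 3 7 5 8 4))) (.H 2 6 5 7 4)) (.H 2 7 5 8 3)) (.T 5 4 0 1 8)) (.T 5 3 0 1 8)) (.T 7 4
  0 6 8)) (.H 1 5 8 7 6)) (.V 7 1 0 6 8)) (.T 6 8 0 1 7)) (.H 2 6 7 8 3)) (.T 3 0 6 7 8)) (.sp 4 3
  7 (.sp 7 4 8 (.sp 6 7 8 (.sp 5 3 8 (.sp 5 4 7 (.sp 5 4 8 (.sp 3 4 5 (.V 3 5 0 8 4) (.H 3 8 7 5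
  4)) (.V 8 5 0 7 4)) (.T 7 4 0 5 8)) (.V 8 5 0 7 3)) (.T 7 3 0 6 8)) (.T 8 4 0 7 3)) (.V 3 7 0 8
  4)))) (.T 5 3 0 1 7))) (.H 0 1 7 2 4)) (.V 2 5 0 6 4)) (.H 0 1 6 2 4)) (.T 6 4 0 1 7)) (.T 6 3 0
  1 7)) (.T 6 2 0 1 7))) (.H 0 1 5 6 4)) (.V 5 0 2 6 8)) (.V 5 0 2 6 3)) (.H 0 1 5 6 2))) (.sp 2 5
  6 (.sp 3 5 6 (.sp 4 5 6 (.sp 1 5 7 (.sp 5 6 7 (.sp 5 2 7 (.sp 6 2 7 (.sp 5 3 7 (.sp 7 5 8 (.sp 6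
  3 7 (.sp 7 6 8 (.sp 5 6 8 (.H 2 7 5 6 8) (.H 2 7 5 6 3)) (.V 6 0 2 7 8)) (.V 6 0 2 7 3)) (.V 5 0
  2 7 8)) (.V 5 0 2 7 3)) (.V 7 6 0 5 2)) (.H 0 1 5 7 2)) (.T 5 7 0 1 6)) (.sp 2 5 7 (.sp 3 5 7
  (.sp 4 5 7 (.sp 5 6 7 (.sp 6 2 7 (.sp 1 6 7 (.sp 6 3 7 (.sp 7 6 8 (.sp 6 4 7 (.sp 3 7 8 (.sp 6 3
  8 (.sp 6 4 8 (.sp 1 6 8 (.sp 5 6 8 (.sp 5 7 8 (.sp 5 3 8 (.V 8 7 0 5 3) (.H 2 5 7 8 3)) (.sp 5 1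
  8 (.sp 7 1 8 (.H 1 6 8 7 5) (.V 7 1 0 5 8)) (.T 5 8 0 1 7))) (.T 6 3 0 5 8)) (.T 6 3 0 1 8)) (.T
  8 4 0 6 3)) (.H 2 7 6 8 3)) (.sp 4 3 7 (.sp 7 4 8 (.sp 5 7 8 (.sp 6 3 8 (.sp 4 3 6 (.sp 4 6 8
  (.V 8 6 0 7 4) (.H 3 8 7 6 4)) (.V 3 6 0 7 4)) (.V 8 6 0 7 3)) (.T 7 3 0 5 8)) (.T 8 4 0 7 3))
  (.V 3 7 0 8 4))) (.H 0 5 6 7 4)) (.V 6 0 2 7 8)) (.V 6 0 2 7 3)) (.T 6 2 0 1 7)) (.H 0 5 6 7 2))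
  (.sp 6 1 7 (.sp 3 6 7 (.sp 4 6 7 (.sp 2 6 7 (.sp 3 7 8 (.sp 3 6 8 (.sp 7 6 8 (.sp 3 5 8 (.sp 7 5
  8 (.sp 6 1 8 (.sp 6 5 8 (.sp 7 1 8 (.sp 4 7 8 (.sp 1 5 8 (.T 5 8 0 1 7) (.H 1 8 7 6 5)) (.T 7 4
  0 6 8)) (.V 7 1 0 6 8)) (.T 6 8 0 5 7)) (.T 6 8 0 1 7)) (.H 2 5 7 8 3)) (.T 3 0 5 6 8)) (.H 2 6
  7 8 3)) (.T 3 0 6 7 8)) (.sp 4 3 7 (.sp 7 4 8 (.sp 1 7 8 (.sp 5 7 8 (.sp 6 7 8 (.sp 3 6 8 (.sp 3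
  5 8 (.sp 6 5 8 (.sp 5 1 8 (.sp 6 1 8 (.H 1 7 8 6 5) (.V 6 1 0 5 8)) (.T 5 8 0 1 6)) (.H 2 5 6 8
  3)) (.T 3 0 5 6 8)) (.sp 4 3 6 (.sp 6 4 8 (.sp 6 5 8 (.T 6 3 0 5 8) (.H 3 8 6 7 4)) (.T 8 4 0 6
  3)) (.V 3 6 0 8 4))) (.T 7 3 0 6 8)) (.T 7 3 0 5 8)) (.T 7 3 0 1 8)) (.T 8 4 0 7 3)) (.V 3 7 0 8
  4))) (.T 6 2 0 1 7)) (.T 6 4 0 5 7)) (.T 6 3 0 5 7)) (.V 6 1 0 5 7))) (.T 5 4 0 1 7)) (.T 5 3 0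
  1 7)) (.T 5 2 0 1 7))) (.T 5 4 0 1 6)) (.T 5 3 0 1 6)) (.T 5 2 0 1 6))) (.I 2 3 8 4)) (.V 2 6 0
  1 8)) (.V 2 7 0 1 8)) (.V 2 5 0 1 8)) (.V 1 0 2 4 7)) (.V 1 0 2 4 6)) (.V 1 0 2 4 5)) (.I 1 2 7
  3)) (.I 1 2 6 3)) (.I 1 2 5 3)

lemma ct310_ok : chk 9 5 (uW [0, 0, 0, 1]) ct310 0 = true := by decide +kernel

/-- Certificate for wedge sizes `(0, 3, 1)`. -/
def ct031 : Ct :=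
    .sp 3 1 5 (.sp 3 1 6 (.sp 3 1 7 (.sp 4 2 5 (.sp 4 2 6 (.sp 4 1 5 (.sp 3 5 8 (.sp 3 6 8 (.sp 3
  7 8 (.sp 3 6 7 (.sp 5 6 7 (.sp 3 5 6 (.sp 3 5 7 (.H 0 5 6 7 3) (.V 7 6 0 5 3)) (.T 6 7 0 5 3))
  (.sp 6 2 7 (.sp 6 1 7 (.sp 4 6 7 (.sp 2 5 6 (.sp 5 3 6 (.sp 5 4 6 (.sp 6 5 8 (.sp 1 5 6 (.sp 1 5
  7 (.sp 2 5 7 (.sp 1 5 8 (.sp 7 6 8 (.sp 6 1 8 (.sp 6 2 8 (.sp 7 1 8 (.sp 7 2 8 (.sp 1 2 8 (.T 2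
  8 0 1 6) (.H 1 8 7 6 2)) (.V 7 2 0 6 8)) (.V 7 1 0 6 8)) (.T 6 8 0 2 7)) (.T 6 8 0 1 7)) (.H 1 5
  7 6 2)) (.H 1 5 7 6 2)) (.V 5 1 0 2 7)) (.sp 3 5 7 (.sp 4 5 7 (.sp 5 7 8 (.sp 7 6 8 (.V 7 5 0 6
  8) (.H 3 6 5 7 8)) (.H 3 6 5 7 4)) (.T 5 4 0 1 7)) (.T 5 3 0 1 7))) (.T 5 3 0 1 6)) (.V 5 0 3 6
  8)) (.V 5 0 3 6 4)) (.H 0 2 5 6 3)) (.sp 5 1 6 (.sp 5 2 7 (.sp 5 1 7 (.sp 7 6 8 (.sp 6 1 8 (.sp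
  6 2 8 (.sp 7 1 8 (.sp 7 2 8 (.sp 1 2 8 (.T 2 8 0 1 6) (.H 1 8 7 6 2)) (.V 7 2 0 6 8)) (.V 7 1 0
  6 8)) (.T 6 8 0 2 7)) (.T 6 8 0 1 7)) (.H 1 7 6 5 2)) (.T 5 7 0 1 6)) (.V 2 0 5 7 6)) (.V 5 1 0
  2 6))) (.T 6 4 0 2 7)) (.V 6 1 0 2 7)) (.H 0 2 6 7 3))) (.sp 6 4 7 (.sp 2 6 7 (.sp 7 6 8 (.sp 1
  6 7 (.sp 3 5 7 (.sp 5 6 7 (.sp 5 2 7 (.sp 5 2 6 (.sp 5 1 7 (.sp 1 5 6 (.V 5 1 0 2 6) (.H 1 6 7 5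
  2)) (.V 5 1 0 2 7)) (.T 5 6 0 2 7)) (.H 0 2 5 7 3)) (.V 7 5 0 6 3)) (.sp 5 4 7 (.sp 2 5 7 (.sp 7
  5 8 (.sp 5 6 7 (.sp 5 2 6 (.sp 5 1 6 (.sp 3 5 6 (.sp 4 5 6 (.sp 6 5 8 (.H 3 7 5 6 4) (.H 3 7 5 6
  8)) (.T 5 4 0 2 6)) (.T 5 3 0 2 6)) (.V 5 1 0 2 6)) (.H 0 2 5 6 7)) (.sp 5 3 6 (.sp 6 5 8 (.H 3
  7 6 5 8) (.T 6 8 0 5 7)) (.T 6 3 0 5 7))) (.V 5 0 3 7 8)) (.T 5 3 0 2 7)) (.V 5 0 3 7 4))) (.T 6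
  3 0 1 7)) (.V 6 0 3 7 8)) (.T 6 3 0 2 7)) (.V 6 0 3 7 4))) (.V 3 7 0 2 8)) (.V 3 6 0 2 8)) (.V 3
  5 0 2 8)) (.V 1 0 2 4 5)) (.I 2 3 6 4)) (.I 2 3 5 4)) (.I 1 2 7 3)) (.I 1 2 6 3)) (.I 1 2 5 3)

lemma ct031_ok : chk 9 5 (uW [1, 1, 1, 2]) ct031 0 = true := by decide +kernel

/-- Certificate for wedge sizes `(1, 3, 0)`. -/
def ct130 : Ct :=
    .sp 3 1 7 (.sp 4 2 6 (.sp 4 2 7 (.sp 4 1 6 (.sp 2 5 6 (.sp 2 5 7 (.sp 2 5 8 (.sp 3 7 8 (.sp 6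
  7 8 (.sp 3 6 8 (.sp 6 3 7 (.V 6 0 3 7 8) (.H 0 6 7 8 3)) (.V 8 7 0 6 3)) (.sp 7 2 8 (.sp 7 1 8
  (.sp 4 7 8 (.sp 7 5 8 (.sp 2 6 7 (.sp 6 3 7 (.sp 6 4 7 (.sp 4 6 8 (.sp 3 6 8 (.sp 5 6 8 (.sp 2 6
  8 (.sp 5 6 7 (.H 2 5 6 8 7) (.T 6 8 0 5 7)) (.V 6 5 0 2 8)) (.H 3 7 6 8 4)) (.V 6 0 3 8 4)) (.sp
  1 6 8 (.sp 2 6 8 (.sp 1 6 7 (.sp 5 6 8 (.sp 6 5 7 (.T 6 8 0 5 7) (.H 2 5 6 8 7)) (.H 1 6 8 7 2))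
  (.T 6 8 0 1 7)) (.T 6 4 0 2 8)) (.T 6 4 0 1 8))) (.V 6 0 3 7 4)) (.H 0 2 6 7 3)) (.sp 6 5 7 (.sp
  6 2 8 (.sp 5 6 8 (.T 6 8 0 5 7) (.H 2 5 8 7 6)) (.T 6 8 0 2 7)) (.V 6 5 0 2 7))) (.V 7 5 0 2 8))
  (.T 7 4 0 2 8)) (.V 7 1 0 2 8)) (.H 0 2 7 8 3))) (.sp 7 4 8 (.sp 2 7 8 (.sp 1 7 8 (.sp 2 6 7
  (.sp 2 6 8 (.sp 7 6 8 (.sp 6 3 8 (.sp 6 4 8 (.sp 6 3 7 (.sp 6 4 7 (.sp 6 5 7 (.sp 6 5 8 (.sp 5 3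
  6 (.sp 5 4 6 (.sp 5 3 8 (.sp 5 4 8 (.sp 3 4 5 (.V 3 5 0 6 4) (.H 3 8 6 5 4)) (.V 8 5 0 6 4)) (.V
  8 5 0 6 3)) (.T 6 4 0 5 8)) (.T 6 3 0 5 8)) (.T 6 8 0 5 7)) (.H 3 8 7 6 4)) (.V 6 0 3 7 4)) (.H
  0 2 6 7 3)) (.V 8 6 0 7 4)) (.V 8 6 0 7 3)) (.H 0 2 6 7 8)) (.V 2 0 6 7 8)) (.sp 3 6 7 (.sp 4 6
  7 (.sp 6 5 7 (.sp 6 7 8 (.sp 4 6 8 (.sp 3 6 8 (.sp 6 2 8 (.sp 6 1 8 (.sp 6 5 8 (.sp 7 5 8 (.sp 6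
  1 7 (.H 1 7 8 6 2) (.V 1 0 6 7 8)) (.H 2 5 7 8 6)) (.V 6 5 0 2 8)) (.V 6 1 0 2 8)) (.H 0 2 6 8
  3)) (.V 6 0 3 8 4)) (.sp 2 6 8 (.sp 3 6 8 (.H 0 2 6 8 3) (.H 3 8 6 7 4)) (.T 6 4 0 2 8))) (.V 7
  2 0 6 8)) (.V 6 5 0 2 7)) (.T 6 4 0 2 7)) (.T 6 3 0 2 7))) (.T 7 3 0 1 8)) (.T 7 3 0 2 8)) (.V 7
  0 3 8 4))) (.V 2 5 0 1 8)) (.V 2 5 0 1 7)) (.V 2 5 0 1 6)) (.V 1 0 2 4 6)) (.I 2 3 7 4)) (.I 2 3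
  6 4)) (.I 1 2 7 3)

lemma ct130_ok : chk 9 5 (uW [0, 1, 1, 1]) ct130 0 = true := by decide +kernel

/-- Certificate for wedge sizes `(0, 2, 2)`. -/
def ct022 : Ct :=
    .sp 3 1 5 (.sp 3 1 6 (.sp 4 2 5 (.sp 4 2 7 (.sp 4 2 8 (.sp 3 5 7 (.sp 3 5 8 (.sp 3 6 7 (.sp 3
  6 8 (.sp 4 1 7 (.sp 4 1 8 (.sp 3 5 6 (.sp 5 2 6 (.sp 5 1 6 (.sp 4 5 6 (.sp 5 6 7 (.sp 3 7 8 (.sp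
  7 4 8 (.sp 1 7 8 (.sp 2 7 8 (.sp 5 7 8 (.sp 5 6 8 (.sp 7 6 8 (.sp 1 6 7 (.sp 2 6 7 (.sp 2 5 7
  (.sp 2 5 8 (.H 2 5 7 8 3) (.V 2 0 5 7 8)) (.sp 2 1 7 (.sp 5 1 7 (.H 1 6 7 5 2) (.V 5 1 0 2 7))
  (.T 2 7 0 1 5))) (.V 6 1 0 2 7)) (.V 7 1 0 6 8)) (.H 3 5 6 7 8)) (.V 5 0 6 7 8)) (.sp 2 5 7 (.sp
  5 4 7 (.sp 7 6 8 (.sp 5 4 8 (.sp 2 5 8 (.sp 6 4 7 (.sp 6 4 8 (.sp 6 5 8 (.T 5 8 0 2 6) (.H 4 8 7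
  5 6)) (.V 8 6 0 7 4)) (.T 7 4 0 6 8)) (.V 2 0 5 7 8)) (.V 8 5 0 7 4)) (.V 7 6 0 5 8)) (.T 7 4 0
  5 8)) (.V 7 2 0 5 8))) (.T 7 4 0 2 8)) (.T 7 4 0 1 8)) (.H 0 3 7 8 4)) (.sp 7 5 8 (.sp 7 6 8
  (.sp 6 5 8 (.sp 5 1 8 (.sp 5 2 8 (.sp 6 1 8 (.sp 6 2 8 (.sp 1 2 8 (.T 2 8 0 1 5) (.H 1 8 6 5 2))
  (.V 6 2 0 5 8)) (.V 6 1 0 5 8)) (.T 5 8 0 2 6)) (.T 5 8 0 1 6)) (.H 3 5 6 8 7)) (.V 7 6 0 3 8))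
  (.V 7 5 0 3 8))) (.sp 5 1 7 (.sp 5 2 7 (.sp 6 1 7 (.sp 6 2 7 (.sp 2 1 7 (.sp 7 6 8 (.sp 6 5 8
  (.sp 5 1 8 (.sp 5 2 8 (.sp 6 1 8 (.sp 6 2 8 (.sp 1 2 8 (.T 2 8 0 1 5) (.H 1 8 6 5 2)) (.V 6 2 0
  5 8)) (.V 6 1 0 5 8)) (.T 5 8 0 2 6)) (.T 5 8 0 1 6)) (.T 6 8 0 5 7)) (.H 1 7 6 5 2)) (.T 2 7 0
  1 5)) (.V 6 2 0 5 7)) (.V 6 1 0 5 7)) (.T 5 7 0 2 6)) (.T 5 7 0 1 6))) (.T 5 4 0 2 6)) (.V 5 1 0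
  2 6)) (.H 0 2 5 6 3)) (.sp 5 4 6 (.sp 6 5 7 (.sp 6 5 8 (.sp 2 5 6 (.sp 6 7 8 (.sp 3 7 8 (.sp 7 5
  8 (.sp 7 4 8 (.sp 1 7 8 (.sp 2 7 8 (.sp 1 5 7 (.sp 2 5 7 (.sp 1 5 6 (.sp 2 6 7 (.sp 2 6 8 (.H 2
  6 7 8 3) (.T 6 7 0 2 8)) (.sp 2 1 7 (.sp 6 1 7 (.H 1 5 7 6 2) (.V 6 1 0 2 7)) (.T 2 7 0 1 6)))
  (.T 5 7 0 1 6)) (.V 7 2 0 5 8)) (.V 7 1 0 5 8)) (.T 7 4 0 2 8)) (.T 7 4 0 1 8)) (.H 0 3 7 8 4))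
  (.H 3 6 5 7 8)) (.V 7 6 0 3 8)) (.sp 7 5 8 (.sp 3 7 8 (.sp 7 4 8 (.sp 5 4 7 (.sp 6 4 7 (.sp 5 4
  8 (.sp 6 4 8 (.H 4 8 7 6 5) (.V 8 6 0 7 4)) (.V 8 5 0 7 4)) (.T 7 4 0 6 8)) (.T 7 4 0 5 8)) (.H
  0 3 7 8 4)) (.H 3 6 5 8 7)) (.V 7 5 0 6 8))) (.T 5 4 0 2 6)) (.V 5 0 3 6 8)) (.V 5 0 3 6 7)) (.V
  5 0 3 6 4))) (.T 4 0 1 3 8)) (.T 4 0 1 3 7)) (.V 3 6 0 2 8)) (.V 3 6 0 2 7)) (.V 3 5 0 2 8)) (.V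
  3 5 0 2 7)) (.I 2 3 8 4)) (.I 2 3 7 4)) (.I 2 3 5 4)) (.I 1 2 6 3)) (.I 1 2 5 3)

lemma ct022_ok : chk 9 5 (uW [1, 1, 2, 2]) ct022 0 = true := by decide +kernel

/-- Certificate for wedge sizes `(2, 2, 0)`. -/
def ct220 : Ct :=
    .sp 3 1 5 (.sp 3 1 6 (.sp 3 1 7 (.sp 4 2 7 (.sp 4 2 8 (.sp 4 1 5 (.sp 4 1 8 (.sp 2 5 7 (.sp 2
  5 8 (.sp 2 6 7 (.sp 2 6 8 (.sp 2 7 8 (.sp 7 3 8 (.sp 7 4 8 (.sp 1 7 8 (.sp 5 7 8 (.sp 2 5 6 (.sp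
  5 1 6 (.sp 3 5 6 (.sp 4 5 6 (.sp 5 6 7 (.sp 5 6 8 (.sp 7 6 8 (.sp 6 3 7 (.sp 6 4 7 (.sp 6 3 8
  (.sp 6 4 8 (.sp 3 4 6 (.V 3 6 0 7 4) (.H 3 8 7 6 4)) (.V 8 6 0 7 4)) (.V 8 6 0 7 3)) (.T 7 4 0 6
  8)) (.T 7 3 0 6 8)) (.H 2 5 6 7 8)) (.V 5 0 6 7 8)) (.sp 5 1 7 (.sp 6 1 7 (.sp 4 6 7 (.sp 3 6 7
  (.sp 6 7 8 (.sp 3 6 8 (.sp 3 5 8 (.sp 6 5 8 (.sp 5 1 8 (.sp 6 1 8 (.H 1 7 8 6 5) (.V 6 1 0 5 8))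
  (.T 5 8 0 1 6)) (.H 2 5 6 8 3)) (.T 3 0 5 6 8)) (.sp 4 3 6 (.sp 6 4 8 (.sp 5 6 8 (.H 3 8 6 7 4)
  (.T 6 3 0 5 8)) (.T 8 4 0 6 3)) (.V 3 6 0 8 4))) (.T 7 4 0 6 8)) (.T 6 3 0 1 7)) (.T 6 4 0 5 7))
  (.V 6 1 0 5 7)) (.T 5 7 0 1 6))) (.T 5 4 0 1 6)) (.T 5 3 0 1 6)) (.H 0 1 5 6 2)) (.sp 6 5 7 (.sp
  6 5 8 (.sp 7 6 8 (.sp 6 3 7 (.sp 6 4 7 (.sp 6 3 8 (.sp 6 4 8 (.sp 3 4 6 (.V 3 6 0 7 4) (.H 3 8 7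
  6 4)) (.V 8 6 0 7 4)) (.V 8 6 0 7 3)) (.T 7 4 0 6 8)) (.T 7 3 0 6 8)) (.H 2 6 5 7 8)) (.V 5 0 2
  6 8)) (.V 5 0 2 6 7))) (.sp 5 3 7 (.sp 5 4 7 (.sp 5 3 8 (.sp 5 4 8 (.sp 4 3 5 (.sp 7 6 8 (.sp 6
  3 7 (.sp 6 4 7 (.sp 6 3 8 (.sp 6 4 8 (.sp 4 3 6 (.sp 6 5 7 (.sp 5 4 6 (.sp 5 6 8 (.V 5 0 6 8 7)
  (.H 4 8 7 6 5)) (.T 6 4 0 5 7)) (.H 3 8 7 6 4)) (.V 3 6 0 7 4)) (.V 8 6 0 7 4)) (.V 8 6 0 7 3))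
  (.T 7 4 0 6 8)) (.T 7 3 0 6 8)) (.H 3 8 7 5 4)) (.V 3 5 0 7 4)) (.V 8 5 0 7 4)) (.V 8 5 0 7 3))
  (.T 7 4 0 5 8)) (.T 7 3 0 5 8))) (.T 7 3 0 1 8)) (.V 7 0 3 8 4)) (.H 0 2 7 8 3)) (.sp 7 1 8 (.sp
  7 5 8 (.sp 7 6 8 (.sp 3 7 8 (.sp 2 5 6 (.sp 5 1 6 (.sp 3 5 6 (.sp 4 5 6 (.sp 5 6 7 (.sp 6 5 8
  (.sp 3 6 8 (.sp 4 6 8 (.sp 4 7 8 (.sp 3 6 7 (.sp 3 5 7 (.H 2 5 6 7 3) (.T 3 0 5 6 7)) (.sp 4 3 6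
  (.sp 6 4 7 (.H 3 7 6 8 4) (.T 7 4 0 6 3)) (.V 3 6 0 7 4))) (.V 8 6 0 7 4)) (.T 6 4 0 5 8)) (.T 6
  3 0 5 8)) (.H 2 5 6 8 7)) (.sp 6 5 8 (.sp 5 1 7 (.sp 6 1 7 (.sp 5 1 8 (.sp 6 1 8 (.H 1 8 7 6 5)
  (.V 6 1 0 5 8)) (.T 5 8 0 1 6)) (.V 6 1 0 5 7)) (.T 5 7 0 1 6)) (.V 5 0 6 8 7))) (.T 5 4 0 1 6))
  (.T 5 3 0 1 6)) (.H 0 1 5 6 2)) (.sp 6 5 7 (.sp 6 5 8 (.sp 7 4 8 (.sp 5 4 7 (.sp 6 4 7 (.sp 5 4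
  8 (.sp 6 4 8 (.sp 4 5 6 (.T 6 4 0 5 7) (.H 4 8 7 6 5)) (.V 8 6 0 7 4)) (.V 8 5 0 7 4)) (.T 7 4 0
  6 8)) (.T 7 4 0 5 8)) (.H 2 6 5 8 7)) (.V 5 0 2 6 8)) (.V 5 0 2 6 7))) (.T 7 3 0 1 8)) (.V 7 6 0
  2 8)) (.V 7 5 0 2 8)) (.V 7 1 0 2 8))) (.V 2 6 0 1 8)) (.V 2 6 0 1 7)) (.V 2 5 0 1 8)) (.V 2 5 0
  1 7)) (.V 1 0 2 4 8)) (.V 1 0 2 4 5)) (.I 2 3 8 4)) (.I 2 3 7 4)) (.I 1 2 7 3)) (.I 1 2 6 3))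
  (.I 1 2 5 3)

lemma ct220_ok : chk 9 5 (uW [0, 0, 1, 1]) ct220 0 = true := by decide +kernel

/-- Certificate for wedge sizes `(2, 0, 2)`. -/
def ct202 : Ct :=
    .sp 3 1 5 (.sp 4 2 7 (.sp 2 5 7 (.sp 2 6 7 (.sp 2 5 8 (.sp 2 6 8 (.sp 3 5 7 (.sp 3 5 8 (.sp 3
  6 7 (.sp 3 6 8 (.sp 4 1 7 (.sp 2 5 6 (.sp 5 1 6 (.sp 3 5 6 (.sp 3 7 8 (.sp 7 4 8 (.sp 6 5 7 (.sp
  1 7 8 (.sp 2 7 8 (.sp 6 1 7 (.sp 7 6 8 (.V 7 1 0 6 8) (.H 2 6 7 8 3)) (.V 6 1 0 5 7)) (.T 7 4 0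
  2 8)) (.T 7 4 0 1 8)) (.H 2 5 6 7 3)) (.H 0 3 7 8 4)) (.sp 7 2 8 (.sp 7 6 8 (.H 2 6 8 7 3) (.V 7
  6 0 3 8)) (.V 7 2 0 3 8))) (.T 5 3 0 1 6)) (.H 0 1 5 6 2)) (.sp 5 3 6 (.sp 6 5 7 (.sp 6 5 8 (.sp
  5 7 8 (.H 2 6 5 8 3) (.H 2 6 5 7 3)) (.V 5 0 2 6 8)) (.V 5 0 2 6 7)) (.V 5 0 2 6 3))) (.T 4 0 1
  3 7)) (.V 3 6 0 2 8)) (.V 3 6 0 2 7)) (.V 3 5 0 2 8)) (.V 3 5 0 2 7)) (.T 2 8 0 6 3)) (.T 2 8 0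
  5 3)) (.T 2 7 0 6 3)) (.T 2 7 0 5 3)) (.I 2 3 7 4)) (.I 1 2 5 3)

lemma ct202_ok : chk 9 5 (uW [0, 0, 2, 2]) ct202 0 = true := by decide +kernel

/-- Certificate for wedge sizes `(1, 1, 3)`. -/
def ct113 : Ct :=
    .sp 3 1 5 (.sp 3 1 6 (.sp 4 2 6 (.sp 4 2 7 (.sp 4 2 8 (.sp 4 2 9 (.sp 4 1 6 (.sp 2 5 6 (.sp 2
  5 7 (.sp 2 5 8 (.sp 2 5 9 (.sp 3 5 7 (.sp 3 5 8 (.sp 3 5 9 (.sp 3 6 7 (.sp 3 6 8 (.sp 3 6 9 (.sp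
  4 1 7 (.sp 4 1 8 (.sp 4 1 9 (.sp 3 8 9 (.sp 4 8 9 (.sp 7 8 9 (.sp 4 7 8 (.sp 4 7 9 (.H 0 7 8 9
  4) (.V 9 8 0 7 4)) (.T 8 9 0 7 4)) (.H 0 3 8 9 4)) (.sp 2 8 9 (.sp 4 7 9 (.sp 7 8 9 (.sp 7 3 9
  (.sp 7 3 8 (.sp 7 6 9 (.sp 7 2 8 (.sp 7 5 8 (.sp 7 6 8 (.sp 6 5 8 (.sp 8 6 9 (.sp 6 4 8 (.sp 2 6
  8 (.sp 2 6 7 (.H 2 6 8 7 3) (.V 2 0 6 8 7)) (.T 6 4 0 2 8)) (.T 8 4 0 6 9)) (.H 3 6 8 9 7)) (.H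
  2 5 8 7 3)) (.V 7 6 0 3 8)) (.V 7 5 0 3 8)) (.V 7 2 0 3 8)) (.V 7 6 0 3 9)) (.V 3 0 7 8 9)) (.H
  0 3 7 9 4)) (.V 9 7 0 8 4)) (.sp 3 7 9 (.sp 2 7 9 (.sp 3 7 8 (.sp 8 7 9 (.sp 7 4 8 (.sp 1 7 8
  (.sp 2 7 8 (.sp 2 6 8 (.sp 2 6 9 (.sp 8 6 9 (.sp 6 4 8 (.sp 6 4 9 (.sp 6 7 8 (.sp 6 2 7 (.sp 4 6
  7 (.sp 6 5 7 (.sp 6 7 9 (.H 4 9 8 6 7) (.V 7 2 0 6 9)) (.V 6 5 0 2 7)) (.T 6 4 0 2 7)) (.H 2 6 7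
  8 3)) (.sp 2 6 7 (.sp 6 4 7 (.sp 7 6 9 (.sp 7 5 8 (.sp 5 4 7 (.sp 7 5 9 (.sp 5 4 9 (.sp 5 6 7
  (.sp 3 5 6 (.H 2 5 6 7 3) (.V 5 0 3 6 7)) (.sp 5 4 6 (.sp 6 5 9 (.H 4 9 7 6 5) (.T 6 9 0 5 7))
  (.T 6 4 0 5 7))) (.V 9 5 0 7 4)) (.T 7 9 0 5 8)) (.T 7 4 0 5 8)) (.H 2 5 7 8 3)) (.T 7 9 0 6 8))
  (.T 7 4 0 6 8)) (.V 7 2 0 6 8))) (.V 9 6 0 8 4)) (.T 8 4 0 6 9)) (.H 2 6 8 9 3)) (.V 2 0 6 8 9))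
  (.sp 2 1 8 (.sp 6 1 8 (.sp 6 2 7 (.sp 4 6 8 (.sp 6 5 8 (.sp 6 7 8 (.sp 2 1 7 (.sp 6 1 7 (.sp 6 5
  7 (.sp 6 8 9 (.sp 7 5 8 (.H 1 7 8 6 2) (.H 2 5 7 8 6)) (.T 8 4 0 6 9)) (.V 6 5 0 2 7)) (.V 6 1 0
  2 7)) (.T 2 7 0 1 6)) (.T 8 0 1 7 6)) (.V 6 5 0 2 8)) (.T 6 4 0 2 8)) (.V 2 0 6 7 8)) (.V 6 1 0
  2 8)) (.T 2 8 0 1 6))) (.T 7 4 0 2 8)) (.T 7 4 0 1 8)) (.H 0 3 7 8 4)) (.H 0 3 7 8 9)) (.sp 7 2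
  8 (.sp 4 7 8 (.sp 7 5 8 (.sp 7 6 8 (.sp 7 8 9 (.sp 6 5 8 (.sp 2 6 7 (.sp 2 6 9 (.sp 6 2 8 (.sp 7
  6 9 (.sp 4 6 8 (.sp 6 4 7 (.sp 6 4 9 (.sp 8 6 9 (.T 8 4 0 6 9) (.H 4 9 7 6 8)) (.V 9 6 0 7 4))
  (.T 7 4 0 6 9)) (.T 6 4 0 2 8)) (.H 2 6 7 9 3)) (.H 2 6 8 7 3)) (.V 2 0 6 7 9)) (.sp 6 2 8 (.sp
  5 6 7 (.V 6 5 0 2 7) (.H 2 5 8 7 6)) (.V 2 0 6 8 7))) (.H 2 5 8 7 3)) (.T 7 9 0 3 8)) (.V 7 6 0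
  3 8)) (.V 7 5 0 3 8)) (.T 7 4 0 3 8)) (.V 7 2 0 3 8))) (.T 7 4 0 2 9)) (.T 7 4 0 3 9))) (.T 8 4
  0 2 9))) (.sp 8 2 9 (.sp 8 5 9 (.sp 8 6 9 (.sp 4 8 9 (.sp 7 8 9 (.sp 4 7 8 (.sp 4 7 9 (.H 0 7 8
  9 4) (.V 9 8 0 7 4)) (.T 8 9 0 7 4)) (.sp 8 1 9 (.sp 3 7 8 (.sp 3 1 8 (.sp 3 1 7 (.sp 7 4 8 (.sp
  3 1 9 (.sp 1 7 8 (.sp 2 7 8 (.sp 2 7 9 (.sp 3 7 9 (.sp 6 7 9 (.sp 6 7 8 (.sp 5 6 7 (.sp 2 6 7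
  (.sp 2 6 8 (.H 2 6 7 8 3) (.V 2 0 6 7 8)) (.V 6 5 0 2 7)) (.H 3 6 7 9 8)) (.T 7 9 0 6 8)) (.H 2
  7 9 8 3)) (.V 7 2 0 3 9)) (.sp 4 7 9 (.sp 7 5 9 (.sp 6 7 9 (.sp 3 7 9 (.sp 6 7 8 (.sp 5 6 7 (.sp
  2 6 7 (.sp 2 6 8 (.H 2 6 7 8 3) (.V 2 0 6 7 8)) (.V 6 5 0 2 7)) (.H 3 6 7 9 8)) (.T 7 9 0 6 8))
  (.V 7 6 0 3 9)) (.sp 2 6 7 (.sp 2 6 8 (.sp 7 6 8 (.sp 1 6 7 (.sp 6 4 7 (.sp 1 6 8 (.sp 6 4 8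
  (.sp 5 6 7 (.sp 3 5 6 (.H 2 5 6 7 3) (.V 5 0 3 6 7)) (.sp 6 5 9 (.sp 6 4 9 (.sp 1 6 9 (.sp 2 6 9
  (.sp 3 7 9 (.sp 7 1 9 (.sp 1 2 7 (.sp 2 1 8 (.sp 2 1 9 (.H 1 6 9 8 2) (.V 1 0 2 9 8)) (.H 1 2 7
  8 3)) (.sp 2 1 9 (.H 1 6 9 7 2) (.V 1 0 2 9 7))) (.H 1 7 9 8 3)) (.H 2 6 9 7 3)) (.T 6 4 0 2 9))
  (.T 6 4 0 1 9)) (.H 4 8 7 6 9)) (.T 6 9 0 5 7))) (.V 8 6 0 7 4)) (.T 8 0 1 7 6)) (.T 7 4 0 6 8))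
  (.V 7 1 0 6 8)) (.H 2 6 7 8 3)) (.V 2 0 6 7 8)) (.sp 6 2 9 (.sp 6 5 7 (.sp 5 6 9 (.T 6 9 0 5 7)
  (.H 2 5 9 7 6)) (.V 6 5 0 2 7)) (.V 2 0 6 9 7)))) (.V 7 5 0 2 9)) (.T 7 4 0 2 9))) (.T 7 4 0 2
  8)) (.T 7 4 0 1 8)) (.H 0 1 3 9 4)) (.H 0 3 7 8 4)) (.T 3 7 0 1 8)) (.H 0 1 3 8 4)) (.sp 7 5 8
  (.sp 7 6 8 (.sp 7 3 9 (.sp 7 5 9 (.sp 7 6 9 (.sp 5 3 6 (.H 3 5 9 8 7) (.H 3 6 9 8 7)) (.T 7 9 0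
  6 8)) (.T 7 9 0 5 8)) (.T 7 9 0 3 8)) (.V 7 6 0 3 8)) (.V 7 5 0 3 8))) (.H 0 1 8 9 4))) (.T 8 4
  0 2 9)) (.V 8 6 0 3 9)) (.V 8 5 0 3 9)) (.V 8 2 0 3 9))) (.T 4 0 1 3 9)) (.T 4 0 1 3 8)) (.T 4 0
  1 3 7)) (.V 3 6 0 2 9)) (.V 3 6 0 2 8)) (.V 3 6 0 2 7)) (.V 3 5 0 2 9)) (.V 3 5 0 2 8)) (.V 3 5
  0 2 7)) (.T 2 9 0 5 3)) (.T 2 8 0 5 3)) (.T 2 7 0 5 3)) (.V 2 5 0 1 6)) (.V 1 0 2 4 6)) (.I 2 3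
  9 4)) (.I 2 3 8 4)) (.I 2 3 7 4)) (.I 2 3 6 4)) (.I 1 2 6 3)) (.I 1 2 5 3)

lemma ct113_ok : chk 10 5 (uW [0, 1, 2, 2, 2]) ct113 0 = true := by decide +kernel

/-- Certificate for wedge sizes `(3, 1, 1)`. -/
def ct311 : Ct :=
    .sp 3 1 5 (.sp 3 1 6 (.sp 3 1 8 (.sp 4 2 8 (.sp 4 1 6 (.sp 4 1 5 (.sp 2 5 8 (.sp 2 7 8 (.sp 2
  6 8 (.sp 2 6 9 (.sp 2 7 9 (.sp 3 6 9 (.sp 3 7 9 (.sp 3 8 9 (.sp 3 5 9 (.sp 3 1 7 (.sp 4 1 7 (.sp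
  2 6 7 (.sp 5 6 7 (.sp 2 5 6 (.sp 2 5 7 (.H 0 5 6 7 2) (.V 7 6 0 5 2)) (.T 6 7 0 5 2)) (.sp 6 1 7
  (.sp 3 6 7 (.sp 4 6 7 (.sp 3 6 8 (.sp 5 6 8 (.sp 2 5 6 (.sp 3 5 6 (.sp 3 5 8 (.H 2 5 6 8 3) (.V
  8 6 0 5 3)) (.T 6 8 0 5 3)) (.V 5 0 2 6 8)) (.sp 6 8 9 (.sp 2 8 9 (.sp 7 6 8 (.sp 7 1 8 (.sp 7 5
  8 (.sp 7 8 9 (.sp 3 7 8 (.H 2 7 8 9 3) (.T 7 3 0 1 8)) (.V 8 6 0 7 9)) (.T 8 0 5 7 6)) (.V 7 1 0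
  6 8)) (.H 2 6 8 9 3)) (.V 8 6 0 2 9)) (.sp 6 5 9 (.sp 8 5 9 (.sp 5 7 8 (.sp 2 5 7 (.sp 6 7 8
  (.sp 7 3 8 (.sp 7 4 8 (.sp 8 7 9 (.sp 1 7 8 (.sp 2 5 6 (.sp 5 1 6 (.sp 5 1 7 (.sp 5 1 8 (.sp 6 1
  8 (.H 1 7 8 6 5) (.V 6 1 0 5 8)) (.T 5 8 0 1 6)) (.T 5 7 0 1 6)) (.H 0 1 5 6 2)) (.H 2 6 5 7 8))
  (.T 7 3 0 1 8)) (.V 7 0 3 8 9)) (.T 8 4 0 7 3)) (.H 2 6 7 8 3)) (.T 8 0 5 7 6)) (.V 5 0 2 7 8))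
  (.sp 3 7 8 (.sp 7 6 8 (.sp 6 1 8 (.sp 7 1 8 (.sp 4 7 8 (.sp 7 8 9 (.sp 8 2 9 (.V 8 7 0 2 9) (.H
  2 7 8 9 3)) (.sp 7 5 9 (.sp 7 6 9 (.sp 6 1 9 (.sp 7 1 9 (.sp 8 1 9 (.sp 1 5 6 (.sp 4 2 6 (.sp 5
  2 6 (.sp 4 2 5 (.sp 4 2 7 (.sp 5 3 6 (.sp 5 4 6 (.sp 3 5 7 (.sp 2 5 7 (.H 2 6 5 7 3) (.V 5 0 2 7
  3)) (.sp 1 5 7 (.sp 5 1 8 (.sp 3 5 8 (.sp 4 5 8 (.sp 2 5 7 (.sp 5 4 7 (.sp 3 4 7 (.sp 4 3 6 (.V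
  3 7 0 6 4) (.H 2 6 7 3 4)) (.sp 4 3 5 (.H 3 7 5 8 4) (.V 3 5 0 7 4))) (.H 2 6 5 7 4)) (.H 2 7 5
  8 3)) (.T 5 4 0 1 8)) (.T 5 3 0 1 8)) (.H 1 5 8 7 6)) (.T 5 3 0 1 7))) (.H 0 1 5 6 4)) (.V 5 0 2
  6 3)) (.H 0 1 7 2 4)) (.V 2 5 0 6 4)) (.H 0 1 5 6 2)) (.H 0 1 6 2 4)) (.H 1 9 8 7 6)) (.T 9 0 1
  8 6)) (.V 7 1 0 6 9)) (.T 6 9 0 1 7)) (.T 7 9 0 6 8)) (.T 7 9 0 5 8))) (.T 7 4 0 6 8)) (.V 7 1 0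
  6 8)) (.T 6 8 0 1 7)) (.H 2 6 7 8 3)) (.sp 8 7 9 (.sp 1 7 8 (.sp 7 5 9 (.sp 1 5 7 (.sp 1 5 6
  (.sp 5 2 6 (.sp 5 3 6 (.sp 5 3 8 (.sp 5 3 7 (.H 3 8 7 5 9) (.V 5 0 3 8 7)) (.H 2 6 5 8 3)) (.V 5
  0 2 6 3)) (.H 0 1 5 6 2)) (.T 5 7 0 1 6)) (.V 7 1 0 5 8)) (.T 7 9 0 5 8)) (.T 7 3 0 1 8)) (.V 7
  0 3 8 9)))) (.V 8 5 0 6 9)) (.T 6 9 0 5 8)))) (.sp 4 3 6 (.sp 6 4 8 (.sp 6 7 8 (.sp 8 6 9 (.sp 7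
  3 8 (.sp 4 3 7 (.sp 7 4 8 (.sp 8 7 9 (.sp 7 6 9 (.H 3 8 6 7 4) (.H 3 8 6 7 9)) (.V 7 0 3 8 9))
  (.T 8 4 0 7 3)) (.V 3 7 0 6 4)) (.V 8 7 0 6 3)) (.V 6 0 3 8 9)) (.V 6 0 3 8 7)) (.T 8 4 0 6 3))
  (.V 3 6 0 8 4))) (.T 6 4 0 1 7)) (.T 6 3 0 1 7)) (.H 0 1 6 7 2))) (.sp 6 3 7 (.sp 7 6 8 (.sp 7 6
  9 (.sp 1 6 7 (.sp 7 8 9 (.sp 3 7 8 (.sp 2 8 9 (.sp 5 2 7 (.sp 5 7 8 (.V 5 0 2 7 8) (.H 2 7 8 9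
  3)) (.H 2 7 8 9 3)) (.V 8 7 0 2 9)) (.V 7 0 3 8 9)) (.sp 8 6 9 (.sp 3 6 8 (.sp 3 7 8 (.sp 5 2 7
  (.sp 5 6 8 (.sp 7 5 8 (.sp 2 5 6 (.sp 5 6 7 (.H 2 7 5 6 8) (.T 6 8 0 5 7)) (.V 5 0 2 6 8)) (.V 5
  0 2 7 8)) (.H 2 7 6 8 3)) (.H 2 7 6 8 3)) (.T 3 0 6 8 7)) (.sp 6 4 8 (.sp 1 6 8 (.sp 2 5 7 (.sp
  5 6 7 (.sp 5 1 7 (.sp 3 7 8 (.sp 5 1 6 (.sp 3 5 7 (.sp 3 5 8 (.sp 7 5 8 (.sp 5 6 8 (.sp 5 1 8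
  (.sp 7 1 8 (.H 1 6 8 7 5) (.V 7 1 0 5 8)) (.T 5 8 0 1 7)) (.V 6 1 0 5 8)) (.H 2 5 7 8 3)) (.T 3
  0 5 7 8)) (.T 5 3 0 1 7)) (.V 1 0 5 6 7)) (.H 3 8 7 6 9)) (.H 0 1 5 7 2)) (.V 7 5 0 6 2)) (.sp 5
  3 7 (.sp 7 5 8 (.sp 8 5 9 (.sp 5 6 8 (.sp 2 5 6 (.sp 5 6 7 (.H 2 7 5 6 8) (.T 6 8 0 5 7)) (.V 5
  0 2 6 8)) (.sp 5 3 6 (.sp 6 5 9 (.sp 3 7 8 (.sp 3 5 8 (.H 2 7 5 8 3) (.H 3 8 6 5 9)) (.H 3 8 7 6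
  9)) (.T 6 9 0 5 8)) (.T 6 3 0 5 8))) (.V 8 5 0 7 9)) (.V 5 0 2 7 8)) (.V 5 0 2 7 3))) (.T 6 3 0
  1 8)) (.T 8 4 0 6 3))) (.V 8 6 0 7 9))) (.T 6 3 0 1 7)) (.V 6 0 2 7 9)) (.V 6 0 2 7 8)) (.V 6 0
  2 7 3))) (.V 1 0 2 4 7)) (.I 1 2 7 3)) (.V 3 5 0 2 9)) (.V 3 8 0 2 9)) (.V 3 7 0 2 9)) (.V 3 6 0
  2 9)) (.T 2 9 0 7 3)) (.T 2 9 0 6 3)) (.V 2 6 0 1 8)) (.V 2 7 0 1 8)) (.V 2 5 0 1 8)) (.V 1 0 2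
  4 5)) (.V 1 0 2 4 6)) (.I 2 3 8 4)) (.I 1 2 8 3)) (.I 1 2 6 3)) (.I 1 2 5 3)

lemma ct311_ok : chk 10 5 (uW [0, 0, 0, 1, 2]) ct311 0 = true := by decide +kernel

/-- Certificate for wedge sizes `(1, 2, 2)`. -/
def ct122 : Ct :=
    .sp 3 1 6 (.sp 3 1 7 (.sp 4 2 6 (.sp 4 2 7 (.sp 4 2 8 (.sp 4 2 9 (.sp 2 5 6 (.sp 2 5 7 (.sp 2
  5 8 (.sp 2 5 9 (.sp 3 5 8 (.sp 3 6 8 (.sp 3 6 9 (.sp 3 7 8 (.sp 3 7 9 (.sp 4 1 8 (.sp 4 1 9 (.sp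
  3 6 7 (.sp 6 2 7 (.sp 6 1 7 (.sp 4 6 7 (.sp 6 5 7 (.sp 6 7 8 (.sp 7 8 9 (.sp 6 7 9 (.sp 3 8 9
  (.sp 6 8 9 (.H 3 6 7 8 9) (.V 8 7 0 6 9)) (.V 8 7 0 3 9)) (.T 7 8 0 6 9)) (.sp 5 6 8 (.sp 3 5 6
  (.sp 2 6 8 (.sp 6 8 9 (.sp 8 3 9 (.V 8 6 0 3 9) (.H 2 5 6 8 3)) (.H 2 5 6 8 3)) (.V 6 5 0 2 8))
  (.V 5 0 3 6 8)) (.sp 3 8 9 (.sp 8 4 9 (.sp 1 8 9 (.sp 2 8 9 (.sp 7 4 8 (.sp 7 4 9 (.sp 1 7 8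
  (.sp 2 7 8 (.sp 6 7 9 (.sp 6 8 9 (.sp 2 6 8 (.sp 2 6 9 (.H 2 6 8 9 3) (.T 6 8 0 2 9)) (.sp 2 1 8
  (.sp 6 1 8 (.sp 4 6 8 (.sp 5 7 8 (.H 2 5 7 8 6) (.H 1 7 8 6 2)) (.T 6 4 0 2 8)) (.V 6 1 0 2 8))
  (.T 2 8 0 1 6))) (.sp 6 4 8 (.sp 4 6 9 (.V 9 6 0 8 4) (.H 4 9 8 6 7)) (.T 8 4 0 6 9))) (.T 7 4 0
  6 9)) (.V 8 2 0 7 9)) (.V 8 1 0 7 9)) (.V 9 7 0 8 4)) (.T 8 4 0 7 9)) (.T 8 4 0 2 9)) (.T 8 4 0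
  1 9)) (.H 0 3 8 9 4)) (.sp 8 6 9 (.sp 6 5 9 (.sp 7 6 9 (.sp 7 5 9 (.sp 6 2 9 (.sp 7 2 9 (.sp 4 7
  9 (.H 2 5 9 7 6) (.T 7 4 0 6 9)) (.V 7 2 0 6 9)) (.T 6 9 0 2 7)) (.T 9 0 5 7 6)) (.H 3 6 7 9 8))
  (.T 6 9 0 5 8)) (.V 8 6 0 3 9))))) (.sp 6 2 8 (.sp 6 5 8 (.sp 7 2 8 (.sp 4 7 8 (.sp 7 5 8 (.sp 8
  7 9 (.sp 8 2 9 (.sp 4 8 9 (.sp 8 6 9 (.sp 6 2 9 (.sp 6 5 9 (.sp 5 8 9 (.V 8 5 0 6 9) (.H 2 5 9 8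
  6)) (.T 6 9 0 5 8)) (.T 6 9 0 2 8)) (.V 8 6 0 7 9)) (.T 8 4 0 7 9)) (.V 8 2 0 7 9)) (.H 2 5 8 7
  6)) (.V 7 5 0 6 8)) (.T 7 4 0 6 8)) (.V 7 2 0 6 8)) (.T 6 8 0 5 7)) (.T 6 8 0 2 7))) (.V 6 5 0 2
  7)) (.T 6 4 0 2 7)) (.V 6 1 0 2 7)) (.H 0 2 6 7 3)) (.sp 6 4 7 (.sp 7 6 8 (.sp 7 6 9 (.sp 1 6 7
  (.sp 2 6 7 (.sp 3 8 9 (.sp 8 4 9 (.sp 1 8 9 (.sp 2 8 9 (.sp 6 8 9 (.sp 7 8 9 (.sp 6 5 7 (.sp 5 6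
  8 (.T 6 8 0 5 7) (.H 3 7 6 8 9)) (.H 3 7 6 8 9)) (.V 8 6 0 7 9)) (.sp 2 6 8 (.sp 6 4 8 (.sp 6 4
  9 (.sp 5 6 8 (.sp 5 6 7 (.sp 7 8 9 (.sp 2 7 8 (.sp 2 7 9 (.H 2 7 8 9 3) (.T 7 8 0 2 9)) (.sp 4 7
  8 (.sp 7 5 8 (.H 2 5 6 8 7) (.V 7 5 0 2 8)) (.T 7 4 0 2 8))) (.sp 7 4 8 (.sp 4 7 9 (.V 9 7 0 8
  4) (.H 4 9 8 7 6)) (.T 8 4 0 7 9))) (.T 6 8 0 5 7)) (.sp 5 4 6 (.sp 6 5 9 (.sp 7 5 8 (.sp 5 4 8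
  (.sp 8 5 9 (.sp 5 4 9 (.sp 8 7 9 (.sp 7 4 8 (.sp 7 4 9 (.sp 6 5 7 (.sp 5 3 6 (.sp 3 5 7 (.T 3 0
  5 7 6) (.H 3 7 6 5 8)) (.T 6 3 0 5 7)) (.H 4 9 8 7 6)) (.V 9 7 0 8 4)) (.T 8 4 0 7 9)) (.H 4 9 8
  6 5)) (.V 9 5 0 6 4)) (.V 8 5 0 6 9)) (.V 8 5 0 6 4)) (.T 8 0 5 7 6)) (.T 6 9 0 5 8)) (.T 6 4 0
  5 8))) (.V 9 6 0 8 4)) (.T 8 4 0 6 9)) (.V 8 2 0 6 9))) (.T 8 4 0 2 9)) (.T 8 4 0 1 9)) (.H 0 3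
  8 9 4)) (.sp 8 6 9 (.sp 8 7 9 (.sp 6 5 7 (.sp 5 3 6 (.sp 6 5 8 (.sp 7 5 8 (.sp 5 3 7 (.sp 5 8 9
  (.V 8 5 0 6 9) (.H 3 7 6 5 8)) (.T 3 0 5 7 6)) (.V 7 5 0 6 8)) (.T 6 8 0 5 7)) (.T 6 3 0 5 7))
  (.H 3 7 6 9 8)) (.V 8 7 0 3 9)) (.V 8 6 0 3 9))) (.T 6 4 0 2 7)) (.T 6 3 0 1 7)) (.V 6 0 3 7 9))
  (.V 6 0 3 7 8)) (.V 6 0 3 7 4))) (.T 4 0 1 3 9)) (.T 4 0 1 3 8)) (.V 3 7 0 2 9)) (.V 3 7 0 2 8))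
  (.V 3 6 0 2 9)) (.V 3 6 0 2 8)) (.V 3 5 0 2 8)) (.T 2 9 0 5 3)) (.T 2 8 0 5 3)) (.V 2 5 0 1 7))
  (.V 2 5 0 1 6)) (.I 2 3 9 4)) (.I 2 3 8 4)) (.I 2 3 7 4)) (.I 2 3 6 4)) (.I 1 2 7 3)) (.I 1 2 6
  3)

lemma ct122_ok : chk 10 5 (uW [0, 1, 1, 2, 2]) ct122 0 = true := by decide +kernel

/-- Certificate for wedge sizes `(2, 2, 1)`. -/
def ct221 : Ct :=
    .sp 3 1 5 (.sp 3 1 7 (.sp 3 1 8 (.sp 4 2 7 (.sp 4 2 8 (.sp 4 1 5 (.sp 2 5 7 (.sp 2 5 8 (.sp 2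
  6 7 (.sp 2 6 8 (.sp 2 5 9 (.sp 2 6 9 (.sp 3 5 9 (.sp 3 6 9 (.sp 3 7 9 (.sp 3 8 9 (.sp 2 7 8 (.sp
  7 3 8 (.sp 7 4 8 (.sp 8 7 9 (.sp 1 7 8 (.sp 6 7 8 (.sp 2 5 6 (.sp 5 1 6 (.sp 3 5 6 (.sp 5 6 7
  (.sp 5 6 8 (.sp 7 5 8 (.sp 5 3 7 (.sp 7 5 9 (.sp 5 3 8 (.sp 5 8 9 (.T 9 0 5 8 7) (.H 3 8 7 5 9))
  (.V 8 5 0 7 3)) (.T 7 9 0 5 8)) (.T 7 3 0 5 8)) (.H 2 5 6 7 8)) (.T 6 7 0 5 8)) (.sp 5 1 7 (.sp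
  6 1 7 (.sp 6 7 9 (.sp 3 6 7 (.sp 2 7 9 (.sp 6 8 9 (.sp 3 6 8 (.sp 2 8 9 (.H 2 6 8 9 3) (.V 8 6 0
  2 9)) (.V 6 0 3 8 9)) (.sp 3 6 8 (.sp 2 8 9 (.sp 3 5 8 (.sp 6 5 8 (.sp 8 5 9 (.sp 5 7 8 (.sp 6 5
  9 (.sp 5 1 8 (.sp 6 1 8 (.sp 1 7 9 (.sp 5 1 9 (.sp 6 1 9 (.sp 7 5 9 (.V 7 1 0 5 9) (.H 1 7 9 6
  5)) (.V 6 1 0 5 9)) (.T 5 9 0 1 8)) (.H 1 7 8 6 5)) (.V 6 1 0 5 8)) (.T 5 8 0 1 6)) (.V 5 0 6 9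
  8)) (.V 8 5 0 7 3)) (.H 2 5 8 9 3)) (.H 2 5 6 8 3)) (.T 3 0 5 6 8)) (.H 2 6 7 9 8)) (.H 3 8 6 7
  9))) (.V 7 6 0 2 9)) (.V 6 0 3 7 9)) (.sp 6 5 9 (.sp 7 1 9 (.sp 7 5 9 (.sp 5 1 9 (.sp 6 1 9 (.H
  1 9 7 6 5) (.V 6 1 0 5 9)) (.T 5 9 0 1 6)) (.V 7 5 0 6 9)) (.V 7 1 0 6 9)) (.T 6 9 0 5 7))) (.V
  6 1 0 5 7)) (.T 5 7 0 1 6))) (.T 5 3 0 1 6)) (.H 0 1 5 6 2)) (.sp 6 5 7 (.sp 6 5 8 (.sp 7 5 8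
  (.sp 5 3 7 (.sp 7 5 9 (.sp 5 3 8 (.sp 5 8 9 (.T 9 0 5 8 7) (.H 3 8 7 5 9)) (.V 8 5 0 7 3)) (.T 7
  9 0 5 8)) (.T 7 3 0 5 8)) (.H 2 6 5 7 8)) (.V 5 0 2 6 8)) (.V 5 0 2 6 7))) (.sp 6 3 7 (.sp 7 6 9
  (.sp 6 3 8 (.sp 8 6 9 (.sp 6 5 7 (.sp 5 6 9 (.T 6 9 0 5 7) (.H 3 8 7 6 9)) (.H 3 8 7 6 9)) (.V 8
  6 0 7 9)) (.V 8 6 0 7 3)) (.T 7 9 0 6 8)) (.T 7 3 0 6 8))) (.T 7 3 0 1 8)) (.V 7 0 3 8 9)) (.V 7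
  0 3 8 4)) (.H 0 2 7 8 3)) (.sp 7 1 8 (.sp 4 7 8 (.sp 7 5 8 (.sp 7 6 8 (.sp 3 7 8 (.sp 2 5 6 (.sp
  5 1 6 (.sp 3 5 6 (.sp 4 5 6 (.sp 5 6 8 (.sp 5 6 7 (.sp 8 7 9 (.sp 7 2 9 (.sp 7 6 9 (.sp 8 2 9
  (.sp 8 6 9 (.H 2 6 9 8 7) (.V 8 6 0 7 9)) (.V 8 2 0 7 9)) (.T 7 9 0 6 8)) (.T 7 9 0 2 8)) (.H 2
  5 6 8 7)) (.T 6 8 0 5 7)) (.sp 5 1 8 (.sp 6 1 8 (.sp 4 6 8 (.sp 6 8 9 (.sp 3 6 8 (.sp 7 8 9 (.sp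
  5 6 7 (.sp 6 7 9 (.sp 3 6 7 (.sp 2 7 9 (.H 2 6 7 9 3) (.V 7 6 0 2 9)) (.V 6 0 3 7 9)) (.sp 3 6 7
  (.sp 5 3 7 (.V 7 6 0 5 3) (.H 2 5 6 7 3)) (.H 3 7 6 8 9))) (.sp 5 1 7 (.sp 6 1 7 (.H 1 8 7 6 5)
  (.V 6 1 0 5 7)) (.T 5 7 0 1 6))) (.V 8 6 0 7 9)) (.V 6 0 3 8 9)) (.sp 6 1 9 (.sp 8 5 9 (.sp 6 5
  9 (.sp 5 1 9 (.sp 8 1 9 (.H 1 9 8 6 5) (.V 8 1 0 5 9)) (.T 5 9 0 1 8)) (.V 5 0 6 9 8)) (.V 8 5 0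
  6 9)) (.T 6 9 0 1 8))) (.T 6 4 0 5 8)) (.V 6 1 0 5 8)) (.T 5 8 0 1 6))) (.T 5 4 0 1 6)) (.T 5 3
  0 1 6)) (.H 0 1 5 6 2)) (.sp 6 5 7 (.sp 6 5 8 (.sp 8 7 9 (.sp 5 8 9 (.sp 6 8 9 (.V 8 6 0 7 9)
  (.V 8 5 0 6 9)) (.H 2 6 5 8 7)) (.H 2 6 5 8 7)) (.V 5 0 2 6 8)) (.V 5 0 2 6 7))) (.T 7 3 0 1 8))
  (.V 7 6 0 2 8)) (.V 7 5 0 2 8)) (.T 7 4 0 2 8)) (.V 7 1 0 2 8))) (.V 3 8 0 2 9)) (.V 3 7 0 2 9))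
  (.V 3 6 0 2 9)) (.V 3 5 0 2 9)) (.T 2 9 0 6 3)) (.T 2 9 0 5 3)) (.V 2 6 0 1 8)) (.V 2 6 0 1 7))
  (.V 2 5 0 1 8)) (.V 2 5 0 1 7)) (.V 1 0 2 4 5)) (.I 2 3 8 4)) (.I 2 3 7 4)) (.I 1 2 8 3)) (.I 1
  2 7 3)) (.I 1 2 5 3)

lemma ct221_ok : chk 10 5 (uW [0, 0, 1, 1, 2]) ct221 0 = true := by decide +kernel

/-- Certificate for wedge sizes `(2, 1, 2)`. -/
def ct212 : Ct :=
    .sp 3 1 5 (.sp 3 1 7 (.sp 4 2 7 (.sp 4 2 8 (.sp 4 2 9 (.sp 2 5 7 (.sp 2 6 7 (.sp 2 5 8 (.sp 2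
  6 8 (.sp 2 5 9 (.sp 2 6 9 (.sp 3 6 8 (.sp 3 6 9 (.sp 3 7 8 (.sp 3 7 9 (.sp 4 1 8 (.sp 4 1 9 (.sp
  3 8 9 (.sp 8 4 9 (.sp 1 8 9 (.sp 2 8 9 (.sp 7 8 9 (.sp 2 7 8 (.sp 7 2 9 (.T 7 8 0 2 9) (.H 2 7 8
  9 3)) (.sp 7 5 8 (.sp 7 6 8 (.sp 2 5 6 (.sp 5 1 6 (.sp 3 5 6 (.sp 6 7 9 (.sp 3 6 7 (.sp 2 7 9
  (.H 2 6 7 9 3) (.V 7 6 0 2 9)) (.V 6 0 3 7 9)) (.sp 5 6 8 (.sp 5 6 7 (.sp 4 6 8 (.sp 6 8 9 (.sp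
  3 6 7 (.sp 5 3 7 (.V 7 6 0 5 3) (.H 2 5 6 7 3)) (.H 3 7 6 8 9)) (.T 8 4 0 6 9)) (.H 2 5 6 8 7))
  (.T 6 8 0 5 7)) (.sp 5 1 8 (.sp 6 1 8 (.sp 6 8 9 (.sp 5 6 7 (.sp 3 6 7 (.sp 5 3 7 (.V 7 6 0 5 3)
  (.H 2 5 6 7 3)) (.H 3 7 6 8 9)) (.sp 6 5 9 (.sp 5 1 9 (.sp 6 1 9 (.sp 8 5 9 (.T 9 0 1 8 5) (.H 1
  8 9 6 5)) (.V 6 1 0 5 9)) (.T 5 9 0 1 6)) (.T 6 9 0 5 7))) (.V 8 1 0 6 9)) (.V 6 1 0 5 8)) (.T 5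
  8 0 1 6)))) (.T 5 3 0 1 6)) (.H 0 1 5 6 2)) (.sp 6 5 7 (.sp 5 6 8 (.T 6 8 0 5 7) (.H 2 6 5 8 7))
  (.V 5 0 2 6 7))) (.V 7 6 0 2 8)) (.V 7 5 0 2 8))) (.sp 2 7 8 (.sp 7 4 8 (.sp 7 4 9 (.sp 6 7 8
  (.sp 3 6 7 (.sp 5 6 7 (.sp 3 5 6 (.sp 3 5 7 (.sp 5 2 6 (.V 5 0 2 6 7) (.H 2 5 6 7 3)) (.V 7 6 0
  5 3)) (.T 6 7 0 5 3)) (.H 2 6 7 8 3)) (.V 6 0 3 7 8)) (.sp 6 4 7 (.sp 7 6 9 (.sp 6 4 8 (.sp 8 6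
  9 (.sp 6 4 9 (.sp 6 5 7 (.sp 4 5 6 (.sp 5 6 8 (.T 6 8 0 5 7) (.T 6 4 0 5 8)) (.H 4 9 8 7 6)) (.H
  4 9 8 7 6)) (.V 9 6 0 7 4)) (.V 8 6 0 7 9)) (.V 8 6 0 7 4)) (.T 7 9 0 6 8)) (.T 7 4 0 6 8))) (.V
  9 7 0 8 4)) (.T 8 4 0 7 9)) (.V 8 2 0 7 9))) (.T 8 4 0 2 9)) (.T 8 4 0 1 9)) (.H 0 3 8 9 4))
  (.sp 8 2 9 (.sp 8 6 9 (.sp 8 7 9 (.sp 4 8 9 (.sp 2 7 8 (.sp 7 2 9 (.sp 7 1 9 (.sp 4 7 9 (.sp 7 5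
  9 (.sp 7 6 9 (.sp 5 6 7 (.sp 2 5 6 (.sp 6 5 9 (.sp 5 1 6 (.sp 3 5 6 (.sp 3 6 7 (.sp 5 3 7 (.V 7
  6 0 5 3) (.H 2 5 6 7 3)) (.sp 7 6 8 (.H 3 7 6 9 8) (.V 6 0 3 7 8))) (.T 5 3 0 1 6)) (.H 0 1 5 6
  2)) (.H 2 5 6 9 7)) (.V 5 0 2 6 7)) (.sp 6 5 9 (.sp 2 5 6 (.sp 5 1 6 (.sp 5 1 7 (.sp 5 1 9 (.sp
  6 1 7 (.sp 6 1 9 (.H 1 9 7 6 5) (.V 6 1 0 5 9)) (.V 6 1 0 5 7)) (.T 5 9 0 1 6)) (.T 5 7 0 1 6))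
  (.H 0 1 5 6 2)) (.H 2 6 5 9 7)) (.T 6 9 0 5 7))) (.V 7 6 0 2 9)) (.V 7 5 0 2 9)) (.T 7 4 0 2 9))
  (.V 7 1 0 2 9)) (.H 2 7 9 8 3)) (.sp 7 2 9 (.sp 7 6 8 (.sp 4 7 9 (.sp 7 5 9 (.sp 7 6 9 (.sp 5 2
  6 (.sp 6 5 7 (.sp 5 6 9 (.T 6 9 0 5 7) (.H 2 6 5 9 7)) (.V 5 0 2 6 7)) (.H 2 6 9 8 7)) (.V 7 6 0
  2 9)) (.V 7 5 0 2 9)) (.T 7 4 0 2 9)) (.V 7 6 0 2 8)) (.V 2 0 7 9 8))) (.T 8 4 0 2 9)) (.V 8 7 0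
  3 9)) (.V 8 6 0 3 9)) (.V 8 2 0 3 9))) (.T 4 0 1 3 9)) (.T 4 0 1 3 8)) (.V 3 7 0 2 9)) (.V 3 7 0
  2 8)) (.V 3 6 0 2 9)) (.V 3 6 0 2 8)) (.T 2 9 0 6 3)) (.T 2 9 0 5 3)) (.T 2 8 0 6 3)) (.T 2 8 0
  5 3)) (.V 2 6 0 1 7)) (.V 2 5 0 1 7)) (.I 2 3 9 4)) (.I 2 3 8 4)) (.I 2 3 7 4)) (.I 1 2 7 3))
  (.I 1 2 5 3)

lemma ct212_ok : chk 10 5 (uW [0, 0, 1, 2, 2]) ct212 0 = true := by decide +kernel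

/-- Certificate for wedge sizes `(1, 3, 1)`. -/
def ct131 : Ct :=
    .sp 3 1 6 (.sp 3 1 7 (.sp 3 1 8 (.sp 4 2 6 (.sp 4 2 7 (.sp 4 1 6 (.sp 2 5 6 (.sp 2 5 7 (.sp 2
  5 8 (.sp 3 6 9 (.sp 3 7 9 (.sp 3 8 9 (.sp 2 5 9 (.sp 2 7 8 (.sp 3 7 8 (.sp 6 7 8 (.sp 3 6 7 (.sp
  6 3 8 (.T 3 0 6 7 8) (.H 0 6 7 8 3)) (.T 7 8 0 6 3)) (.H 0 2 7 8 3)) (.sp 7 4 8 (.sp 8 7 9 (.sp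
  1 7 8 (.sp 3 6 8 (.sp 6 7 8 (.sp 6 2 8 (.sp 6 1 8 (.sp 6 2 7 (.sp 6 5 8 (.sp 6 1 7 (.sp 5 7 8
  (.sp 6 5 7 (.H 2 5 7 8 6) (.V 6 5 0 2 7)) (.H 1 7 8 6 2)) (.V 1 0 6 7 8)) (.V 6 5 0 2 8)) (.V 2
  0 6 7 8)) (.V 6 1 0 2 8)) (.H 0 2 6 8 3)) (.V 8 6 0 7 3)) (.sp 6 4 8 (.sp 2 6 8 (.sp 8 6 9 (.sp
  6 7 8 (.sp 6 2 7 (.sp 3 6 7 (.sp 4 6 7 (.sp 6 5 7 (.sp 7 6 9 (.H 3 8 6 7 4) (.H 3 8 6 7 9)) (.V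
  6 5 0 2 7)) (.T 6 4 0 2 7)) (.T 6 3 0 2 7)) (.H 0 2 6 7 8)) (.sp 6 3 7 (.sp 7 6 9 (.sp 6 5 7
  (.sp 5 6 9 (.sp 6 5 8 (.T 6 9 0 5 8) (.T 6 8 0 5 7)) (.H 3 8 7 6 9)) (.H 3 8 7 6 9)) (.T 7 9 0 6
  8)) (.T 7 3 0 6 8))) (.V 6 0 3 8 9)) (.T 6 3 0 2 8)) (.V 6 0 3 8 4))) (.T 7 3 0 1 8)) (.V 7 0 3
  8 9)) (.V 7 0 3 8 4))) (.sp 7 1 8 (.sp 3 7 8 (.sp 4 7 8 (.sp 7 5 8 (.sp 3 6 7 (.sp 3 6 8 (.sp 6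
  2 7 (.sp 7 6 8 (.sp 6 2 8 (.sp 6 5 7 (.sp 6 5 8 (.sp 8 7 9 (.sp 8 2 9 (.sp 4 8 9 (.sp 8 6 9 (.sp
  7 2 9 (.sp 7 5 9 (.sp 5 8 9 (.V 8 5 0 6 9) (.H 2 5 9 8 7)) (.T 7 9 0 5 8)) (.T 7 9 0 2 8)) (.V 8
  6 0 7 9)) (.T 8 4 0 7 9)) (.V 8 2 0 7 9)) (.H 2 5 8 7 6)) (.T 6 8 0 5 7)) (.V 6 5 0 2 7)) (.H 0
  2 6 8 3)) (.H 0 6 7 8 3)) (.H 0 2 6 7 3)) (.T 3 0 6 7 8)) (.sp 6 4 7 (.sp 2 6 7 (.sp 7 6 9 (.sp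
  1 6 7 (.sp 7 6 8 (.sp 3 6 8 (.sp 5 6 8 (.sp 5 6 7 (.sp 2 6 8 (.sp 6 8 9 (.sp 8 7 9 (.V 8 6 0 7
  9) (.H 3 7 6 8 9)) (.H 2 5 6 8 7)) (.V 6 5 0 2 8)) (.V 5 0 6 8 7)) (.sp 6 8 9 (.sp 8 7 9 (.V 8 6
  0 7 9) (.H 3 7 6 8 9)) (.sp 6 4 8 (.sp 1 6 8 (.sp 2 6 8 (.H 1 6 8 7 2) (.T 6 4 0 2 8)) (.T 6 4 0
  1 8)) (.H 3 7 6 8 4)))) (.sp 2 6 8 (.sp 8 6 9 (.sp 1 6 8 (.sp 5 6 8 (.sp 6 5 7 (.V 5 0 6 8 7)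
  (.H 2 5 6 8 7)) (.H 1 6 8 7 2)) (.T 6 3 0 1 8)) (.V 6 0 3 8 9)) (.T 6 3 0 2 8))) (.T 7 8 0 6 3))
  (.T 6 3 0 1 7)) (.V 6 0 3 7 9)) (.T 6 3 0 2 7)) (.V 6 0 3 7 4))) (.V 7 5 0 2 8)) (.T 7 4 0 2 8))
  (.T 7 3 0 2 8)) (.V 7 1 0 2 8))) (.T 2 9 0 5 3)) (.V 3 8 0 2 9)) (.V 3 7 0 2 9)) (.V 3 6 0 2 9))
  (.V 2 5 0 1 8)) (.V 2 5 0 1 7)) (.V 2 5 0 1 6)) (.V 1 0 2 4 6)) (.I 2 3 7 4)) (.I 2 3 6 4)) (.I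
  1 2 8 3)) (.I 1 2 7 3)) (.I 1 2 6 3)

lemma ct131_ok : chk 10 5 (uW [0, 1, 1, 1, 2]) ct131 0 = true := by decide +kernel


/-! ### Certificates for the position of double wedges -/

/-- Certificate for wedge sizes `(2, 1, 1)` with extra assumptions. -/
def ct_fa : Ct :=
    .sp 3 1 5 (.sp 4 1 5 (.sp 2 5 7 (.sp 2 6 7 (.sp 2 5 8 (.sp 2 6 8 (.sp 3 5 8 (.sp 3 6 8 (.sp 3
  7 8 (.sp 2 5 6 (.sp 5 1 6 (.sp 3 5 6 (.sp 4 5 6 (.sp 6 5 7 (.sp 6 5 8 (.sp 4 6 7 (.sp 5 1 7 (.sp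
  6 1 7 (.sp 5 1 8 (.sp 6 1 8 (.sp 6 7 8 (.sp 2 7 8 (.H 2 6 7 8 3) (.V 7 6 0 2 8)) (.sp 7 1 8 (.sp
  4 7 8 (.sp 7 5 8 (.H 1 8 7 6 5) (.V 7 5 0 6 8)) (.T 7 4 0 6 8)) (.V 7 1 0 6 8))) (.V 6 1 0 5 8))
  (.T 5 8 0 1 6)) (.V 6 1 0 5 7)) (.T 5 7 0 1 6)) (.T 6 4 0 5 7)) (.H 2 5 6 8 3)) (.H 2 5 6 7 3))
  (.T 5 4 0 1 6)) (.T 5 3 0 1 6)) (.H 0 1 5 6 2)) (.sp 5 3 6 (.sp 6 5 7 (.H 2 6 5 7 3) (.V 5 0 2 6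
  7)) (.V 5 0 2 6 3))) (.V 3 7 0 2 8)) (.V 3 6 0 2 8)) (.V 3 5 0 2 8)) (.T 2 8 0 6 3)) (.T 2 8 0 5
  3)) (.V 2 6 0 1 7)) (.V 2 5 0 1 7)) (.V 1 0 2 4 5)) (.I 1 2 5 3)

lemma ct_fa_ok : chk 9 5 (uW [0, 0, 1, 2]) ct_fa (st (st 0 6 7 3) 5 7 3) = true := by decide +kernel

/-- Certificate for wedge sizes `(2, 1, 1)` with extra assumptions. -/
def ct_fb : Ct :=
    .sp 2 5 7 (.sp 2 6 7 (.sp 3 7 8 (.sp 3 5 6 (.sp 3 5 7 (.sp 5 2 6 (.V 5 0 2 6 3) (.H 2 5 6 7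
  3)) (.V 7 6 0 5 3)) (.T 6 7 0 5 3)) (.V 3 7 0 2 8)) (.V 2 6 0 1 7)) (.V 2 5 0 1 7)

lemma ct_fb_ok : chk 9 5 (uW [0, 0, 1, 2]) ct_fb (st (st 0 6 7 3) 7 5 6) = true := by decide +kernel

/-- Certificate for wedge sizes `(1, 1, 2)` with extra assumptions. -/
def ct_fc : Ct :=
    .sp 4 2 7 (.sp 2 5 6 (.sp 2 5 7 (.sp 2 5 8 (.sp 3 5 7 (.sp 3 5 8 (.sp 3 6 7 (.sp 3 6 8 (.sp 4
  1 8 (.sp 3 7 8 (.sp 7 4 8 (.sp 2 7 8 (.sp 7 6 8 (.sp 7 5 8 (.sp 6 4 7 (.sp 6 4 8 (.sp 5 4 7 (.sp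
  5 4 8 (.sp 5 6 7 (.sp 3 5 6 (.H 2 5 6 7 3) (.V 5 0 3 6 7)) (.sp 5 4 6 (.sp 6 5 8 (.H 4 8 7 6 5)
  (.V 5 0 6 8 7)) (.V 5 0 4 7 6))) (.V 8 5 0 7 4)) (.T 7 4 0 5 8)) (.V 8 6 0 7 4)) (.T 7 4 0 6 8))
  (.H 2 5 7 8 3)) (.H 2 6 7 8 3)) (.T 7 4 0 2 8)) (.H 0 3 7 8 4)) (.sp 7 2 8 (.sp 7 6 8 (.H 2 6 8
  7 3) (.V 7 6 0 3 8)) (.V 7 2 0 3 8))) (.T 4 0 1 3 8)) (.V 3 6 0 2 8)) (.V 3 6 0 2 7)) (.V 3 5 0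
  2 8)) (.V 3 5 0 2 7)) (.T 2 8 0 5 3)) (.T 2 7 0 5 3)) (.V 2 5 0 1 6)) (.I 2 3 7 4)

lemma ct_fc_ok : chk 9 5 (uW [0, 1, 2, 2]) ct_fc (st (st 0 6 7 2) 6 8 2) = true := by decide +kernel

/-- Certificate for wedge sizes `(1, 1, 2)` with extra assumptions. -/
def ct_fd : Ct :=
    .sp 2 5 6 (.sp 3 6 7 (.sp 3 6 8 (.sp 2 6 8 (.sp 2 7 8 (.sp 7 3 8 (.V 7 2 0 3 8) (.H 2 6 7 8
  3)) (.V 7 6 0 2 8)) (.T 6 7 0 2 8)) (.V 3 6 0 2 8)) (.V 3 6 0 2 7)) (.V 2 5 0 1 6)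

lemma ct_fd_ok : chk 9 5 (uW [0, 1, 2, 2]) ct_fd (st (st 0 6 7 2) 8 6 7) = true := by decide +kernel

/-! ### The full configuration -/

/-- The orientations known in advance in the configuration with `|A| = 6` and wedge sizes
`3, 0, 0, 3`: index `0` is the apex, `1, …, 5` are the points `p`, `6, …, 11` are in `B`. -/
def uF (a b c : ℕ) : Bool :=
  match a with
  | 0 => lt' 0 b && (lt' 0 c && (
      bif lt' b 6 then
        (bif lt' c 6 then (Nat.beq b 5 && Nat.beq c 1) || (lt' b c && !(Nat.beq b 1 && Nat.beq c 5))
        else bif lt' c 9 then Nat.beq b 1 else lt' 1 b && lt' b 5)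
      else
        (bif lt' c 6 then (bif lt' b 9 then lt' 1 c && lt' c 5 else Nat.beq c 5) else lt' b c)))
  | a' + 1 => lt' a' 5 && (lt' 0 b && (lt' b 6 && (
      bif lt' c 6 then lt' (Nat.succ a') b && lt' b c
      else (Nat.beq a' 4 && Nat.beq b 1) || (Nat.beq a' b &&
        (bif lt' c 9 then lt' b 3 else lt' 2 b)))))

/-- Certificate for the full configuration. -/
def ct_full : Ct :=
    .sp 3 1 6 (.sp 3 1 7 (.sp 5 3 9 (.sp 5 3 10 (.sp 5 3 11 (.sp 2 7 9 (.sp 2 8 9 (.sp 2 7 10 (.sp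
  2 8 10 (.sp 2 7 11 (.sp 2 8 11 (.sp 3 6 9 (.sp 3 7 9 (.sp 3 8 9 (.sp 3 6 10 (.sp 3 7 10 (.sp 3 8
  10 (.sp 3 7 11 (.sp 3 8 11 (.sp 3 6 11 (.sp 4 1 6 (.sp 4 1 7 (.sp 5 2 9 (.sp 5 2 10 (.sp 5 2 11
  (.sp 4 7 9 (.sp 4 8 9 (.sp 4 7 10 (.sp 4 8 10 (.sp 3 6 7 (.sp 2 6 7 (.sp 6 7 8 (.sp 2 6 8 (.sp 6
  1 8 (.sp 7 2 8 (.sp 6 1 7 (.sp 4 2 6 (.sp 3 6 8 (.sp 4 6 8 (.sp 7 3 8 (.sp 8 7 9 (.sp 8 7 10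
  (.sp 4 2 8 (.sp 3 4 8 (.sp 3 4 6 (.H 2 6 8 3 4) (.V 3 8 0 6 4)) (.sp 3 9 11 (.sp 4 9 11 (.sp 9
  10 11 (.sp 9 5 11 (.sp 3 10 11 (.sp 4 10 11 (.sp 2 9 11 (.sp 4 2 11 (.sp 9 4 10 (.sp 4 2 9 (.sp
  9 3 10 (.sp 5 9 10 (.sp 9 2 10 (.sp 2 3 10 (.sp 2 3 9 (.sp 2 3 11 (.H 2 3 9 11 4) (.V 2 5 3 9
  11)) (.V 2 0 3 10 9)) (.H 2 8 7 10 3)) (.V 9 2 4 10 5)) (.T 9 5 4 10 11)) (.V 9 3 0 4 10)) (.V 2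
  0 4 9 11)) (.H 0 4 9 10 11)) (.H 0 2 4 11 5)) (.T 9 5 0 2 11)) (.T 11 0 4 9 10)) (.T 11 0 3 9
  10)) (.H 0 4 9 11 5)) (.sp 5 9 10 (.sp 5 10 11 (.sp 9 4 10 (.sp 9 7 10 (.sp 7 9 11 (.T 9 11 0 7
  10) (.V 9 10 4 7 11)) (.V 9 7 0 4 10)) (.H 0 4 9 10 5)) (.T 10 5 0 9 11)) (.sp 2 9 10 (.sp 3 9
  10 (.sp 4 9 10 (.sp 9 8 10 (.sp 9 7 10 (.sp 9 7 11 (.sp 2 3 9 (.sp 2 3 10 (.sp 4 10 11 (.sp 4 2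
  11 (.sp 4 2 10 (.sp 4 2 9 (.H 2 3 9 10 4) (.V 2 0 4 9 10)) (.T 4 10 0 2 11)) (.H 0 2 4 11 5))
  (.sp 3 10 11 (.V 10 3 0 4 11) (.H 3 9 11 10 4))) (.V 2 5 3 9 10)) (.H 2 8 7 9 3)) (.T 9 11 0 7
  10)) (.V 9 7 0 8 10)) (.H 3 8 9 10 4)) (.V 9 3 0 4 10)) (.T 9 5 0 3 10)) (.T 9 5 0 2 10)))) (.V
  9 3 0 4 11)) (.sp 5 9 11 (.sp 9 7 11 (.sp 9 10 11 (.sp 9 4 11 (.sp 5 9 10 (.sp 9 3 10 (.sp 9 4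
  10 (.sp 10 5 11 (.sp 3 10 11 (.sp 10 4 11 (.T 10 5 0 4 11) (.H 3 10 11 9 4)) (.T 10 5 3 11 9))
  (.H 0 9 10 11 5)) (.T 9 10 0 4 11)) (.T 9 10 0 3 11)) (.V 9 0 5 10 11)) (.H 0 4 9 11 5)) (.sp 5
  10 11 (.sp 4 9 10 (.sp 9 5 10 (.sp 4 2 10 (.sp 2 9 10 (.sp 3 9 10 (.sp 4 2 9 (.sp 9 8 10 (.sp 9
  7 10 (.sp 2 3 9 (.sp 2 3 10 (.H 2 3 9 10 4) (.V 2 5 3 9 10)) (.H 2 8 7 9 3)) (.V 9 7 0 8 10))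
  (.H 3 8 9 10 4)) (.V 2 0 4 9 10)) (.T 9 5 0 3 10)) (.T 9 5 0 2 10)) (.H 0 2 4 10 5)) (.H 0 4 9
  10 5)) (.sp 9 3 10 (.sp 9 7 10 (.sp 10 3 11 (.sp 9 4 11 (.sp 10 7 11 (.sp 10 4 11 (.H 3 11 10 9
  4) (.T 10 9 4 7 11)) (.V 10 7 0 9 11)) (.V 9 10 4 7 11)) (.V 10 3 0 9 11)) (.V 9 7 0 4 10)) (.V
  9 3 0 4 10))) (.V 11 9 0 10 5))) (.V 9 7 0 3 11)) (.T 9 5 0 3 11)))) (.T 2 6 3 4 8)) (.V 7 0 2 8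
  10)) (.V 7 0 2 8 9)) (.V 7 0 2 8 3)) (.T 6 4 0 1 8)) (.T 6 3 0 1 8)) (.H 0 1 6 2 4)) (.T 6 7 1 8
  2)) (.H 0 6 7 8 2)) (.H 0 1 6 8 2)) (.sp 7 2 8 (.sp 6 3 8 (.sp 3 7 8 (.V 7 0 2 8 3) (.H 2 8 6 7
  3)) (.V 6 0 2 8 3)) (.V 8 7 0 6 2))) (.sp 2 7 8 (.sp 3 7 8 (.sp 6 1 7 (.sp 7 1 8 (.sp 6 1 8 (.sp
  4 2 6 (.sp 4 6 7 (.sp 3 6 8 (.sp 4 2 7 (.sp 3 4 7 (.sp 3 4 6 (.H 2 6 7 3 4) (.V 3 7 0 6 4)) (.sp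
  4 3 8 (.sp 3 9 11 (.sp 4 9 11 (.sp 9 10 11 (.sp 9 5 11 (.sp 4 10 11 (.sp 2 9 11 (.sp 4 2 11 (.sp
  9 4 10 (.sp 4 2 9 (.sp 9 3 10 (.sp 9 7 10 (.sp 8 9 10 (.sp 8 10 11 (.sp 9 8 11 (.V 8 0 9 10 11)
  (.V 9 8 4 10 11)) (.V 10 9 0 8 11)) (.sp 6 8 10 (.sp 7 8 10 (.sp 7 8 9 (.sp 2 3 9 (.sp 2 3 11
  (.H 2 3 9 11 4) (.V 2 5 3 9 11)) (.H 2 7 8 9 3)) (.V 7 0 8 10 9)) (.V 8 6 0 7 10)) (.H 3 8 10 9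
  4))) (.V 9 7 0 4 10)) (.V 9 3 0 4 10)) (.V 2 0 4 9 11)) (.H 0 4 9 10 11)) (.H 0 2 4 11 5)) (.T 9
  5 0 2 11)) (.T 11 0 4 9 10)) (.H 0 4 9 11 5)) (.sp 5 9 10 (.sp 5 10 11 (.sp 9 4 10 (.sp 9 7 10
  (.sp 7 9 11 (.T 9 11 0 7 10) (.V 9 10 4 7 11)) (.V 9 7 0 4 10)) (.H 0 4 9 10 5)) (.T 10 5 0 9
  11)) (.sp 2 9 10 (.sp 3 9 10 (.sp 4 9 10 (.sp 4 10 11 (.sp 10 5 11 (.sp 4 2 11 (.sp 2 10 11 (.sp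
  3 10 11 (.sp 4 2 10 (.sp 4 2 9 (.sp 8 9 10 (.sp 7 8 9 (.sp 7 8 10 (.sp 2 3 10 (.sp 2 3 11 (.sp 3
  2 9 (.H 2 3 10 11 4) (.H 2 3 9 10 4)) (.V 2 0 3 10 11)) (.H 2 7 8 10 3)) (.T 8 9 0 7 10)) (.H 3
  8 9 10 4)) (.sp 8 5 9 (.sp 5 0 8 (.sp 1 8 9 (.sp 7 8 9 (.sp 2 3 9 (.sp 2 3 10 (.H 2 3 9 10 4)
  (.V 2 5 3 9 10)) (.H 2 7 8 9 3)) (.V 8 1 0 7 9)) (.T 8 5 0 1 9)) (.I 0 5 9 8)) (.T 9 5 2 8 10)))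
  (.V 2 0 4 9 10)) (.T 4 10 0 2 11)) (.T 10 5 0 3 11)) (.T 10 5 0 2 11)) (.H 0 2 4 11 5)) (.H 0 4
  10 11 5)) (.sp 3 10 11 (.V 10 3 0 4 11) (.H 3 9 11 10 4))) (.V 9 3 0 4 10)) (.T 9 5 0 3 10)) (.T
  9 5 0 2 10)))) (.V 9 3 0 4 11)) (.sp 5 9 11 (.sp 9 7 11 (.sp 9 8 11 (.sp 9 10 11 (.sp 9 4 11
  (.sp 5 9 10 (.sp 9 3 10 (.sp 9 4 10 (.sp 10 5 11 (.sp 3 10 11 (.sp 10 4 11 (.T 10 5 0 4 11) (.H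
  3 10 11 9 4)) (.T 10 5 3 11 9)) (.H 0 9 10 11 5)) (.T 9 10 0 4 11)) (.T 9 10 0 3 11)) (.V 9 0 5
  10 11)) (.H 0 4 9 11 5)) (.sp 5 10 11 (.sp 4 9 10 (.sp 9 5 10 (.sp 10 4 11 (.sp 4 2 10 (.sp 2 9
  10 (.sp 3 9 10 (.sp 10 3 11 (.sp 4 2 9 (.sp 2 3 9 (.sp 2 3 10 (.H 2 3 9 10 4) (.V 2 5 3 9 10))
  (.sp 3 2 11 (.sp 9 2 11 (.sp 8 7 11 (.sp 6 8 11 (.V 8 6 0 7 11) (.H 2 8 11 9 3)) (.H 2 7 8 11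
  3)) (.V 9 2 0 3 11)) (.T 3 11 0 2 9))) (.V 2 0 4 9 10)) (.V 10 3 0 4 11)) (.T 9 5 0 3 10)) (.T 9
  5 0 2 10)) (.H 0 2 4 10 5)) (.H 0 4 10 11 5)) (.H 0 4 9 10 5)) (.sp 9 3 10 (.sp 9 7 10 (.sp 10 3
  11 (.sp 9 4 11 (.sp 10 7 11 (.sp 10 4 11 (.H 3 11 10 9 4) (.T 10 9 4 7 11)) (.V 10 7 0 9 11))
  (.V 9 10 4 7 11)) (.V 10 3 0 9 11)) (.V 9 7 0 4 10)) (.V 9 3 0 4 10))) (.V 11 9 0 10 5))) (.T 11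
  0 3 8 9)) (.V 9 7 0 3 11)) (.T 9 5 0 3 11))) (.V 3 8 0 7 4))) (.T 2 6 3 4 7)) (.T 6 3 0 1 8))
  (.T 6 4 0 1 7)) (.H 0 1 6 2 4)) (.T 6 8 0 1 7)) (.V 7 1 0 6 8)) (.H 0 1 6 7 2)) (.T 7 3 0 6 8))
  (.T 7 2 0 6 8))) (.V 6 0 2 7 3)) (.sp 1 6 7 (.sp 2 7 8 (.sp 7 1 8 (.sp 3 7 8 (.sp 4 7 8 (.sp 6 7
  8 (.sp 2 6 8 (.sp 6 2 7 (.T 7 8 0 6 2) (.H 0 6 7 8 2)) (.V 8 7 0 6 2)) (.sp 6 2 7 (.sp 3 6 8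
  (.sp 2 6 8 (.H 2 7 6 8 3) (.V 6 0 2 8 3)) (.sp 8 6 9 (.sp 2 4 8 (.sp 2 4 7 (.H 0 7 8 2 4) (.T 2
  7 3 4 8)) (.sp 4 2 7 (.sp 3 4 8 (.sp 3 4 7 (.H 2 7 8 3 4) (.V 3 8 0 7 4)) (.sp 3 9 11 (.sp 4 9
  11 (.sp 9 10 11 (.sp 9 5 11 (.sp 4 10 11 (.sp 2 9 11 (.sp 4 2 11 (.sp 9 4 10 (.sp 4 2 9 (.sp 9 3
  10 (.sp 9 7 10 (.sp 8 9 10 (.sp 8 10 11 (.sp 9 8 11 (.V 8 0 9 10 11) (.V 9 8 4 10 11)) (.V 10 9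
  0 8 11)) (.sp 6 8 10 (.sp 7 8 10 (.sp 7 8 9 (.sp 2 3 9 (.sp 2 3 11 (.H 2 3 9 11 4) (.V 2 5 3 9
  11)) (.H 2 7 8 9 3)) (.V 7 0 8 10 9)) (.V 8 6 0 7 10)) (.H 3 8 10 9 4))) (.V 9 7 0 4 10)) (.V 9
  3 0 4 10)) (.V 2 0 4 9 11)) (.H 0 4 9 10 11)) (.H 0 2 4 11 5)) (.T 9 5 0 2 11)) (.T 11 0 4 9
  10)) (.H 0 4 9 11 5)) (.sp 5 9 10 (.sp 5 10 11 (.sp 9 4 10 (.sp 9 7 10 (.sp 7 9 11 (.T 9 11 0 7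
  10) (.V 9 10 4 7 11)) (.V 9 7 0 4 10)) (.H 0 4 9 10 5)) (.T 10 5 0 9 11)) (.sp 2 9 10 (.sp 3 9
  10 (.sp 4 9 10 (.sp 4 10 11 (.sp 4 2 11 (.sp 9 8 10 (.sp 4 2 10 (.sp 8 5 9 (.sp 4 2 9 (.sp 5 0 8
  (.sp 1 8 9 (.sp 7 8 9 (.sp 2 3 9 (.sp 2 3 10 (.H 2 3 9 10 4) (.V 2 5 3 9 10)) (.H 2 7 8 9 3))
  (.V 8 1 0 7 9)) (.T 8 5 0 1 9)) (.I 0 5 9 8)) (.V 2 0 4 9 10)) (.T 9 5 2 8 10)) (.T 4 10 0 2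
  11)) (.H 3 8 9 10 4)) (.H 0 2 4 11 5)) (.sp 3 10 11 (.V 10 3 0 4 11) (.H 3 9 11 10 4))) (.V 9 3
  0 4 10)) (.T 9 5 0 3 10)) (.T 9 5 0 2 10)))) (.V 9 3 0 4 11)) (.sp 5 9 11 (.sp 9 7 11 (.sp 9 8
  11 (.sp 9 10 11 (.sp 9 4 11 (.sp 5 9 10 (.sp 9 3 10 (.sp 9 4 10 (.sp 10 5 11 (.sp 3 10 11 (.sp
  10 4 11 (.T 10 5 0 4 11) (.H 3 10 11 9 4)) (.T 10 5 3 11 9)) (.H 0 9 10 11 5)) (.T 9 10 0 4 11))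
  (.T 9 10 0 3 11)) (.V 9 0 5 10 11)) (.H 0 4 9 11 5)) (.sp 5 10 11 (.sp 4 9 10 (.sp 9 5 10 (.sp
  10 4 11 (.sp 4 2 10 (.sp 2 9 10 (.sp 3 9 10 (.sp 10 3 11 (.sp 4 2 9 (.sp 2 3 9 (.sp 2 3 10 (.H 2
  3 9 10 4) (.V 2 5 3 9 10)) (.sp 3 2 11 (.sp 9 2 11 (.sp 8 7 11 (.sp 6 8 11 (.V 8 6 0 7 11) (.H 2
  8 11 9 3)) (.H 2 7 8 11 3)) (.V 9 2 0 3 11)) (.T 3 11 0 2 9))) (.V 2 0 4 9 10)) (.V 10 3 0 4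
  11)) (.T 9 5 0 3 10)) (.T 9 5 0 2 10)) (.H 0 2 4 10 5)) (.H 0 4 10 11 5)) (.H 0 4 9 10 5)) (.sp
  9 3 10 (.sp 9 7 10 (.sp 10 3 11 (.sp 9 4 11 (.sp 10 7 11 (.sp 10 4 11 (.H 3 11 10 9 4) (.T 10 9
  4 7 11)) (.V 10 7 0 9 11)) (.V 9 10 4 7 11)) (.V 10 3 0 9 11)) (.V 9 7 0 4 10)) (.V 9 3 0 4
  10))) (.V 11 9 0 10 5))) (.T 11 0 3 8 9)) (.V 9 7 0 3 11)) (.T 9 5 0 3 11)))) (.H 0 1 7 2 4)))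
  (.V 6 0 3 8 9))) (.H 0 1 6 7 2))) (.T 7 4 0 1 8)) (.T 7 3 0 1 8)) (.H 0 1 7 8 2)) (.sp 1 7 8
  (.sp 7 3 8 (.sp 6 7 8 (.sp 6 3 8 (.sp 6 1 8 (.T 6 3 0 1 8) (.H 0 1 6 7 8)) (.I 3 6 7 8)) (.sp 6
  2 7 (.sp 6 2 8 (.sp 3 6 8 (.V 6 0 2 8 3) (.H 2 8 7 6 3)) (.V 8 6 0 7 2)) (.T 7 2 0 6 8))) (.V 7
  0 2 8 3)) (.T 7 2 0 1 8))) (.T 6 3 0 1 7))) (.T 10 0 3 8 4)) (.T 10 0 3 7 4)) (.T 9 0 3 8 4))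
  (.T 9 0 3 7 4)) (.T 5 0 2 3 11)) (.T 5 0 2 3 10)) (.T 5 0 2 3 9)) (.V 1 0 2 4 7)) (.V 1 0 2 4
  6)) (.X 0 3 11 6)) (.X 0 3 11 8)) (.X 0 3 11 7)) (.X 0 3 10 8)) (.X 0 3 10 7)) (.X 0 3 10 6))
  (.X 0 3 9 8)) (.X 0 3 9 7)) (.X 0 3 9 6)) (.X 0 2 11 8)) (.X 0 2 11 7)) (.X 0 2 10 8)) (.X 0 2
  10 7)) (.X 0 2 9 8)) (.X 0 2 9 7)) (.I 3 4 11 5)) (.I 3 4 10 5)) (.I 3 4 9 5)) (.I 1 2 7 3)) (.I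
  1 2 6 3)

lemma ct_full_ok : chk 12 6 uF ct_full 0 = true := by decide +kernel


/-! ### The star configuration -/

lemma D_pos_iff_swap {p q r : Pt} : 0 < D p q r ↔ D q p r < 0 := by
  rw [D_swap p q r]; constructor <;> intro h <;> linarith

lemma D_pos_iff_swap' {p q r : Pt} : 0 < D p q r ↔ D p r q < 0 := by
  rw [D_swap' p q r]; constructor <;> intro h <;> linarith

/-- Three directions positively spanning the plane are not in a half-plane. -/
lemma no_half {s x y z b : Pt} (h1 : D s x y < 0) (h2 : D s y z < 0) (h3 : D s z x < 0)
    (k1 : D s b x < 0) (k2 : D s b y < 0) (k3 : D s b z < 0) : False := by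
  have e : D s y z * D s b x + D s z x * D s b y + D s x y * D s b z = 0 := by
    unfold D; ring
  nlinarith [mul_pos_of_neg_of_neg h2 k1, mul_pos_of_neg_of_neg h3 k2,
    mul_pos_of_neg_of_neg h1 k3]

lemma no_half' {s x y z b : Pt} (h1 : D s x y < 0) (h2 : D s y z < 0) (h3 : D s z x < 0)
    (k1 : D s x b < 0) (k2 : D s y b < 0) (k3 : D s z b < 0) : False := by
  have e : D s y z * D s x b + D s z x * D s y b + D s x y * D s z b = 0 := by
    unfold D; ring
  nlinarith [mul_pos_of_neg_of_neg h2 k1, mul_pos_of_neg_of_neg h3 k2,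
    mul_pos_of_neg_of_neg h1 k3]

/-- The structure of `A ∪ B`: an apex `s` and the other points `p 0, …, p (m+1)` of `A`,
sorted clockwise around `s`. -/
structure Sta (v : Pt) (c : ℝ) (A B : Finset Pt) (s : Pt) (m : ℕ) (p : ℕ → Pt) : Prop where
  hA : ∀ x ∈ A, dotp v x < c
  hB : ∀ x ∈ B, c < dotp v x
  hgen : GenPos (↑(A ∪ B) : Set Pt)
  hnh : ¬ ∃ H : Finset Pt, DividedFiveHole A B H
  hm : 3 ≤ m
  sA : s ∈ A
  pA : ∀ i, i ≤ m + 1 → p i ∈ A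
  Aeq : ∀ x ∈ A, x = s ∨ ∃ i, i ≤ m + 1 ∧ x = p i
  ppp : ∀ i j k, i < j → j < k → k ≤ m + 1 → D (p i) (p j) (p k) < 0
  spp : ∀ i j, i < j → j ≤ m + 1 → ¬ (i = 0 ∧ j = m + 1) → D s (p i) (p j) < 0
  spp0 : D s (p (m + 1)) (p 0) < 0
  edge : ∀ b ∈ B, D (p (m + 1)) (p 0) b < 0

/-- A real key for the angular order around `t` in a half-plane bounded by `t u`. -/
lemma exists_key (t u : Pt) (T : Finset Pt) (hT : ∀ x ∈ T, 0 < D t u x) (hne : T.Nonempty) :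
    ∃ K : Pt → ℝ, ∀ x ∈ T, ∀ y ∈ T, (K x < K y ↔ 0 < D t x y) := by
  obtain ⟨x0, hx0⟩ := hne
  have htu : 0 < (u.1 - t.1) ^ 2 + (u.2 - t.2) ^ 2 := by
    by_contra h
    have h1 : (u.1 - t.1) = 0 := by nlinarith [sq_nonneg (u.1 - t.1), sq_nonneg (u.2 - t.2)]
    have h2 : (u.2 - t.2) = 0 := by nlinarith [sq_nonneg (u.1 - t.1), sq_nonneg (u.2 - t.2)]
    have := hT x0 hx0
    unfold D at this
    rw [h1, h2] at this
    linarith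
  refine ⟨fun x => - dotp (u - t) (x - t) / D t u x, fun x hx y hy => ?_⟩
  have hx' := hT x hx
  have hy' := hT y hy
  have e : dotp (u - t) (x - t) * D t u y - dotp (u - t) (y - t) * D t u x
      = ((u.1 - t.1) ^ 2 + (u.2 - t.2) ^ 2) * D t x y := by
    unfold dotp D; simp; ring
  rw [div_lt_div_iff₀ hx' hy']
  constructor
  · intro h
    by_contra hc
    push Not at hc
    nlinarith [mul_nonneg htu.le (neg_nonneg.2 hc)]
  · intro h
    nlinarith [mul_pos htu h]

lemma exists_min_ang {t u : Pt} {T : Finset Pt} (hT : ∀ x ∈ T, 0 < D t u x) (hne : T.Nonempty)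
    (hg : ∀ x ∈ T, ∀ y ∈ T, x ≠ y → D t x y ≠ 0) :
    (∃ b ∈ T, ∀ x ∈ T, x ≠ b → D t b x < 0) ∧ ∃ b ∈ T, ∀ x ∈ T, x ≠ b → 0 < D t b x := by
  obtain ⟨K, hK⟩ := exists_key t u T hT hne
  constructor
  · obtain ⟨b, hb, hmin⟩ := T.exists_max_image K hne
    refine ⟨b, hb, fun x hx hxb => ?_⟩
    have h1 := hmin x hx
    have h2 : ¬ 0 < D t b x := fun h => by have := (hK b hb x hx).2 h; linarith
    exact lt_of_le_of_ne (not_lt.1 h2) (hg b hb x hx hxb.symm)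
  · obtain ⟨b, hb, hmin⟩ := T.exists_min_image K hne
    refine ⟨b, hb, fun x hx hxb => ?_⟩
    have h1 := hmin x hx
    have h2 : ¬ 0 < D t x b := fun h => by have := (hK x hx b hb).2 h; linarith
    rw [D_swap'] at h2
    exact lt_of_le_of_ne (by linarith) (hg b hb x hx hxb.symm).symm

/-- Sorting a finite set clockwise around `t`. -/
lemma exists_sort {t u : Pt} (T : Finset Pt) (hT : ∀ x ∈ T, 0 < D t u x)
    (hg : ∀ x ∈ T, ∀ y ∈ T, x ≠ y → D t x y ≠ 0) :
    ∃ L : List Pt, L.Pairwise (fun x y => D t x y < 0) ∧ (∀ x, x ∈ L ↔ x ∈ T) ∧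
      L.length = T.card := by
  induction T using Finset.strongInduction with
  | H T ih =>
    rcases T.eq_empty_or_nonempty with rfl | hne
    · exact ⟨[], by simp⟩
    · obtain ⟨⟨b, hb, hmin⟩, -⟩ := exists_min_ang hT hne hg
      obtain ⟨L, h1, h2, h3⟩ := ih (T.erase b) (Finset.erase_ssubset hb)
        (fun x hx => hT x (Finset.mem_of_mem_erase hx))
        (fun x hx y hy => hg x (Finset.mem_of_mem_erase hx) y (Finset.mem_of_mem_erase hy))
      refine ⟨b :: L, ?_, ?_, ?_⟩
      · rw [List.pairwise_cons]
        refine ⟨fun x hx => ?_, h1⟩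
        have := (h2 x).1 hx
        exact hmin x (Finset.mem_of_mem_erase this) (Finset.ne_of_mem_erase this)
      · intro x
        rw [List.mem_cons, h2, Finset.mem_erase]
        constructor
        · rintro (rfl | h)
          · exact hb
          · exact h.2
        · intro h
          by_cases hx : x = b
          · exact Or.inl hx
          · exact Or.inr ⟨hx, h⟩
      · rw [List.length_cons, h3, Finset.card_erase_of_mem hb]
        have := Finset.card_pos.2 hne
        omega

open Classical in
/-- The wedge of a point: number of the last `p i` that precedes it. -/
def rk (s : Pt) (m : ℕ) (p : ℕ → Pt) (b : Pt) : ℕ :=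
  Nat.findGreatest (fun i => 1 ≤ i ∧ D s (p i) b < 0) m

namespace Sta

variable {v : Pt} {c : ℝ} {A B : Finset Pt} {s : Pt} {m : ℕ} {p : ℕ → Pt}

lemma memA (S : Sta v c A B s m p) {x : Pt} (hx : x ∈ A) : x ∈ (↑(A ∪ B) : Set Pt) := by
  have := S.hm
  simp [hx]

lemma memB (S : Sta v c A B s m p) {x : Pt} (hx : x ∈ B) : x ∈ (↑(A ∪ B) : Set Pt) := by
  have := S.hm
  simp [hx]

lemma neAB (S : Sta v c A B s m p) {x y : Pt} (hx : x ∈ A) (hy : y ∈ B) : x ≠ y := by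
  rintro rfl
  linarith [S.hA x hx, S.hB x hy]

lemma p_ne_s (S : Sta v c A B s m p) {i : ℕ} (hi : i ≤ m + 1) : p i ≠ s := by
  have hm := S.hm
  rcases Nat.eq_zero_or_pos i with rfl | h
  · exact (D_lt_ne (S.spp 0 1 (by omega) (by omega) (by omega))).1.symm
  · by_cases h1 : i = m + 1
    · subst h1; exact (D_lt_ne S.spp0).1.symm
    · exact (D_lt_ne (S.spp i (m + 1) (by omega) (by omega) (by omega))).1.symm

lemma p_ne (S : Sta v c A B s m p) {i j : ℕ} (hi : i ≤ m + 1) (hj : j ≤ m + 1) (h : i ≠ j) :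
    p i ≠ p j := by
  have hm := S.hm
  have key : ∀ i j, i < j → j ≤ m + 1 → p i ≠ p j := by
    intro i j hij hj
    by_cases h1 : i = 0 ∧ j = m + 1
    · obtain ⟨rfl, rfl⟩ := h1; exact (D_lt_ne S.spp0).2.2.symm
    · exact (D_lt_ne (S.spp i j hij hj h1)).2.2
  rcases lt_or_gt_of_ne h with h | h
  · exact key i j h hj
  · exact (key j i h hi).symm

lemma dne (S : Sta v c A B s m p) {x y z : Pt} (hx : x ∈ (↑(A ∪ B) : Set Pt))
    (hy : y ∈ (↑(A ∪ B) : Set Pt)) (hz : z ∈ (↑(A ∪ B) : Set Pt)) (h1 : x ≠ y) (h2 : x ≠ z)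
    (h3 : y ≠ z) : D x y z ≠ 0 := S.hgen.D_ne hx hy hz h1 h2 h3

/-- Dichotomy for the ray through `p i`. -/
lemma dich (S : Sta v c A B s m p) {i : ℕ} (hi : i ≤ m + 1) {b : Pt} (hb : b ∈ B) :
    D s (p i) b < 0 ∨ D s b (p i) < 0 := by
  have h := S.dne (S.memA S.sA) (S.memA (S.pA i hi)) (S.memB hb) (S.p_ne_s hi).symm
    (S.neAB S.sA hb) (S.neAB (S.pA i hi) hb)
  rcases lt_or_gt_of_ne h with h | h
  · exact Or.inl h
  · right; rwa [← D_pos_iff_swap']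

lemma dichB (S : Sta v c A B s m p) {b b' : Pt} (hb : b ∈ B) (hb' : b' ∈ B) (hne : b ≠ b') :
    D s b b' < 0 ∨ D s b' b < 0 := by
  have h := S.dne (S.memA S.sA) (S.memB hb) (S.memB hb') (S.neAB S.sA hb) (S.neAB S.sA hb') hne
  rcases lt_or_gt_of_ne h with h | h
  · exact Or.inl h
  · right; rwa [← D_pos_iff_swap']

lemma asym {s b b' : Pt} (h : D s b b' < 0) (h' : D s b' b < 0) : False := by
  rw [D_swap'] at h'; linarith

lemma not_back (S : Sta v c A B s m p) {b : Pt} (hb : b ∈ B) (h1 : D s (p (m + 1)) b < 0)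
    (h2 : D s b (p 0) < 0) : False :=
  sep_tri (S.hA s S.sA) (S.hA _ (S.pA (m + 1) le_rfl)) (S.hA _ (S.pA 0 (by omega))) (S.hB b hb)
    h1 (S.edge b hb) (by rw [← D_rot]; exact h2)

lemma rank_mono (S : Sta v c A B s m p) {b : Pt} (hb : b ∈ B) {i j : ℕ} (hi : 1 ≤ i)
    (hij : i < j) (hj : j ≤ m) (h : D s (p j) b < 0) : D s (p i) b < 0 := by
  rcases S.dich (i := i) (by omega) hb with h1 | h1
  · exact h1
  exfalso
  have hpp := S.spp i j hij (by omega) (by omega)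
  rcases S.dich (i := 0) (by omega) hb with h2 | h2
  · exact no_half hpp h h1 (S.spp 0 i (by omega) (by omega) (by omega))
      (S.spp 0 j (by omega) (by omega) (by omega)) h2
  · rcases S.dich (i := m + 1) (by omega) hb with h3 | h3
    · exact S.not_back hb h3 h2
    · exact no_half' hpp h h1 (S.spp i (m + 1) (by omega) (by omega) (by omega))
        (S.spp j (m + 1) (by omega) (by omega) (by omega)) h3

lemma rk_le (s : Pt) (m : ℕ) (p : ℕ → Pt) (b : Pt) : rk s m p b ≤ m := by
  classical
  unfold rk
  convert Nat.findGreatest_le (P := fun i => 1 ≤ i ∧ D s (p i) b < 0) m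

lemma rk_before0 (S : Sta v c A B s m p) {b : Pt} (hb : b ∈ B) {i : ℕ} (hi : 1 ≤ i)
    (h : i ≤ rk s m p b) : D s (p i) b < 0 := by
  classical
  have h1 : 1 ≤ rk s m p b ∧ D s (p (rk s m p b)) b < 0 := by
    have := Nat.findGreatest_of_ne_zero (P := fun i => 1 ≤ i ∧ D s (p i) b < 0) (n := m)
      (m := rk s m p b) (by unfold rk; congr) (by omega)
    exact this
  have hle := rk_le s m p b
  rcases Nat.lt_or_ge i (rk s m p b) with h2 | h2
  · exact S.rank_mono hb hi h2 hle h1.2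
  · have : i = rk s m p b := by omega
    rw [this]; exact h1.2

lemma rk_after0 (S : Sta v c A B s m p) {b : Pt} (hb : b ∈ B) {i : ℕ} (hi : rk s m p b < i)
    (h : i ≤ m) : D s b (p i) < 0 := by
  classical
  rcases S.dich (i := i) (by omega) hb with h1 | h1
  · exfalso
    have := Nat.findGreatest_is_greatest (P := fun i => 1 ≤ i ∧ D s (p i) b < 0) (n := m)
      (k := i) (by unfold rk at hi; convert hi) h
    exact this ⟨by omega, h1⟩
  · exact h1

lemma before_p0 (S : Sta v c A B s m p) {b : Pt} (hb : b ∈ B) (h : rk s m p b < m) :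
    D s (p 0) b < 0 := by
  have hm := S.hm
  rcases S.dich (i := 0) (by omega) hb with h1 | h1
  · exact h1
  exfalso
  have h2 := S.rk_after0 hb h le_rfl
  rcases S.dich (i := m + 1) (by omega) hb with h3 | h3
  · exact S.not_back hb h3 h1
  · exact no_half (S.spp 0 m (by omega) (by omega) (by omega))
      (S.spp m (m + 1) (by omega) (by omega) (by omega)) S.spp0 h1 h2 h3

lemma after_pm (S : Sta v c A B s m p) {b : Pt} (hb : b ∈ B) (h : 1 ≤ rk s m p b) :
    D s b (p (m + 1)) < 0 := by
  have hm := S.hm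
  rcases S.dich (i := m + 1) (by omega) hb with h1 | h1
  swap
  · exact h1
  exfalso
  have h2 := S.rk_before0 hb le_rfl h
  rcases S.dich (i := 0) (by omega) hb with h3 | h3
  · exact no_half' (S.spp 0 1 (by omega) (by omega) (by omega))
      (S.spp 1 (m + 1) (by omega) (by omega) (by omega)) S.spp0 h3 h2 h1
  · exact S.not_back hb h1 h3

lemma before (S : Sta v c A B s m p) {b : Pt} (hb : b ∈ B) {i : ℕ} (h : i ≤ rk s m p b)
    (h0 : i = 0 → rk s m p b < m) : D s (p i) b < 0 := by
  rcases Nat.eq_zero_or_pos i with rfl | hi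
  · exact S.before_p0 hb (h0 rfl)
  · exact S.rk_before0 hb hi h

lemma after (S : Sta v c A B s m p) {b : Pt} (hb : b ∈ B) {i : ℕ} (h : rk s m p b < i)
    (hi : i ≤ m + 1) (h0 : i = m + 1 → 1 ≤ rk s m p b) : D s b (p i) < 0 := by
  by_cases h1 : i = m + 1
  · subst h1; exact S.after_pm hb (h0 rfl)
  · exact S.rk_after0 hb h (by omega)

/-- Points of `B` in earlier wedges come earlier. -/
lemma factF (S : Sta v c A B s m p) {b d : Pt} (hb : b ∈ B) (hd : d ∈ B)
    (h : rk s m p b < rk s m p d) : D s b d < 0 := by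
  have hm := S.hm
  have hdm := rk_le s m p d
  rcases S.dichB hb hd (by rintro rfl; omega) with h1 | h1
  · exact h1
  exfalso
  have g1 := S.before hd (i := rk s m p d) le_rfl (by omega)
  have g2 := S.after hb (i := rk s m p d) h (by omega) (by omega)
  have b0 := S.before hb (i := 0) (by omega) (by omega)
  have d1 := S.after hd (i := m + 1) (by omega) (by omega) (by omega)
  have pg := S.spp 0 (rk s m p d) (by omega) (by omega) (by omega)
  have d0 : D s d (p 0) < 0 := by
    rcases S.dich (i := 0) (by omega) hd with h3 | h3
    · exact (no_half g2 g1 h1 b0 pg h3).elim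
    · exact h3
  have hne := S.dne (S.memB hd) (S.memB hb) (S.memA (S.pA 0 (by omega)))
    (by rintro rfl; omega) (S.neAB (S.pA 0 (by omega)) hd).symm
    (S.neAB (S.pA 0 (by omega)) hb).symm
  rcases lt_or_gt_of_ne hne with h2 | h2
  · have e : D d b (p 0) * D (p (m+1)) (p 0) s + D b s (p 0) * D (p (m+1)) (p 0) d
        + D s d (p 0) * D (p (m+1)) (p 0) b = 0 := by unfold D; ring
    have k1 : D (p (m+1)) (p 0) s < 0 := by rw [D_rot]; exact S.spp0
    have k2 : D b s (p 0) < 0 := by rw [← D_rot]; exact b0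
    nlinarith [mul_pos_of_neg_of_neg h2 k1, mul_pos_of_neg_of_neg k2 (S.edge d hd),
      mul_pos_of_neg_of_neg d0 (S.edge b hb)]
  · exact sep_seg (S.hA s S.sA) (S.hA _ (S.pA 0 (by omega))) (S.hB b hb) (S.hB d hd) b0
      (by rw [← D_rot]; exact d0) (by rw [D_rot]; exact h1) (D_pos_iff_swap.1 h2)

/-- A point witnessing that `B` is in a half-plane seen from `s`. -/
lemma exists_u (S : Sta v c A B s m p) : ∃ u, ∀ b ∈ B, 0 < D s u b := by
  refine ⟨(s.1 + v.2, s.2 - v.1), fun b hb => ?_⟩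
  have h1 := S.hB b hb
  have h2 := S.hA s S.sA
  unfold D
  unfold dotp at h1 h2
  simp only
  nlinarith

lemma transB (S : Sta v c A B s m p) {x y z : Pt} (hx : x ∈ B) (hy : y ∈ B) (hz : z ∈ B)
    (h1 : D s x y < 0) (h2 : D s y z < 0) : D s x z < 0 := by
  obtain ⟨u, hu⟩ := S.exists_u
  exact D_trans' (hu x hx) (hu y hy) (hu z hz) h1 h2

/-- Points of `B` lie beyond the edge of their wedge. -/
lemma claim0 (S : Sta v c A B s m p) {b : Pt} (hb : b ∈ B) {k : ℕ} (hk : rk s m p b = k) :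
    0 < D (p k) (p (k + 1)) b := by
  have hm := S.hm
  have hle := rk_le s m p b
  have h1 := S.before hb (i := k) (by omega) (by omega)
  have h2 := S.after hb (i := k + 1) (by omega) (by omega) (by omega)
  have hne := S.dne (S.memA (S.pA k (by omega))) (S.memA (S.pA (k + 1) (by omega))) (S.memB hb)
    (S.p_ne (by omega) (by omega) (by omega)) (S.neAB (S.pA k (by omega)) hb)
    (S.neAB (S.pA (k + 1) (by omega)) hb)
  rcases lt_or_gt_of_ne hne with h | h
  · exact (sep_tri (S.hA s S.sA) (S.hA _ (S.pA k (by omega))) (S.hA _ (S.pA (k + 1) (by omega)))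
      (S.hB b hb) h1 h (by rw [← D_rot]; exact h2)).elim
  · exact h

end Sta


lemma Pent.sep_edges {a b c d e x : Pt} (P : Pent a b c d e)
    (h : 0 < D a b x ∨ 0 < D b c x ∨ 0 < D c d x ∨ 0 < D d e x ∨ 0 < D e a x) :
    x ∉ convexHull ℝ ({a, b, c, d, e} : Set Pt) := by
  rcases h with h | h | h | h | h
  · exact P.sep_edge h
  · rw [rot5]; exact P.rot.sep_edge h
  · rw [rot5, rot5]; exact P.rot.rot.sep_edge h
  · rw [rot5, rot5, rot5]; exact P.rot.rot.rot.sep_edge h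
  · rw [rot5, rot5, rot5, rot5]; exact P.rot.rot.rot.rot.sep_edge h

namespace Sta

variable {v : Pt} {c : ℝ} {A B : Finset Pt} {s : Pt} {m : ℕ} {p : ℕ → Pt}

lemma contra (S : Sta v c A B s m p) {a b d e f : Pt} (P : Pent a b d e f)
    (h1 : a ∈ A ∪ B) (h2 : b ∈ A ∪ B) (h3 : d ∈ A ∪ B) (h4 : e ∈ A ∪ B) (h5 : f ∈ A ∪ B)
    (hA : a ∈ A ∨ b ∈ A ∨ d ∈ A ∨ e ∈ A ∨ f ∈ A) (hB : a ∈ B ∨ b ∈ B ∨ d ∈ B ∨ e ∈ B ∨ f ∈ B)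
    (es : s ≠ a → s ≠ b → s ≠ d → s ≠ e → s ≠ f →
      s ∉ convexHull ℝ ({a, b, d, e, f} : Set Pt))
    (ep : ∀ j, j ≤ m + 1 → p j ≠ a → p j ≠ b → p j ≠ d → p j ≠ e → p j ≠ f →
      p j ∉ convexHull ℝ ({a, b, d, e, f} : Set Pt))
    (eb : ∀ x ∈ B, x ≠ a → x ≠ b → x ≠ d → x ≠ e → x ≠ f →
      x ∉ convexHull ℝ ({a, b, d, e, f} : Set Pt)) : False := by
  refine no_hole S.hnh P ?_ ?_ ?_ ?_
  · intro x hx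
    simp only [Finset.mem_insert, Finset.mem_singleton] at hx
    rcases hx with rfl | rfl | rfl | rfl | rfl <;> assumption
  · rcases hA with h | h | h | h | h
    exacts [⟨_, by simp, h⟩, ⟨_, by simp, h⟩, ⟨_, by simp, h⟩, ⟨_, by simp, h⟩, ⟨_, by simp, h⟩]
  · rcases hB with h | h | h | h | h
    exacts [⟨_, by simp, h⟩, ⟨_, by simp, h⟩, ⟨_, by simp, h⟩, ⟨_, by simp, h⟩, ⟨_, by simp, h⟩]
  · intro x hx hx'
    simp only [Finset.mem_insert, Finset.mem_singleton, not_or] at hx'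
    obtain ⟨k1, k2, k3, k4, k5⟩ := hx'
    rcases Finset.mem_union.1 hx with hx | hx
    · rcases S.Aeq x hx with rfl | ⟨j, hj, rfl⟩
      · exact es k1 k2 k3 k4 k5
      · exact ep j hj k1 k2 k3 k4 k5
    · exact eb x hx k1 k2 k3 k4 k5

lemma uA (_S : Sta v c A B s m p) {x : Pt} (hx : x ∈ A) : x ∈ A ∪ B := Finset.mem_union_left _ hx
lemma uB (_S : Sta v c A B s m p) {x : Pt} (hx : x ∈ B) : x ∈ A ∪ B := Finset.mem_union_right _ hx

lemma dneP (S : Sta v c A B s m p) {i j : ℕ} (hi : i ≤ m + 1) (hj : j ≤ m + 1) (hij : i ≠ j)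
    {b : Pt} (hb : b ∈ B) : D (p i) (p j) b ≠ 0 :=
  S.dne (S.memA (S.pA i hi)) (S.memA (S.pA j hj)) (S.memB hb) (S.p_ne hi hj hij)
    (S.neAB (S.pA i hi) hb) (S.neAB (S.pA j hj) hb)

lemma dnePB (S : Sta v c A B s m p) {i : ℕ} (hi : i ≤ m + 1) 
    {b d : Pt} (hb : b ∈ B) (hd : d ∈ B) (hbd : b ≠ d) : D (p i) b d ≠ 0 :=
  S.dne (S.memA (S.pA i hi)) (S.memB hb) (S.memB hd)
    (S.neAB (S.pA i hi) hb) (S.neAB (S.pA i hi) hd) hbd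

lemma claim1 (S : Sta v c A B s m p) {b : Pt} (hb : b ∈ B) {k : ℕ} (hk : rk s m p b = k)
    (hkm : k + 2 ≤ m + 1) : 0 < D (p (k + 1)) (p (k + 2)) b := by
  classical
  have hm := S.hm
  by_contra hcon
  set T := B.filter (fun x => rk s m p x = k ∧ D (p (k + 1)) (p (k + 2)) x < 0) with hT
  have hbT : b ∈ T := by
    rw [hT, Finset.mem_filter]
    refine ⟨hb, hk, lt_of_le_of_ne (not_lt.1 hcon) ?_⟩
    exact S.dneP (by omega) (by omega) (by omega) hb
  have hTm : ∀ x ∈ T, x ∈ B ∧ rk s m p x = k ∧ D (p (k + 1)) (p (k + 2)) x < 0 := by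
    intro x hx; rw [hT, Finset.mem_filter] at hx; exact hx
  obtain ⟨-, b, hbT, hmin⟩ := exists_min_ang (t := p k) (u := s) (T := T) (by
    intro x hx
    obtain ⟨hxB, hxk, -⟩ := hTm x hx
    rw [D_pos_iff_swap]
    exact S.before hxB (by omega) (by omega)) ⟨b, hbT⟩ (by
    intro x hx y hy hxy
    exact S.dnePB (by omega) (hTm x hx).1 (hTm y hy).1 hxy)
  obtain ⟨hb, hk, hbk⟩ := hTm b hbT
  have c0 := S.claim0 hb hk
  have sk := S.before hb (i := k) (by omega) (by omega)
  have sk1 := S.after hb (i := k + 1) (by omega) (by omega) (by omega)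
  have sk2 := S.after hb (i := k + 2) (by omega) (by omega) (by omega)
  have q1 : D (p k) b (p (k + 1)) < 0 := D_pos_iff_swap'.1 c0
  have s1 := S.spp k (k + 1) (by omega) (by omega) (by omega)
  have s2 := S.spp k (k + 2) (by omega) (by omega) (by omega)
  have s3 := S.spp (k + 1) (k + 2) (by omega) (by omega) (by omega)
  have p1 := S.ppp k (k + 1) (k + 2) (by omega) (by omega) (by omega)
  have q2 : D (p k) b (p (k + 2)) < 0 :=
    D_trans' (u := s) (D_pos_iff_swap.2 sk) (D_pos_iff_swap.2 s1) (D_pos_iff_swap.2 s2) q1 p1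
  have P : Pent s (p k) b (p (k + 1)) (p (k + 2)) :=
    ⟨sk, s1, s2, sk1, sk2, s3, q1, q2, p1, by rwa [← D_rot]⟩
  refine S.contra P (S.uA S.sA) (S.uA (S.pA _ (by omega))) (S.uB hb) (S.uA (S.pA _ (by omega)))
    (S.uA (S.pA _ (by omega))) (Or.inl S.sA) (Or.inr (Or.inr (Or.inl hb))) ?_ ?_ ?_
  · intro h; exact absurd rfl h
  · intro j hj _ n1 _ n2 n3
    apply P.sep_edges
    have j1 : j ≠ k := by rintro rfl; exact n1 rfl
    have j2 : j ≠ k + 1 := by rintro rfl; exact n2 rfl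
    have j3 : j ≠ k + 2 := by rintro rfl; exact n3 rfl
    rcases Nat.lt_or_ge j k with h | h
    · left
      rw [D_pos_iff_swap']
      exact S.spp j k (by omega) (by omega) (by omega)
    · right; right; right; right
      rw [D_pos_iff_swap]
      exact S.spp (k + 2) j (by omega) (by omega) (by omega)
  · intro x hx _ _ xb _ _
    apply P.sep_edges
    rcases Nat.lt_trichotomy (rk s m p x) k with h | h | h
    · left
      rw [D_pos_iff_swap']
      exact S.after hx h (by omega) (by omega)
    · by_cases hxT : x ∈ T
      · right; left
        exact hmin x hxT xb
      · right; right; right; left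
        have : ¬ D (p (k + 1)) (p (k + 2)) x < 0 := fun h' => hxT (by
          rw [hT, Finset.mem_filter]; exact ⟨hx, h, h'⟩)
        exact lt_of_le_of_ne (not_lt.1 this) (S.dneP (by omega) (by omega) (by omega) hx).symm
    · rcases Nat.lt_or_ge (k + 1) (rk s m p x) with h' | h'
      · right; right; right; right
        rw [D_pos_iff_swap]
        exact S.before hx (i := k + 2) (by omega) (by omega)
      · right; right; right; left
        exact S.claim0 hx (k := k + 1) (by omega)

lemma claim2 (S : Sta v c A B s m p) {b : Pt} (hb : b ∈ B) {k : ℕ} (hk : rk s m p b = k + 1) :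
    0 < D (p k) (p (k + 1)) b := by
  classical
  have hm := S.hm
  have hle := rk_le s m p b
  by_contra hcon
  set T := B.filter (fun x => rk s m p x = k + 1 ∧ D (p k) (p (k + 1)) x < 0) with hT
  have hbT : b ∈ T := by
    rw [hT, Finset.mem_filter]
    refine ⟨hb, hk, lt_of_le_of_ne (not_lt.1 hcon) ?_⟩
    exact S.dneP (by omega) (by omega) (by omega) hb
  have hTm : ∀ x ∈ T, x ∈ B ∧ rk s m p x = k + 1 ∧ D (p k) (p (k + 1)) x < 0 := by
    intro x hx; rw [hT, Finset.mem_filter] at hx; exact hx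
  -- choose the last point as seen from the far vertex
  obtain ⟨u, hu⟩ : ∃ u, ∀ x ∈ T, 0 < D (p (k + 2)) u x := by
    refine ⟨(p (k + 2)) + ((p (k + 2)) - s), fun x hx => ?_⟩
    obtain ⟨hxB, hxk, -⟩ := hTm x hx
    have := S.after hxB (i := k + 2) (by omega) (by omega) (by omega)
    have e : D (p (k + 2)) (p (k + 2) + (p (k + 2) - s)) x = - D s x (p (k + 2)) := by
      unfold D; simp; ring
    rw [e]; linarith
  obtain ⟨⟨b, hbT, hmin⟩, -⟩ := exists_min_ang (t := p (k + 2)) (u := u) (T := T) hu ⟨b, hbT⟩ (by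
    intro x hx y hy hxy
    exact S.dnePB (by omega) (hTm x hx).1 (hTm y hy).1 hxy)
  obtain ⟨hb, hk, hbk⟩ := hTm b hbT
  have c0 := S.claim0 hb hk
  have sk := S.before hb (i := k) (by omega) (by omega)
  have sk1 := S.before hb (i := k + 1) (by omega) (by omega)
  have sk2 := S.after hb (i := k + 2) (by omega) (by omega) (by omega)
  have q1 : D (p (k + 1)) b (p (k + 2)) < 0 := D_pos_iff_swap'.1 c0
  have s1 := S.spp k (k + 1) (by omega) (by omega) (by omega)
  have s2 := S.spp k (k + 2) (by omega) (by omega) (by omega)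
  have s3 := S.spp (k + 1) (k + 2) (by omega) (by omega) (by omega)
  have p1 := S.ppp k (k + 1) (k + 2) (by omega) (by omega) (by omega)
  have q2 : D (p (k + 2)) (p k) b < 0 :=
    D_trans (u := s) (q := p (k + 1)) (by rw [← D_rot]; exact s2) (by rw [← D_rot]; exact s3)
      (by rw [← D_rot]; exact sk2) (by rw [← D_rot]; exact p1) (by rw [← D_rot]; exact q1)
  have P : Pent s (p k) (p (k + 1)) b (p (k + 2)) :=
    ⟨s1, sk, s2, sk1, s3, sk2, hbk, p1, by rw [D_rot]; exact q2, q1⟩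
  refine S.contra P (S.uA S.sA) (S.uA (S.pA _ (by omega))) (S.uA (S.pA _ (by omega))) (S.uB hb)
    (S.uA (S.pA _ (by omega))) (Or.inl S.sA) (Or.inr (Or.inr (Or.inr (Or.inl hb)))) ?_ ?_ ?_
  · intro h; exact absurd rfl h
  · intro j hj _ n1 n2 _ n3
    apply P.sep_edges
    have j1 : j ≠ k := by rintro rfl; exact n1 rfl
    have j2 : j ≠ k + 1 := by rintro rfl; exact n2 rfl
    have j3 : j ≠ k + 2 := by rintro rfl; exact n3 rfl
    rcases Nat.lt_or_ge j k with h | h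
    · left
      rw [D_pos_iff_swap']
      exact S.spp j k (by omega) (by omega) (by omega)
    · right; right; right; right
      rw [D_pos_iff_swap]
      exact S.spp (k + 2) j (by omega) (by omega) (by omega)
  · intro x hx _ _ _ xb _
    apply P.sep_edges
    rcases Nat.lt_trichotomy (rk s m p x) (k + 1) with h | h | h
    · rcases Nat.lt_or_ge (rk s m p x) k with h' | h'
      · left
        rw [D_pos_iff_swap']
        exact S.after hx h' (by omega) (by omega)
      · right; left
        exact S.claim0 hx (by omega)
    · by_cases hxT : x ∈ T
      · right; right; right; left
        have := hmin x hxT xb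
        rw [D_pos_iff_swap]
        exact this
      · right; left
        have : ¬ D (p k) (p (k + 1)) x < 0 := fun h' => hxT (by
          rw [hT, Finset.mem_filter]; exact ⟨hx, h, h'⟩)
        exact lt_of_le_of_ne (not_lt.1 this) (S.dneP (by omega) (by omega) (by omega) hx).symm
    · right; right; right; right
      rw [D_pos_iff_swap]
      exact S.before hx (i := k + 2) (by omega) (by omega)

/-- A point of `B` sees the edges next to its wedge. -/
lemma claim (S : Sta v c A B s m p) {b : Pt} (hb : b ∈ B) {j : ℕ} (hj : j + 1 ≤ m + 1)
    (h1 : j ≤ rk s m p b + 1) (h2 : rk s m p b ≤ j + 1) : 0 < D (p j) (p (j + 1)) b := by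
  rcases Nat.lt_trichotomy (rk s m p b) j with h | h | h
  · obtain rfl : j = rk s m p b + 1 := by omega
    exact S.claim1 hb rfl (by omega)
  · exact S.claim0 hb h
  · exact S.claim2 hb (by omega)

end Sta


/-! ### Windows of three consecutive wedges -/

lemma nth_map (e : List Pt) (g : Pt → ℕ) (z : Pt) (k : ℕ) (hk : k < e.length) :
    nth (e.map g) k = g (e.getD k z) := by
  induction e generalizing k with
  | nil => simp at hk
  | cons x l ih =>
    cases k with
    | zero => simp [nth]
    | succ k =>
      simp only [List.map_cons, nth, List.getD_cons_succ]
      exact ih k (by simpa using hk)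

/-- The points of a window: the apex, four points of `A`, and a list of points of `B`. -/
def fW (s : Pt) (p : ℕ → Pt) (i : ℕ) (e : List Pt) (k : ℕ) : Pt :=
  if k = 0 then s else if k < 5 then p (i + (k - 1)) else e.getD (k - 5) s

/-- `T` is cut out of `B` by the hull of the window. -/
def Isl (B : Finset Pt) (s : Pt) (p : ℕ → Pt) (i : ℕ) (T : Set Pt) : Prop :=
  ∀ x ∈ B, x ∈ convexHull ℝ ({s, p i, p (i + 1), p (i + 2), p (i + 3)} ∪ T) → x ∈ T

namespace Sta

variable {v : Pt} {c : ℝ} {A B : Finset Pt} {s : Pt} {m : ℕ} {p : ℕ → Pt}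

lemma getD_mem' {e : List Pt} {k : ℕ} {z : Pt} (hk : k < e.length) : e.getD k z ∈ e := by
  rw [List.getD_eq_getElem _ _ hk]; exact List.getElem_mem hk

lemma win_cfg (S : Sta v c A B s m p) {i : ℕ} (hi : i + 3 ≤ m + 1) {e : List Pt}
    (hlen : e.length ≤ 11) (hsort : e.Pairwise (fun x y => D s x y < 0))
    (heB : ∀ x ∈ e, x ∈ B ∧ i ≤ rk s m p x ∧ rk s m p x ≤ i + 2)
    (hisl : Isl B s p i {x | x ∈ e}) :
    Cfg (5 + e.length) 5 (uW (e.map (fun b => rk s m p b - i))) (fW s p i e) := by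
  have hm := S.hm
  have f0 : fW s p i e 0 = s := by simp [fW]
  have f1 : ∀ k, 1 ≤ k → k < 5 → fW s p i e k = p (i + (k - 1)) := by
    intro k h1 h2
    unfold fW
    rw [if_neg (by omega), if_pos h2]
  have f2 : ∀ k, 5 ≤ k → fW s p i e k = e.getD (k - 5) s := by
    intro k h1
    unfold fW
    rw [if_neg (by omega), if_neg (by omega)]
  have fA : ∀ k, k < 5 → fW s p i e k ∈ A := by
    intro k hk
    rcases Nat.eq_zero_or_pos k with rfl | h
    · rw [f0]; exact S.sA
    · rw [f1 k h hk]; exact S.pA _ (by omega)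
  have fe : ∀ k, 5 ≤ k → k < 5 + e.length → fW s p i e k ∈ e := by
    intro k h1 h2
    rw [f2 k h1]
    exact getD_mem' (by omega)
  have fB : ∀ k, 5 ≤ k → k < 5 + e.length → fW s p i e k ∈ B := fun k h1 h2 =>
    (heB _ (fe k h1 h2)).1
  have fC : ∀ k, k < 5 + e.length → fW s p i e k ∈ A ∪ B := by
    intro k hk
    rcases Nat.lt_or_ge k 5 with h | h
    · exact S.uA (fA k h)
    · exact S.uB (fB k h hk)
  have fBB : ∀ j k, 5 ≤ j → j < k → k < 5 + e.length → D s (fW s p i e j) (fW s p i e k) < 0 := by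
    intro j k h1 h2 h3
    rw [f2 j h1, f2 k (by omega), List.getD_eq_getElem _ _ (by omega),
      List.getD_eq_getElem _ _ (by omega)]
    exact List.pairwise_iff_getElem.1 hsort _ _ _ _ (by omega)
  have finj : ∀ j k, j < k → k < 5 + e.length → fW s p i e j ≠ fW s p i e k := by
    intro j k h1 h2
    rcases Nat.lt_or_ge k 5 with h | h
    · rw [f1 k (by omega) h]
      rcases Nat.eq_zero_or_pos j with rfl | h'
      · rw [f0]; exact (S.p_ne_s (by omega)).symm
      · rw [f1 j h' (by omega)]; exact S.p_ne (by omega) (by omega) (by omega)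
    · rcases Nat.lt_or_ge j 5 with h' | h'
      · exact S.neAB (fA j h') (fB k h h2)
      · exact (D_lt_ne (fBB j k h' h1 h2)).2.2
  have finj' : ∀ j k, j ≠ k → j < 5 + e.length → k < 5 + e.length →
      fW s p i e j ≠ fW s p i e k := by
    intro j k h1 h2 h3
    rcases lt_or_gt_of_ne h1 with h | h
    · exact finj j k h h3
    · exact (finj k j h h2).symm
  have fsub : ∀ k, k < 5 + e.length →
      fW s p i e k ∈ ({s, p i, p (i + 1), p (i + 2), p (i + 3)} ∪ {x | x ∈ e} : Set Pt) := by
    intro k hk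
    rcases Nat.lt_or_ge k 5 with h | h
    · left
      interval_cases k
      · simp [f0]
      · rw [f1 1 (by omega) (by omega)]; simp
      · rw [f1 2 (by omega) (by omega)]; simp
      · rw [f1 3 (by omega) (by omega)]; simp
      · rw [f1 4 (by omega) (by omega)]; simp
    · right
      exact fe k h hk
  -- half-planes
  have hp1 : ∀ k, k < 5 + e.length → D s (p i) (fW s p i e k) ≤ 0 := by
    intro k hk
    rcases Nat.lt_or_ge k 5 with h | h
    · rcases Nat.eq_zero_or_pos k with rfl | h'
      · rw [f0, D_self3]
      · rw [f1 k h' h]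
        rcases Nat.eq_or_lt_of_le h' with h'' | h''
        · have : i + (k - 1) = i := by omega
          rw [this, D_self2]
        · exact (S.spp i (i + (k - 1)) (by omega) (by omega) (by omega)).le
    · obtain ⟨h1, h2, h3⟩ := heB _ (fe k h hk)
      exact (S.before h1 h2 (by omega)).le
  have hp2 : ∀ k, k < 5 + e.length → D (p (i + 3)) s (fW s p i e k) ≤ 0 := by
    intro k hk
    rcases Nat.lt_or_ge k 5 with h | h
    · rcases Nat.eq_zero_or_pos k with rfl | h'
      · rw [f0, D_self2]
      · rw [f1 k h' h]
        rcases Nat.lt_or_ge k 4 with h'' | h''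
        · rw [← D_rot]
          exact (S.spp (i + (k - 1)) (i + 3) (by omega) (by omega) (by omega)).le
        · have : i + (k - 1) = i + 3 := by omega
          rw [this, D_self3]
    · obtain ⟨h1, h2, h3⟩ := heB _ (fe k h hk)
      rw [← D_rot]
      exact (S.after h1 (by omega) (by omega) (by omega)).le
  refine ⟨by omega, ?_, ?_, ?_, ?_⟩
  · intro a b d ha hb hd hab had hbd
    exact S.dne (by exact_mod_cast fC a ha) (by exact_mod_cast fC b hb)
      (by exact_mod_cast fC d hd) (finj' a b hab ha hb) (finj' a d had ha hd) (finj' b d hbd hb hd)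
  · refine ⟨v, c, fun k h1 h2 => S.hA _ (fA k h1), fun k h1 h2 => S.hB _ (fB k h1 h2)⟩
  · intro a b d ha hb hd hu
    have hn : ∀ k, 5 ≤ k → k < 5 + e.length →
        nth (e.map (fun b => rk s m p b - i)) (Nat.sub k 5) = rk s m p (fW s p i e k) - i := by
      intro k h1 h2
      rw [f2 k h1]
      exact nth_map e _ s (k - 5) (by omega)
    rcases a with _ | a
    · unfold uW at hu
      simp only [Bool.and_eq_true, lt'_iff] at hu
      obtain ⟨b0, d0, hu⟩ := hu
      rw [f0]
      by_cases hb5 : b < 5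
      · have e1 : lt' b 5 = true := (lt'_iff _ _).2 hb5
        rw [e1, cond_true] at hu
        by_cases hd5 : d < 5
        · have e2 : lt' d 5 = true := (lt'_iff _ _).2 hd5
          rw [e2, cond_true, lt'_iff] at hu
          rw [f1 b b0 hb5, f1 d d0 hd5]
          exact S.spp _ _ (by omega) (by omega) (by omega)
        · have e2 : lt' d 5 = false := by
            rw [← Bool.not_eq_true, lt'_iff]; exact hd5
          rw [e2, cond_false, Nat.ble_eq, hn d (by omega) hd] at hu
          obtain ⟨h1, h2, h3⟩ := heB _ (fe d (by omega) hd)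
          rw [f1 b b0 hb5]
          exact S.before h1 (by omega) (by omega)
      · have e1 : lt' b 5 = false := by
          rw [← Bool.not_eq_true, lt'_iff]; exact hb5
        rw [e1, cond_false] at hu
        by_cases hd5 : d < 5
        · have e2 : lt' d 5 = true := (lt'_iff _ _).2 hd5
          rw [e2, cond_true, lt'_iff, hn b (by omega) hb] at hu
          obtain ⟨h1, h2, h3⟩ := heB _ (fe b (by omega) hb)
          rw [f1 d d0 hd5]
          exact S.after h1 (by omega) (by omega) (by omega)
        · have e2 : lt' d 5 = false := by
            rw [← Bool.not_eq_true, lt'_iff]; exact hd5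
          rw [e2, cond_false, lt'_iff] at hu
          exact fBB b d (by omega) hu hd
    · unfold uW at hu
      simp only [Bool.and_eq_true, lt'_iff] at hu
      obtain ⟨a0, b0, b5, hu⟩ := hu
      rw [f1 (a + 1) (by omega) (by omega), f1 b b0 b5]
      by_cases hd5 : d < 5
      · have e2 : lt' d 5 = true := (lt'_iff _ _).2 hd5
        rw [e2, cond_true, Bool.and_eq_true, lt'_iff, lt'_iff] at hu
        rw [f1 d (by omega) hd5]
        exact S.ppp _ _ _ (by omega) (by omega) (by omega)
      · have e2 : lt' d 5 = false := by
          rw [← Bool.not_eq_true, lt'_iff]; exact hd5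
        rw [e2, cond_false, hn d (by omega) hd] at hu
        simp only [Bool.and_eq_true, Nat.ble_eq, Nat.beq_eq, Nat.add_eq] at hu
        obtain ⟨rfl, hu1, hu2⟩ := hu
        obtain ⟨h1, h2, h3⟩ := heB _ (fe d (by omega) hd)
        rw [← D_pos_iff_swap]
        have : i + (a + 1 - 1) = i + (a - 1) + 1 := by omega
        rw [this]
        exact S.claim h1 (by omega) (by omega) (by omega)
  · intro a1 a2 a3 a4 a5 l1 l2 l3 l4 l5 P hA' hB' hemp
    have hsub : ({fW s p i e a1, fW s p i e a2, fW s p i e a3, fW s p i e a4, fW s p i e a5}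
        : Set Pt) ⊆ ({s, p i, p (i + 1), p (i + 2), p (i + 3)} ∪ {x | x ∈ e} : Set Pt) := by
      intro x hx
      simp only [Set.mem_insert_iff, Set.mem_singleton_iff] at hx
      rcases hx with rfl | rfl | rfl | rfl | rfl <;> apply fsub <;> assumption
    have hin : ∀ k, k < 5 + e.length → fW s p i e k ≠ fW s p i e a1 →
        fW s p i e k ≠ fW s p i e a2 → fW s p i e k ≠ fW s p i e a3 →
        fW s p i e k ≠ fW s p i e a4 → fW s p i e k ≠ fW s p i e a5 → fW s p i e k ∉
        convexHull ℝ ({fW s p i e a1, fW s p i e a2, fW s p i e a3, fW s p i e a4, fW s p i e a5}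
        : Set Pt) := by
      intro k hk n1 n2 n3 n4 n5
      exact hemp k hk (fun h => n1 (by rw [h])) (fun h => n2 (by rw [h])) (fun h => n3 (by rw [h]))
        (fun h => n4 (by rw [h])) (fun h => n5 (by rw [h]))
    have hD1 : ∀ x ∈ convexHull ℝ
        ({fW s p i e a1, fW s p i e a2, fW s p i e a3, fW s p i e a4, fW s p i e a5} : Set Pt),
        D s (p i) x ≤ 0 := by
      intro x hx
      refine hull_D_le ?_ hx
      intro y hy
      simp only [Set.mem_insert_iff, Set.mem_singleton_iff] at hy
      rcases hy with rfl | rfl | rfl | rfl | rfl <;> apply hp1 <;> assumption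
    have hD2 : ∀ x ∈ convexHull ℝ
        ({fW s p i e a1, fW s p i e a2, fW s p i e a3, fW s p i e a4, fW s p i e a5} : Set Pt),
        D (p (i + 3)) s x ≤ 0 := by
      intro x hx
      refine hull_D_le ?_ hx
      intro y hy
      simp only [Set.mem_insert_iff, Set.mem_singleton_iff] at hy
      rcases hy with rfl | rfl | rfl | rfl | rfl <;> apply hp2 <;> assumption
    refine S.contra P (fC _ l1) (fC _ l2) (fC _ l3) (fC _ l4) (fC _ l5) ?_ ?_ ?_ ?_ ?_
    · rcases hA' with h | h | h | h | h
      · exact Or.inl (fA _ h)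
      · exact Or.inr (Or.inl (fA _ h))
      · exact Or.inr (Or.inr (Or.inl (fA _ h)))
      · exact Or.inr (Or.inr (Or.inr (Or.inl (fA _ h))))
      · exact Or.inr (Or.inr (Or.inr (Or.inr (fA _ h))))
    · rcases hB' with h | h | h | h | h
      · exact Or.inl (fB _ h l1)
      · exact Or.inr (Or.inl (fB _ h l2))
      · exact Or.inr (Or.inr (Or.inl (fB _ h l3)))
      · exact Or.inr (Or.inr (Or.inr (Or.inl (fB _ h l4))))
      · exact Or.inr (Or.inr (Or.inr (Or.inr (fB _ h l5))))
    · have := hin 0 (by omega)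
      rwa [f0] at this
    · intro j hj
      rcases Nat.lt_or_ge j i with h | h
      · intro _ _ _ _ _ hx
        have h1 := hD1 _ hx
        have h2 := S.spp j i h (by omega) (by omega)
        rw [D_swap'] at h2
        linarith
      · rcases Nat.lt_or_ge (i + 3) j with h' | h'
        · intro _ _ _ _ _ hx
          have h1 := hD2 _ hx
          have h2 := S.spp (i + 3) j h' (by omega) (by omega)
          rw [D_swap] at h2
          linarith
        · have := hin (j - i + 1) (by omega)
          rw [f1 _ (by omega) (by omega)] at this
          have e1 : i + (j - i + 1 - 1) = j := by omega
          rwa [e1] at this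
    · intro x hx n1 n2 n3 n4 n5 hxx
      have h1 : x ∈ e := hisl x hx (convexHull_mono hsub hxx)
      obtain ⟨k, hk, rfl⟩ := List.getElem_of_mem h1
      have e1 : fW s p i e (k + 5) = e[k] := by
        rw [f2 _ (by omega), List.getD_eq_getElem _ _ (by omega)]
        simp
      have := hin (k + 5) (by omega)
      rw [e1] at this
      exact this n1 n2 n3 n4 n5 hxx

end Sta


namespace Sta

variable {v : Pt} {c : ℝ} {A B : Finset Pt} {s : Pt} {m : ℕ} {p : ℕ → Pt}

/-- Removing an extreme point keeps an island. -/
lemma isl_remove (S : Sta v c A B s m p) {i : ℕ} (hi : i + 3 ≤ m + 1) {T : Finset Pt}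
    (hT : T ⊆ B) (hne : T.Nonempty) (hisl : Isl B s p i (↑T : Set Pt)) :
    ∃ t ∈ T, Isl B s p i (↑(T.erase t) : Set Pt) := by
  classical
  set W : Set Pt := {s, p i, p (i + 1), p (i + 2), p (i + 3)} with hW
  have hWA : ∀ x ∈ W, dotp v x < c := by
    intro x hx
    simp only [hW, Set.mem_insert_iff, Set.mem_singleton_iff] at hx
    rcases hx with rfl | rfl | rfl | rfl | rfl
    · exact S.hA _ S.sA
    all_goals exact S.hA _ (S.pA _ (by omega))
  have hfin : (W ∪ ↑T : Set Pt).Finite := by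
    apply Set.Finite.union _ T.finite_toSet
    simp [hW]
  obtain ⟨t, htT, htE⟩ : ∃ t ∈ T, t ∈ (convexHull ℝ (W ∪ ↑T : Set Pt)).extremePoints ℝ := by
    by_contra hcon
    push Not at hcon
    have hsub : (convexHull ℝ (W ∪ ↑T : Set Pt)).extremePoints ℝ ⊆ W := by
      intro x hx
      rcases extremePoints_convexHull_subset hx with h | h
      · exact h
      · exact (hcon x (by exact_mod_cast h) hx).elim
    have hcl := closure_convexHull_extremePoints (hfin.isCompact_convexHull (𝕜 := ℝ))
      (convex_convexHull ℝ _)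
    have hWfin : W.Finite := hfin.subset Set.subset_union_left
    have : convexHull ℝ (W ∪ ↑T : Set Pt) ⊆ convexHull ℝ W := by
      rw [← hcl]
      exact closure_minimal (convexHull_mono hsub) (hWfin.isClosed_convexHull (𝕜 := ℝ))
    obtain ⟨t, ht⟩ := hne
    have h1 := this (subset_convexHull ℝ _ (Or.inr (by exact_mod_cast ht)))
    have h2 := hull_dotp_lt hWA h1
    linarith [S.hB t (hT ht)]
  refine ⟨t, htT, ?_⟩
  rw [(convex_convexHull ℝ _).mem_extremePoints_iff_mem_sdiff_convexHull_sdiff] at htE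
  intro x hx hxx
  have hsub : (W ∪ ↑(T.erase t) : Set Pt) ⊆ W ∪ ↑T :=
    Set.union_subset_union_right _ (by exact_mod_cast Finset.erase_subset t T)
  have h1 : x ∈ T := by exact_mod_cast hisl x hx (convexHull_mono hsub hxx)
  have h2 : x ≠ t := by
    rintro rfl
    apply htE.2
    refine convexHull_mono ?_ hxx
    intro y hy
    refine ⟨subset_convexHull ℝ _ (hsub hy), ?_⟩
    rintro rfl
    rcases hy with hy | hy
    · linarith [S.hB y hx, hWA y hy]
    · simp at hy
  simp [h1, h2]

/-- The number of points of `T` in wedge `k`. -/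
def cnt (s : Pt) (m : ℕ) (p : ℕ → Pt) (T : Finset Pt) (k : ℕ) : ℕ :=
  (T.filter (fun x => rk s m p x = k)).card

lemma exists_wedge_list (S : Sta v c A B s m p) {T : Finset Pt} (hT : T ⊆ B) (k : ℕ) :
    ∃ L : List Pt, L.Pairwise (fun x y => D s x y < 0) ∧
      (∀ x, x ∈ L ↔ (x ∈ T ∧ rk s m p x = k)) ∧ L.length = cnt s m p T k := by
  obtain ⟨u, hu⟩ := S.exists_u
  obtain ⟨L, h1, h2, h3⟩ := exists_sort (t := s) (u := u) (T.filter (fun x => rk s m p x = k))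
    (fun x hx => hu x (hT (Finset.mem_of_mem_filter x hx)))
    (fun x hx y hy hxy => by
      have hx' := hT (Finset.mem_of_mem_filter x hx)
      have hy' := hT (Finset.mem_of_mem_filter y hy)
      exact S.dne (S.memA S.sA) (S.memB hx') (S.memB hy') (S.neAB S.sA hx') (S.neAB S.sA hy') hxy)
  refine ⟨L, h1, fun x => ?_, h3⟩
  rw [h2, Finset.mem_filter]

lemma win_not (S : Sta v c A B s m p) {i : ℕ} (hi : i + 3 ≤ m + 1) {T : Finset Pt}
    (hT : T ⊆ B) (hr : ∀ x ∈ T, i ≤ rk s m p x ∧ rk s m p x ≤ i + 2)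
    (hisl : Isl B s p i (↑T : Set Pt)) {n0 n1 n2 : ℕ} (h0 : cnt s m p T i = n0)
    (h1 : cnt s m p T (i + 1) = n1) (h2 : cnt s m p T (i + 2) = n2) (hn : n0 + n1 + n2 ≤ 11)
    (t : Ct) (hchk : chk (5 + (n0 + n1 + n2)) 5
      (uW (List.replicate n0 0 ++ List.replicate n1 1 ++ List.replicate n2 2)) t 0 = true) :
    False := by
  obtain ⟨L0, a0, b0, c0⟩ := S.exists_wedge_list hT i
  obtain ⟨L1, a1, b1, c1⟩ := S.exists_wedge_list hT (i + 1)
  obtain ⟨L2, a2, b2, c2⟩ := S.exists_wedge_list hT (i + 2)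
  rw [h0] at c0
  rw [h1] at c1
  rw [h2] at c2
  have hmem : ∀ x, x ∈ L0 ++ L1 ++ L2 ↔ x ∈ T := by
    intro x
    simp only [List.mem_append, b0, b1, b2]
    constructor
    · rintro ((h | h) | h) <;> exact h.1
    · intro h
      have := hr x h
      have : rk s m p x = i ∨ rk s m p x = i + 1 ∨ rk s m p x = i + 2 := by omega
      tauto
  have C := S.win_cfg hi (e := L0 ++ L1 ++ L2) (by simp; omega) (by
      rw [List.pairwise_append, List.pairwise_append]
      refine ⟨⟨a0, a1, ?_⟩, a2, ?_⟩
      · intro x hx y hy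
        rw [b0] at hx
        rw [b1] at hy
        exact S.factF (hT hx.1) (hT hy.1) (by omega)
      · intro x hx y hy
        rw [b2] at hy
        rw [List.mem_append, b0, b1] at hx
        rcases hx with hx | hx
        · exact S.factF (hT hx.1) (hT hy.1) (by omega)
        · exact S.factF (hT hx.1) (hT hy.1) (by omega))
    (fun x hx => ⟨hT ((hmem x).1 hx), hr x ((hmem x).1 hx)⟩)
    (by
      have : {x | x ∈ L0 ++ L1 ++ L2} = (↑T : Set Pt) := by
        ext x; rw [Set.mem_ofPred_eq, hmem]; simp
      rw [this]; exact hisl)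
  have hmap : (L0 ++ L1 ++ L2).map (fun b => rk s m p b - i) =
      List.replicate n0 0 ++ List.replicate n1 1 ++ List.replicate n2 2 := by
    rw [List.map_append, List.map_append]
    congr 1
    · congr 1
      · rw [List.eq_replicate_iff]
        refine ⟨by simp [c0], ?_⟩
        intro b hb
        obtain ⟨x, hx, rfl⟩ := List.mem_map.1 hb
        have := ((b0 x).1 hx).2
        omega
      · rw [List.eq_replicate_iff]
        refine ⟨by simp [c1], ?_⟩
        intro b hb
        obtain ⟨x, hx, rfl⟩ := List.mem_map.1 hb
        have := ((b1 x).1 hx).2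
        omega
    · rw [List.eq_replicate_iff]
      refine ⟨by simp [c2], ?_⟩
      intro b hb
      obtain ⟨x, hx, rfl⟩ := List.mem_map.1 hb
      have := ((b2 x).1 hx).2
      omega
  rw [hmap] at C
  have hl : 5 + (L0 ++ L1 ++ L2).length = 5 + (n0 + n1 + n2) := by simp; omega
  rw [hl] at C
  exact chk_sound C t 0 (MaskOK.zero _) hchk

/-- Possible numbers of points in three consecutive wedges. -/
def Feas (a b d : ℕ) : Prop :=
  (a + b + d ≤ 3 ∧ b ≤ 2) ∨ (a = 1 ∧ b = 1 ∧ d = 2) ∨ (a = 1 ∧ b = 2 ∧ d = 1) ∨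
    (a = 2 ∧ b = 1 ∧ d = 1)

lemma cnt_erase {T : Finset Pt} {t : Pt} (ht : t ∈ T) (k : ℕ) :
    cnt s m p T k = cnt s m p (T.erase t) k + if rk s m p t = k then 1 else 0 := by
  classical
  unfold cnt
  rw [Finset.filter_erase]
  split_ifs with h
  · rw [Finset.card_erase_add_one]
    simp [ht, h]
  · rw [Finset.erase_eq_of_notMem, add_zero]
    simp [h]

/-- Infeasible triples of numbers of points. -/
def badL : List (ℕ × ℕ × ℕ) := [(0, 3, 0), (0, 0, 4), (4, 0, 0), (1, 0, 3), (3, 0, 1), (0, 1, 3),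
  (3, 1, 0), (0, 3, 1), (1, 3, 0), (0, 2, 2), (2, 2, 0), (2, 0, 2), (1, 1, 3), (3, 1, 1),
  (1, 2, 2), (2, 2, 1), (2, 1, 2), (1, 3, 1)]

instance (a b d : ℕ) : Decidable (Feas a b d) := by unfold Feas; infer_instance

set_option synthInstance.maxHeartbeats 400000 in
set_option synthInstance.maxSize 2000 in
lemma feas_step : ∀ a b d : Fin 4, Feas a b d →
    (Feas ((a : ℕ) + 1) b d ∨ (((a : ℕ) + 1, (b : ℕ), (d : ℕ)) : ℕ × ℕ × ℕ) ∈ badL) ∧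
    (Feas a ((b : ℕ) + 1) d ∨ (((a : ℕ), (b : ℕ) + 1, (d : ℕ)) : ℕ × ℕ × ℕ) ∈ badL) ∧
    (Feas a b ((d : ℕ) + 1) ∨ (((a : ℕ), (b : ℕ), (d : ℕ) + 1) : ℕ × ℕ × ℕ) ∈ badL) := by
  decide +kernel

lemma feas_aux (S : Sta v c A B s m p) {i : ℕ} (hi : i + 3 ≤ m + 1) (T : Finset Pt) :
    T ⊆ B → (∀ x ∈ T, i ≤ rk s m p x ∧ rk s m p x ≤ i + 2) →
    Isl B s p i (↑T : Set Pt) →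
    Feas (cnt s m p T i) (cnt s m p T (i + 1)) (cnt s m p T (i + 2)) := by
  classical
  induction T using Finset.strongInduction with
  | H T ih =>
    intro hT hr hisl
    rcases T.eq_empty_or_nonempty with rfl | hne
    · left; simp [cnt]
    obtain ⟨t, ht, hisl'⟩ := S.isl_remove hi hT hne hisl
    have hf := ih (T.erase t) (Finset.erase_ssubset ht)
      ((Finset.erase_subset _ _).trans hT) (fun x hx => hr x (Finset.mem_of_mem_erase hx)) hisl'
    have e0 := cnt_erase (s := s) (m := m) (p := p) ht i
    have e1 := cnt_erase (s := s) (m := m) (p := p) ht (i + 1)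
    have e2 := cnt_erase (s := s) (m := m) (p := p) ht (i + 2)
    have hrt := hr t ht
    have hnot : ∀ n0 n1 n2 : ℕ, n0 + n1 + n2 ≤ 11 → ∀ ct : Ct,
        chk (5 + (n0 + n1 + n2)) 5
          (uW (List.replicate n0 0 ++ List.replicate n1 1 ++ List.replicate n2 2)) ct 0 = true →
        ¬ (cnt s m p T i = n0 ∧ cnt s m p T (i + 1) = n1 ∧ cnt s m p T (i + 2) = n2) :=
      fun n0 n1 n2 hn ct hc h => S.win_not hi hT hr hisl h.1 h.2.1 h.2.2 hn ct hc
    have g1 := hnot 0 3 0 (by omega) _ ct030_ok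
    have g2 := hnot 0 0 4 (by omega) _ ct004_ok
    have g3 := hnot 4 0 0 (by omega) _ ct400_ok
    have g4 := hnot 1 0 3 (by omega) _ ct103_ok
    have g5 := hnot 3 0 1 (by omega) _ ct301_ok
    have g6 := hnot 0 1 3 (by omega) _ ct013_ok
    have g7 := hnot 3 1 0 (by omega) _ ct310_ok
    have g8 := hnot 0 3 1 (by omega) _ ct031_ok
    have g9 := hnot 1 3 0 (by omega) _ ct130_ok
    have g10 := hnot 0 2 2 (by omega) _ ct022_ok
    have g11 := hnot 2 2 0 (by omega) _ ct220_ok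
    have g12 := hnot 2 0 2 (by omega) _ ct202_ok
    have g13 := hnot 1 1 3 (by omega) _ ct113_ok
    have g14 := hnot 3 1 1 (by omega) _ ct311_ok
    have g15 := hnot 1 2 2 (by omega) _ ct122_ok
    have g16 := hnot 2 2 1 (by omega) _ ct221_ok
    have g17 := hnot 2 1 2 (by omega) _ ct212_ok
    have g18 := hnot 1 3 1 (by omega) _ ct131_ok
    have hbad : (cnt s m p T i, cnt s m p T (i + 1), cnt s m p T (i + 2)) ∉ badL := by
      unfold badL
      simp only [List.mem_cons, Prod.mk.injEq, List.not_mem_nil, or_false, not_or]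
      exact ⟨g1, g2, g3, g4, g5, g6, g7, g8, g9, g10, g11, g12, g13, g14, g15, g16, g17, g18⟩
    clear g1 g2 g3 g4 g5 g6 g7 g8 g9 g10 g11 g12 g13 g14 g15 g16 g17 g18
    have hk : rk s m p t = i ∨ rk s m p t = i + 1 ∨ rk s m p t = i + 2 := by omega
    have hlt : cnt s m p (T.erase t) i < 4 ∧ cnt s m p (T.erase t) (i + 1) < 4 ∧
        cnt s m p (T.erase t) (i + 2) < 4 := by
      unfold Feas at hf
      omega
    have hst := feas_step ⟨_, hlt.1⟩ ⟨_, hlt.2.1⟩ ⟨_, hlt.2.2⟩ hf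
    rcases hk with hk | hk | hk <;> rw [hk] at e0 e1 e2 <;> simp at e0 e1 e2 <;>
      rw [e0, e1, e2] at hbad ⊢
    · exact hst.1.resolve_right hbad
    · exact hst.2.1.resolve_right hbad
    · exact hst.2.2.resolve_right hbad

/-- The points of `B` in the window. -/
lemma isl_full (S : Sta v c A B s m p) {i : ℕ} (hi : i + 3 ≤ m + 1) :
    Isl B s p i (↑(B.filter (fun x => i ≤ rk s m p x ∧ rk s m p x ≤ i + 2)) : Set Pt) := by
  have hm := S.hm
  intro x hx hxx
  have h1 : D s (p i) x ≤ 0 := by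
    refine hull_D_le ?_ hxx
    intro y hy
    rcases hy with hy | hy
    · simp only [Set.mem_insert_iff, Set.mem_singleton_iff] at hy
      rcases hy with rfl | rfl | rfl | rfl | rfl
      · rw [D_self3]
      · rw [D_self2]
      all_goals exact (S.spp _ _ (by omega) (by omega) (by omega)).le
    · simp only [Finset.coe_filter, Set.mem_ofPred_eq] at hy
      exact (S.before hy.1 hy.2.1 (by omega)).le
  have h2 : D (p (i + 3)) s x ≤ 0 := by
    refine hull_D_le ?_ hxx
    intro y hy
    rcases hy with hy | hy
    · simp only [Set.mem_insert_iff, Set.mem_singleton_iff] at hy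
      rcases hy with rfl | rfl | rfl | rfl | rfl
      · rw [D_self2]
      · rw [← D_rot]; exact (S.spp _ _ (by omega) (by omega) (by omega)).le
      · rw [← D_rot]; exact (S.spp _ _ (by omega) (by omega) (by omega)).le
      · rw [← D_rot]; exact (S.spp _ _ (by omega) (by omega) (by omega)).le
      · rw [D_self3]
    · simp only [Finset.coe_filter, Set.mem_ofPred_eq] at hy
      rw [← D_rot]
      exact (S.after hy.1 (by omega) (by omega) (by omega)).le
  simp only [Finset.coe_filter, Set.mem_ofPred_eq]
  refine ⟨hx, ?_, ?_⟩
  · by_contra h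
    have := S.after hx (i := i) (by omega) (by omega) (by omega)
    rw [D_swap'] at this
    linarith
  · by_contra h
    have := S.before hx (i := i + 3) (by omega) (by omega)
    rw [D_swap] at h2
    linarith

lemma feas (S : Sta v c A B s m p) {i : ℕ} (hi : i + 3 ≤ m + 1) :
    Feas (cnt s m p B i) (cnt s m p B (i + 1)) (cnt s m p B (i + 2)) := by
  have h := S.feas_aux hi _ (Finset.filter_subset _ _) (by
    intro x hx; exact (Finset.mem_filter.1 hx).2) (S.isl_full hi)
  have e : ∀ k, i ≤ k → k ≤ i + 2 →
      cnt s m p (B.filter (fun x => i ≤ rk s m p x ∧ rk s m p x ≤ i + 2)) k = cnt s m p B k := by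
    intro k h1 h2
    unfold cnt
    rw [Finset.filter_filter]
    congr 1
    apply Finset.filter_congr
    intro x _
    constructor
    · exact fun h => h.2
    · exact fun h => ⟨by omega, h⟩
  rwa [e i (by omega) (by omega), e (i + 1) (by omega) (by omega),
    e (i + 2) (by omega) (by omega)] at h

end Sta


namespace Sta

variable {v : Pt} {c : ℝ} {A B : Finset Pt} {s : Pt} {m : ℕ} {p : ℕ → Pt}

lemma full_cfg (S : Sta v c A B s m p) {i : ℕ} (hi : i + 3 ≤ m + 1) {L0 L1 L2 : List Pt}
    (a0 : L0.Pairwise (fun x y => D s x y < 0)) (a1 : L1.Pairwise (fun x y => D s x y < 0))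
    (a2 : L2.Pairwise (fun x y => D s x y < 0)) (b0 : ∀ x, x ∈ L0 ↔ (x ∈ B ∧ rk s m p x = i))
    (b1 : ∀ x, x ∈ L1 ↔ (x ∈ B ∧ rk s m p x = i + 1))
    (b2 : ∀ x, x ∈ L2 ↔ (x ∈ B ∧ rk s m p x = i + 2))
    (hl : (L0 ++ L1 ++ L2).length ≤ 11) :
    Cfg (5 + (L0 ++ L1 ++ L2).length) 5 (uW ((L0 ++ L1 ++ L2).map (fun b => rk s m p b - i)))
      (fW s p i (L0 ++ L1 ++ L2)) := by
  have hmem : ∀ x, x ∈ L0 ++ L1 ++ L2 ↔ (x ∈ B ∧ i ≤ rk s m p x ∧ rk s m p x ≤ i + 2) := by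
    intro x
    simp only [List.mem_append, b0, b1, b2]
    constructor
    · rintro ((h | h) | h) <;> exact ⟨h.1, by omega, by omega⟩
    · rintro ⟨h1, h2, h3⟩
      have : rk s m p x = i ∨ rk s m p x = i + 1 ∨ rk s m p x = i + 2 := by omega
      tauto
  refine S.win_cfg hi (e := L0 ++ L1 ++ L2) hl ?_ (fun x hx => (hmem x).1 hx) ?_
  · rw [List.pairwise_append, List.pairwise_append]
    refine ⟨⟨a0, a1, ?_⟩, a2, ?_⟩
    · intro x hx y hy
      rw [b0] at hx
      rw [b1] at hy
      exact S.factF hx.1 hy.1 (by omega)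
    · intro x hx y hy
      rw [b2] at hy
      rw [List.mem_append, b0, b1] at hx
      rcases hx with hx | hx
      · exact S.factF hx.1 hy.1 (by omega)
      · exact S.factF hx.1 hy.1 (by omega)
  · have : {x | x ∈ L0 ++ L1 ++ L2} =
        (↑(B.filter (fun x => i ≤ rk s m p x ∧ rk s m p x ≤ i + 2)) : Set Pt) := by
      ext x
      rw [Set.mem_ofPred_eq, hmem, Finset.coe_filter, Set.mem_ofPred_eq]
    rw [this]
    exact S.isl_full hi

lemma wf211 (S : Sta v c A B s m p) {i : ℕ} (hi : i + 3 ≤ m + 1) (h0 : cnt s m p B i = 2)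
    (h1 : cnt s m p B (i + 1) = 1) (h2 : cnt s m p B (i + 2) = 1) {x : Pt} (hx : x ∈ B)
    (hxr : rk s m p x = i + 1) :
    ∃ β ∈ B, rk s m p β = i ∧ 0 < D β x (p (i + 2)) ∧
      ∀ z ∈ B, rk s m p z = i → z ≠ β → D s β z < 0 → D β x z < 0 := by
  obtain ⟨L0, a0, b0, c0⟩ := S.exists_wedge_list (T := B) subset_rfl i
  obtain ⟨L1, a1, b1, c1⟩ := S.exists_wedge_list (T := B) subset_rfl (i + 1)
  obtain ⟨L2, a2, b2, c2⟩ := S.exists_wedge_list (T := B) subset_rfl (i + 2)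
  rw [h0, List.length_eq_two] at c0
  rw [h1, List.length_eq_one_iff] at c1
  rw [h2, List.length_eq_one_iff] at c2
  obtain ⟨b, b', rfl⟩ := c0
  obtain ⟨x', rfl⟩ := c1
  obtain ⟨y, rfl⟩ := c2
  have hxx : x = x' := by
    have := (b1 x).2 ⟨hx, hxr⟩
    simpa using this
  subst hxx
  have hb := (b0 b).1 (by simp)
  have hb' := (b0 b').1 (by simp)
  have hy := (b2 y).1 (by simp)
  have hbb : D s b b' < 0 := by simpa using a0
  have C := S.full_cfg hi a0 a1 a2 b0 b1 b2 (by simp)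
  have e1 : ([b, b'] ++ [x] ++ [y]).map (fun b => rk s m p b - i) = [0, 0, 1, 2] := by
    simp [hb.2, hb'.2, hxr, hy.2]
  rw [e1] at C
  have hbx : b ≠ x := by rintro rfl; omega
  have hb'x : b' ≠ x := by rintro rfl; omega
  have dn : ∀ z ∈ B, z ≠ x → D z x (p (i + 2)) ≠ 0 := by
    intro z hz hzx
    exact S.dne (S.memB hz) (S.memB hx) (S.memA (S.pA _ (by omega))) hzx
      (S.neAB (S.pA _ (by omega)) hz).symm (S.neAB (S.pA _ (by omega)) hx).symm
  rcases lt_or_gt_of_ne (dn b' hb'.1 hb'x) with h | h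
  swap
  · refine ⟨b', hb'.1, hb'.2, h, ?_⟩
    intro z hz hzr hzb hsz
    have : z = b ∨ z = b' := by simpa using (b0 z).2 ⟨hz, hzr⟩
    rcases this with rfl | rfl
    · exact (asym hbb hsz).elim
    · exact (hzb rfl).elim
  · have m1 : MaskOK (fW s p i ([b, b'] ++ [x] ++ [y])) (st 0 6 7 3) :=
      (MaskOK.zero _).st (by omega) (by omega) (by omega) (by simpa [fW] using h)
    have g1 : 0 < D b x (p (i + 2)) := by
      rcases lt_or_gt_of_ne (dn b hb.1 hbx) with h' | h'
      · exact (chk_sound C ct_fa _ (m1.st (i := 5) (j := 7) (k := 3) (by omega) (by omega)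
          (by omega) (by simpa [fW] using h')) ct_fa_ok).elim
      · exact h'
    refine ⟨b, hb.1, hb.2, g1, ?_⟩
    intro z hz hzr hzb hsz
    have : z = b ∨ z = b' := by simpa using (b0 z).2 ⟨hz, hzr⟩
    rcases this with rfl | rfl
    · exact (hzb rfl).elim
    · rcases lt_or_gt_of_ne (S.dne (S.memB hb.1) (S.memB hx) (S.memB hz) hbx hzb.symm
        hb'x.symm) with h' | h'
      · exact h'
      · exfalso
        refine chk_sound C ct_fb _ (m1.st (i := 7) (j := 5) (k := 6) (by omega) (by omega)
          (by omega) ?_) ct_fb_ok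
        rw [D_pos_iff_swap] at h'
        simpa [fW] using h'

lemma wf112 (S : Sta v c A B s m p) {i : ℕ} (hi : i + 3 ≤ m + 1) (h0 : cnt s m p B i = 1)
    (h1 : cnt s m p B (i + 1) = 1) (h2 : cnt s m p B (i + 2) = 2) {y : Pt} (hy : y ∈ B)
    (hyr : rk s m p y = i + 1) :
    ∃ γ ∈ B, rk s m p γ = i + 2 ∧ D γ y (p (i + 1)) < 0 ∧
      ∀ z ∈ B, rk s m p z = i + 2 → z ≠ γ → D s z γ < 0 → 0 < D γ y z := by
  obtain ⟨L0, a0, b0, c0⟩ := S.exists_wedge_list (T := B) subset_rfl i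
  obtain ⟨L1, a1, b1, c1⟩ := S.exists_wedge_list (T := B) subset_rfl (i + 1)
  obtain ⟨L2, a2, b2, c2⟩ := S.exists_wedge_list (T := B) subset_rfl (i + 2)
  rw [h0, List.length_eq_one_iff] at c0
  rw [h1, List.length_eq_one_iff] at c1
  rw [h2, List.length_eq_two] at c2
  obtain ⟨x, rfl⟩ := c0
  obtain ⟨y', rfl⟩ := c1
  obtain ⟨b, b', rfl⟩ := c2
  have hyy : y = y' := by
    have := (b1 y).2 ⟨hy, hyr⟩
    simpa using this
  subst hyy
  have hb := (b2 b).1 (by simp)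
  have hb' := (b2 b').1 (by simp)
  have hx := (b0 x).1 (by simp)
  have hbb : D s b b' < 0 := by simpa using a2
  have C := S.full_cfg hi a0 a1 a2 b0 b1 b2 (by simp)
  have e1 : ([x] ++ [y] ++ [b, b']).map (fun b => rk s m p b - i) = [0, 1, 2, 2] := by
    simp [hb.2, hb'.2, hyr, hx.2]
  rw [e1] at C
  have hbx : b ≠ y := by rintro rfl; omega
  have hb'x : b' ≠ y := by rintro rfl; omega
  have dn : ∀ z ∈ B, z ≠ y → D z y (p (i + 1)) ≠ 0 := by
    intro z hz hzx
    exact S.dne (S.memB hz) (S.memB hy) (S.memA (S.pA _ (by omega))) hzx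
      (S.neAB (S.pA _ (by omega)) hz).symm (S.neAB (S.pA _ (by omega)) hy).symm
  rcases lt_or_gt_of_ne (dn b hb.1 hbx) with h | h
  · refine ⟨b, hb.1, hb.2, h, ?_⟩
    intro z hz hzr hzb hsz
    have : z = b ∨ z = b' := by simpa using (b2 z).2 ⟨hz, hzr⟩
    rcases this with rfl | rfl
    · exact (hzb rfl).elim
    · exact (asym hbb hsz).elim
  · rw [D_pos_iff_swap] at h
    have m1 : MaskOK (fW s p i ([x] ++ [y] ++ [b, b'])) (st 0 6 7 2) :=
      (MaskOK.zero _).st (by omega) (by omega) (by omega) (by simpa [fW] using h)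
    have g1 : D b' y (p (i + 1)) < 0 := by
      rcases lt_or_gt_of_ne (dn b' hb'.1 hb'x) with h' | h'
      · exact h'
      · rw [D_pos_iff_swap] at h'
        exact (chk_sound C ct_fc _ (m1.st (i := 6) (j := 8) (k := 2) (by omega) (by omega)
          (by omega) (by simpa [fW] using h')) ct_fc_ok).elim
    refine ⟨b', hb'.1, hb'.2, g1, ?_⟩
    intro z hz hzr hzb hsz
    have : z = b ∨ z = b' := by simpa using (b2 z).2 ⟨hz, hzr⟩
    rcases this with rfl | rfl
    · rcases lt_or_gt_of_ne (S.dne (S.memB hb'.1) (S.memB hy) (S.memB hz) hb'x hzb.symm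
        hbx.symm) with h' | h'
      · exfalso
        refine chk_sound C ct_fd _ (m1.st (i := 8) (j := 6) (k := 7) (by omega) (by omega)
          (by omega) ?_) ct_fd_ok
        simpa [fW] using h'
      · exact h'
    · exact (hzb rfl).elim

end Sta


/-! ### A chain of single points between two pairs -/

lemma r1 {p q r : Pt} (h : D p q r < 0) : D q r p < 0 := by rw [D_rot]; exact h
lemma r2 {p q r : Pt} (h : D p q r < 0) : D r p q < 0 := by rw [D_rot']; exact h
lemma r1P {p q r : Pt} (h : 0 < D p q r) : 0 < D q r p := by rw [D_rot]; exact h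
lemma r2P {p q r : Pt} (h : 0 < D p q r) : 0 < D r p q := by rw [D_rot']; exact h
/-- swap to negative -/
lemma sN {p q r : Pt} (h : 0 < D p q r) : D q p r < 0 := D_pos_iff_swap.1 h
/-- swap to positive -/
lemma sP {p q r : Pt} (h : D p q r < 0) : 0 < D q p r := D_pos_iff_swap.2 h

namespace Sta

variable {v : Pt} {c : ℝ} {A B : Finset Pt} {s : Pt} {m : ℕ} {p : ℕ → Pt}

lemma turn0 (S : Sta v c A B s m p) {x y Q : Pt} (hx : x ∈ B) (hy : y ∈ B)
    (hQ : Q ∈ A) (hxy : D s x y < 0) (hxQ : D s x Q < 0) (hQy : D s Q y < 0) :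
    D x y Q < 0 := by
  have n1 := S.dne (S.memB hx) (S.memB hy) (S.memA hQ) (D_lt_ne hxy).2.2 (S.neAB hQ hx).symm
    (S.neAB hQ hy).symm
  rcases lt_or_gt_of_ne n1 with h | h
  · exact h
  · exact (sep_seg (S.hA s S.sA) (S.hA Q hQ) (S.hB y hy) (S.hB x hx) hQy
      (by rw [← D_rot]; exact hxQ) (by rw [D_rot]; exact hxy) (D_pos_iff_swap.1 h)).elim

lemma turn1 (S : Sta v c A B s m p) {β x y Q : Pt} (hβ : β ∈ B) (hx : x ∈ B) (hy : y ∈ B)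
    (hQ : Q ∈ A) (hβx : D s β x < 0) (hβy : D s β y < 0) (hxy : D s x y < 0) (hxQ : D s x Q < 0)
    (hQy : D s Q y < 0) (h : 0 < D β x Q) : 0 < D β x y := by
  have t0 := S.turn0 hx hy hQ hxy hxQ hQy
  have n1 := S.dne (S.memB hβ) (S.memB hx) (S.memB hy) (D_lt_ne hβx).2.2 (D_lt_ne hβy).2.2
    (D_lt_ne hxy).2.2
  rcases lt_or_gt_of_ne n1 with h' | h'
  · exfalso
    refine no_half (s := x) (x := β) (y := Q) (z := s) (b := y) ?_ ?_ ?_ ?_ ?_ ?_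
    · exact sN h
    · exact r1 hxQ
    · exact r2 hβx
    · exact r1 h'
    · exact t0
    · exact r1 hxy
  · exact h'

/-- The invariant of the chain. -/
def Inv (B : Finset Pt) (s : Pt) (m : ℕ) (p : ℕ → Pt) (i : ℕ) (β : Pt) (l : ℕ) : Prop :=
  ∀ x ∈ B, rk s m p x = l → 0 < D β x (p (l + 1)) ∧
    ∀ z ∈ B, i ≤ rk s m p z → rk s m p z < l → z ≠ β → D s β z < 0 → D β x z < 0

lemma inv_step (S : Sta v c A B s m p) {i l : ℕ} {β x y : Pt} (hβ : β ∈ B)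
    (hβr : rk s m p β = i) (hil : i < l) (hlm : l + 1 < m) (hx : x ∈ B) (hxr : rk s m p x = l)
    (hy : y ∈ B) (hyr : rk s m p y = l + 1)
    (ux : ∀ z ∈ B, rk s m p z = l → z = x) (uy : ∀ z ∈ B, rk s m p z = l + 1 → z = y)
    (hI : Inv B s m p i β l) : Inv B s m p i β (l + 1) := by
  obtain ⟨ha, hb⟩ := hI x hx hxr
  have hPA := S.pA (l + 2) (by omega)
  have hQA := S.pA (l + 1) (by omega)
  have sβx := S.factF hβ hx (by omega)
  have sβy := S.factF hβ hy (by omega)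
  have sxy := S.factF hx hy (by omega)
  have sxQ := S.after hx (i := l + 1) (by omega) (by omega) (by omega)
  have sxP := S.after hx (i := l + 2) (by omega) (by omega) (by omega)
  have sQy := S.before hy (i := l + 1) (by omega) (by omega)
  have syP := S.after hy (i := l + 2) (by omega) (by omega) (by omega)
  have sβQ := S.after hβ (i := l + 1) (by omega) (by omega) (by omega)
  have sβP := S.after hβ (i := l + 2) (by omega) (by omega) (by omega)
  have sQP := S.spp (l + 1) (l + 2) (by omega) (by omega) (by omega)
  have xyQ := S.turn0 hx hy hQA sxy sxQ sQy
  have bxy := S.turn1 hβ hx hy hQA sβx sβy sxy sxQ sQy ha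
  have bne : β ≠ y := (D_lt_ne sβy).2.2
  have PQx : D (p (l + 2)) (p (l + 1)) x < 0 := sN (S.claim hx (by omega) (by omega) (by omega))
  have PQy : D (p (l + 2)) (p (l + 1)) y < 0 := sN (S.claim hy (by omega) (by omega) (by omega))
  have Qxβ : D (p (l + 1)) x β < 0 := r2 (sN ha)
  have xβy : D x β y < 0 := sN bxy
  have main : 0 < D β y (p (l + 2)) := by
    rcases lt_or_gt_of_ne (S.dne (S.memB hβ) (S.memB hy) (S.memA hPA) bne
      (S.neAB hPA hβ).symm (S.neAB hPA hy).symm) with hcon | h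
    swap
    · exact h
    exfalso
    set P := p (l + 2) with hP
    set Q := p (l + 1) with hQ
    have Qxy : D Q x y < 0 := r2 xyQ
    have Pβy : D P β y < 0 := r2 hcon
    have Pxy : D P x y < 0 := by
      rcases lt_or_gt_of_ne (S.dne (S.memA hPA) (S.memB hx) (S.memB hy) (S.neAB hPA hx)
        (S.neAB hPA hy) (D_lt_ne sxy).2.2) with h | h
      · exact h
      exfalso
      have yxP : D y x P < 0 := r2 (sN h)
      have yQx : D y Q x < 0 := r2 Qxy
      have yxβ : D y x β < 0 := r2 xβy
      have yPβ : D y P β < 0 := r1 hcon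
      have yβQ : D y β Q < 0 := by
        rcases lt_or_gt_of_ne (S.dne (S.memB hy) (S.memB hβ) (S.memA hQA) bne.symm
          (S.neAB hQA hy).symm (S.neAB hQA hβ).symm) with h | h
        · exact h
        · exact (no_half' (s := y) (x := P) (y := Q) (z := x) (b := β) (r2 PQy) yQx yxP
            yPβ (D_pos_iff_swap'.1 h) yxβ).elim
      exact no_half (s := y) (x := x) (y := β) (z := Q) (b := s) yxβ yβQ yQx
        (r2 sxy) (r2 sβy) (r2 sQy)
    have Qβy : D Q β y < 0 := r1 (D_trans (t := y) (u := P) (p := Q) (q := x) (r := β)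
      (r2 PQy) (r2 Pxy) (r2 Pβy) (r2 Qxy) (r2 xβy))
    have Pxβ : D P x β < 0 := r2 (D_trans' (t := x) (u := Q) (p := β) (q := y) (r := P)
      (sP Qxβ) (sP Qxy) (sP (r1 PQx)) xβy (r1 Pxy))
    have PQβ : D P Q β < 0 := r2 (D_trans (t := Q) (u := x) (p := β) (q := y) (r := P)
      Qxβ Qxy (r1 PQx) Qβy (r1 PQy))
    have PP : Pent P Q x β y := ⟨PQx, PQβ, PQy, Pxβ, Pxy, Pβy, Qxβ, Qxy, Qβy, xβy⟩
    refine S.contra PP (S.uA hPA) (S.uA hQA) (S.uB hx) (S.uB hβ) (S.uB hy) (Or.inl hPA)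
      (Or.inr (Or.inr (Or.inl hx))) ?_ ?_ ?_
    · intro _ _ _ _ _
      apply PP.sep_edges
      right; right; left
      exact sP (r1 sβx)
    · intro g hg n1 n2 _ _ _
      apply PP.sep_edges
      left
      have g1 : g ≠ l + 2 := by rintro rfl; exact n1 rfl
      have g2 : g ≠ l + 1 := by rintro rfl; exact n2 rfl
      rcases Nat.lt_or_ge g (l + 1) with h | h
      · exact sP (r1 (S.ppp g (l + 1) (l + 2) (by omega) (by omega) (by omega)))
      · exact sP (S.ppp (l + 1) (l + 2) g (by omega) (by omega) (by omega))
    · intro z hz _ _ zx zβ zy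
      have z1 : rk s m p z ≠ l := fun h => zx (ux z hz h)
      have z2 : rk s m p z ≠ l + 1 := fun h => zy (uy z hz h)
      rcases Nat.lt_or_ge (l + 1) (rk s m p z) with h | h
      · refine pent_sep (u := P) (w := s) ?_ ?_ ?_ ?_ ?_
          (sP (S.before hz (i := l + 2) (by omega) (by omega)))
        · rw [D_self3]
        · exact (r2 sQP).le
        · exact (r2 sxP).le
        · exact (r2 sβP).le
        · exact (r2 syP).le
      · rcases S.dichB hβ hz zβ.symm with h' | h'
        · by_cases hzi : i ≤ rk s m p z
          · apply PP.sep_edges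
            right; right; left
            exact sP (hb z hz hzi (by omega) zβ h')
          · exact (asym h' (S.factF hz hβ (by omega))).elim
        · refine pent_sep (u := s) (w := β) sβP.le sβQ.le sβx.le ?_ sβy.le
            (D_pos_iff_swap'.2 h')
          rw [D_self2]
  intro y' hy' hyr'
  obtain rfl := uy y' hy' hyr'
  refine ⟨main, ?_⟩
  intro z hz h1 h2 h3 h4
  have byx : D β y' x < 0 := by rw [← D_pos_iff_swap']; exact bxy
  by_cases hzx : rk s m p z = l
  · rw [ux z hz hzx]; exact byx
  · exact D_trans' (u := s) (sP sβy) (sP sβx) (sP h4) byx (hb z hz h1 (by omega) h3 h4)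

end Sta


namespace Sta

variable {v : Pt} {c : ℝ} {A B : Finset Pt} {s : Pt} {m : ℕ} {p : ℕ → Pt}

lemma chain_end (S : Sta v c A B s m p) {i l : ℕ} {β x y γ : Pt} (hβ : β ∈ B)
    (hβr : rk s m p β = i) (hil : i < l) (hlm : l + 2 ≤ m) (hx : x ∈ B) (hxr : rk s m p x = l)
    (hy : y ∈ B) (hyr : rk s m p y = l + 1) (hγ : γ ∈ B) (hγr : rk s m p γ = l + 2)
    (ux : ∀ z ∈ B, rk s m p z = l → z = x) (uy : ∀ z ∈ B, rk s m p z = l + 1 → z = y)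
    (hI : Inv B s m p i β l) (hJ : Inv B s m p i β (l + 1)) (γyQ : D γ y (p (l + 1)) < 0)
    (hg : ∀ z ∈ B, rk s m p z = l + 2 → z ≠ γ → D s z γ < 0 → 0 < D γ y z) : False := by
  obtain ⟨ha, hb⟩ := hI x hx hxr
  have hc := (hJ y hy hyr).1
  have hPA := S.pA (l + 2) (by omega)
  have hQA := S.pA (l + 1) (by omega)
  have sβx := S.factF hβ hx (by omega)
  have sβy := S.factF hβ hy (by omega)
  have sβγ := S.factF hβ hγ (by omega)
  have sxy := S.factF hx hy (by omega)
  have sxγ := S.factF hx hγ (by omega)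
  have syγ := S.factF hy hγ (by omega)
  have sxQ := S.after hx (i := l + 1) (by omega) (by omega) (by omega)
  have sQy := S.before hy (i := l + 1) (by omega) (by omega)
  have sQγ := S.before hγ (i := l + 1) (by omega) (by omega)
  have syP := S.after hy (i := l + 2) (by omega) (by omega) (by omega)
  have sPγ := S.before hγ (i := l + 2) (by omega) (by omega)
  have sβQ := S.after hβ (i := l + 1) (by omega) (by omega) (by omega)
  have xyQ := S.turn0 hx hy hQA sxy sxQ sQy
  have bxy := S.turn1 hβ hx hy hQA sβx sβy sxy sxQ sQy ha
  have yγP := S.turn0 hy hγ hPA syγ syP sPγ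
  have byγ := S.turn1 hβ hy hγ hPA sβy sβγ syγ syP sPγ hc
  have bne : β ≠ y := (D_lt_ne sβy).2.2
  have xβy : D x β y < 0 := sN bxy
  have βγy : D β γ y < 0 := D_pos_iff_swap'.1 byγ
  have xβγ : D x β γ < 0 := by
    have h := D_trans' (t := β) (u := s) (p := γ) (q := y) (r := x) (sP sβγ) (sP sβy) (sP sβx)
      βγy (r1 xβy)
    exact r2 h
  set Q := p (l + 1) with hQ
  have Qxβ : D Q x β < 0 := r2 (sN ha)
  have Qxy : D Q x y < 0 := r2 xyQ
  have Qγy : D Q γ y < 0 := r2 γyQ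
  have yxβ : D y x β < 0 := r2 xβy
  have yQx : D y Q x < 0 := r2 Qxy
  have yQβ : D y Q β < 0 := by
    rcases lt_or_gt_of_ne (S.dne (S.memB hy) (S.memA hQA) (S.memB hβ)
          (S.neAB hQA hy).symm bne.symm (S.neAB hQA hβ)) with h | h
    · exact h
    · exact (no_half (s := y) (x := x) (y := β) (z := Q) (b := s) yxβ (D_pos_iff_swap'.1 h) yQx
        (r2 sxy) (r2 sβy) (r2 sQy)).elim
  have Qβy : D Q β y < 0 := r1 yQβ
  have xγy : D x γ y < 0 := r1 (D_trans (t := y) (u := Q) (p := x) (q := β) (r := γ)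
    yQx yQβ (r2 Qγy) yxβ (r2 βγy))
  have Qxγ : D Q x γ < 0 := r2 (D_trans (t := x) (u := β) (p := γ) (q := y) (r := Q)
    xβγ xβy (r1 Qxβ) xγy xyQ)
  have Qβγ : D Q β γ < 0 := r1 (D_trans (t := γ) (u := y) (p := Q) (q := x) (r := β)
    γyQ (r1 xγy) (r1 βγy) (r2 Qxγ) (r2 xβγ))
  have PP : Pent Q x β γ y := ⟨Qxβ, Qxγ, Qxy, Qβγ, Qβy, Qγy, xβγ, xβy, xγy, βγy⟩
  have lineγ : ∀ z, D s γ z < 0 → z ∉ convexHull ℝ ({Q, x, β, γ, y} : Set Pt) := by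
    intro z hz
    refine pent_sep (u := γ) (w := s) (r2 sQγ).le (r2 sxγ).le (r2 sβγ).le ?_ (r2 syγ).le (sP hz)
    rw [D_self3]
  refine S.contra PP (S.uA hQA) (S.uB hx) (S.uB hβ) (S.uB hγ) (S.uB hy) (Or.inl hQA)
    (Or.inr (Or.inl hx)) ?_ ?_ ?_
  · intro _ _ _ _ _
    apply PP.sep_edges
    right; left
    exact sP (r1 sβx)
  · intro g hgm n1 _ _ _ _
    have g1 : g ≠ l + 1 := by rintro rfl; exact n1 rfl
    rcases Nat.lt_or_ge (l + 2) g with h | h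
    · exact lineγ _ (S.after hγ (i := g) (by omega) (by omega) (by omega))
    · apply PP.sep_edges
      by_cases h2 : g = l + 2
      · subst h2
        right; right; right; left
        exact sP yγP
      · left
        have c1 : D Q (p l) x < 0 := sN (S.claim hx (by omega) (by omega) (by omega))
        have c2 : D Q (p g) x < 0 := by
          by_cases h3 : g = l
          · subst h3; exact c1
          · exact D_trans (t := Q) (u := s) (p := p g) (q := p l) (r := x)
              (r2 (S.spp g (l + 1) (by omega) (by omega) (by omega)))
              (r2 (S.spp l (l + 1) (by omega) (by omega) (by omega)))
              (r2 sxQ) (r2 (S.ppp g l (l + 1) (by omega) (by omega) (by omega))) c1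
        exact D_pos_iff_swap'.2 c2
  · intro z hz _ zx zβ zγ zy
    have z1 : rk s m p z ≠ l := fun h => zx (ux z hz h)
    have z2 : rk s m p z ≠ l + 1 := fun h => zy (uy z hz h)
    rcases Nat.lt_or_ge (l + 2) (rk s m p z) with h | h
    · exact lineγ _ (S.factF hγ hz (by omega))
    by_cases h2 : rk s m p z = l + 2
    · rcases S.dichB hγ hz zγ.symm with h' | h'
      · exact lineγ _ h'
      · apply PP.sep_edges
        right; right; right; left
        exact hg z hz h2 zγ h'
    · rcases S.dichB hβ hz zβ.symm with h' | h'
      · by_cases hzi : i ≤ rk s m p z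
        · apply PP.sep_edges
          right; left
          exact sP (hb z hz hzi (by omega) zβ h')
        · exact (asym h' (S.factF hz hβ (by omega))).elim
      · refine pent_sep (u := s) (w := β) sβQ.le sβx.le ?_ sβγ.le sβy.le
            (D_pos_iff_swap'.2 h')
        rw [D_self2]

lemma cnt_one (_S : Sta v c A B s m p) {k : ℕ} (h : cnt s m p B k = 1) :
    ∃ x ∈ B, rk s m p x = k ∧ ∀ z ∈ B, rk s m p z = k → z = x := by
  rw [cnt, Finset.card_eq_one] at h
  obtain ⟨x, hx⟩ := h
  have h1 : x ∈ B.filter (fun b => rk s m p b = k) := by rw [hx]; simp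
  rw [Finset.mem_filter] at h1
  refine ⟨x, h1.1, h1.2, fun z hz hzr => ?_⟩
  have : z ∈ B.filter (fun b => rk s m p b = k) := by rw [Finset.mem_filter]; exact ⟨hz, hzr⟩
  rw [hx] at this
  simpa using this

/-- The pattern `2, 1, …, 1, 2` does not occur. -/
lemma no_chain (S : Sta v c A B s m p) {i j : ℕ} (hij : i < j) (hj : j ≤ m)
    (hi2 : cnt s m p B i = 2) (hj2 : cnt s m p B j = 2)
    (h1 : ∀ g, i < g → g < j → cnt s m p B g = 1) : False := by
  rcases Nat.lt_or_ge j (i + 3) with hlt | hge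
  · have hm := S.hm
    have : j = i + 1 ∨ j = i + 2 := by omega
    rcases this with rfl | rfl
    · rcases Nat.lt_or_ge (i + 3) (m + 2) with h | h
      · have := S.feas (i := i) (by omega)
        rw [hi2, hj2] at this
        unfold Feas at this
        omega
      · obtain ⟨i, rfl⟩ : ∃ i', i = i' + 1 := ⟨i - 1, by omega⟩
        have := S.feas (i := i) (by omega)
        rw [hi2, hj2] at this
        unfold Feas at this
        omega
    · have := S.feas (i := i) (by omega)
      rw [hi2, hj2, h1 (i + 1) (by omega) (by omega)] at this
      unfold Feas at this
      omega
  · obtain ⟨x, hx, hxr, ux⟩ := S.cnt_one (h1 (i + 1) (by omega) (by omega))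
    obtain ⟨β, hβ, hβr, hb1, hb2⟩ := S.wf211 (by omega) hi2 (h1 (i + 1) (by omega) (by omega))
      (h1 (i + 2) (by omega) (by omega)) hx hxr
    have base : Inv B s m p i β (i + 1) := by
      intro x' hx' hxr'
      obtain rfl := ux x' hx' hxr'
      exact ⟨hb1, fun z hz h3 h4 h5 h6 => hb2 z hz (by omega) h5 h6⟩
    have all : ∀ k, i + 1 + k < j → Inv B s m p i β (i + 1 + k) := by
      intro k
      induction k with
      | zero => intro _; exact base
      | succ k ih =>
        intro hk
        obtain ⟨x, hx, hxr, ux⟩ := S.cnt_one (h1 (i + 1 + k) (by omega) (by omega))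
        obtain ⟨y, hy, hyr, uy⟩ := S.cnt_one (h1 (i + 1 + k + 1) (by omega) (by omega))
        exact S.inv_step (l := i + 1 + k) hβ hβr (by omega) (by omega) hx hxr hy hyr ux uy (ih (by omega))
    obtain ⟨l, rfl⟩ : ∃ l, j = l + 2 := ⟨j - 2, by omega⟩
    obtain ⟨x, hx, hxr, ux⟩ := S.cnt_one (h1 l (by omega) (by omega))
    obtain ⟨y, hy, hyr, uy⟩ := S.cnt_one (h1 (l + 1) (by omega) (by omega))
    obtain ⟨γ, hγ, hγr, hg1, hg2⟩ := S.wf112 (by omega) (h1 l (by omega) (by omega))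
      (h1 (l + 1) (by omega) (by omega)) hj2 hy hyr
    have I1 := all (l - (i + 1)) (by omega)
    have I2 := all (l + 1 - (i + 1)) (by omega)
    rw [Nat.add_sub_cancel' (by omega)] at I1 I2
    exact S.chain_end hβ hβr (by omega) (by omega) hx hxr hy hyr hγ hγr ux uy I1 I2 hg1 hg2

end Sta


/-! ### The exceptional case with weights `3, 0, 0, 3` -/

/-- The labelling of the full configuration. -/
def fF (s : Pt) (p : ℕ → Pt) (e : List Pt) (k : ℕ) : Pt :=
  if k = 0 then s else if k < 6 then p (k - 1) else e.getD (k - 6) s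

namespace Sta

variable {v : Pt} {c : ℝ} {A B : Finset Pt} {s : Pt} {p : ℕ → Pt}

lemma all_cfg (S : Sta v c A B s 3 p) {e : List Pt}
    (hlen : e.length = 6) (hsort : e.Pairwise (fun x y => D s x y < 0))
    (heB : ∀ x, x ∈ e ↔ x ∈ B)
    (hr0 : ∀ k, k < 3 → rk s 3 p (e.getD k s) = 0)
    (hr3 : ∀ k, 3 ≤ k → k < 6 → rk s 3 p (e.getD k s) = 3) :
    Cfg 12 6 uF (fF s p e) := by
  have f0 : fF s p e 0 = s := by simp [fF]
  have f1 : ∀ k, 1 ≤ k → k < 6 → fF s p e k = p (k - 1) := by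
    intro k h1 h2
    unfold fF
    rw [if_neg (by omega), if_pos h2]
  have f2 : ∀ k, 6 ≤ k → fF s p e k = e.getD (k - 6) s := by
    intro k h1
    unfold fF
    rw [if_neg (by omega), if_neg (by omega)]
  have fA : ∀ k, k < 6 → fF s p e k ∈ A := by
    intro k hk
    rcases Nat.eq_zero_or_pos k with rfl | h
    · rw [f0]; exact S.sA
    · rw [f1 k h hk]; exact S.pA _ (by omega)
  have fB : ∀ k, 6 ≤ k → k < 12 → fF s p e k ∈ B := by
    intro k h1 h2
    rw [← heB, f2 k h1]
    exact getD_mem' (by omega)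
  have r0 : ∀ k, 6 ≤ k → k < 9 → rk s 3 p (fF s p e k) = 0 := by
    intro k h1 h2
    rw [f2 k h1]
    exact hr0 _ (by omega)
  have r3 : ∀ k, 9 ≤ k → k < 12 → rk s 3 p (fF s p e k) = 3 := by
    intro k h1 h2
    rw [f2 k (by omega)]
    exact hr3 _ (by omega) (by omega)
  have fC : ∀ k, k < 12 → fF s p e k ∈ A ∪ B := by
    intro k hk
    rcases Nat.lt_or_ge k 6 with h | h
    · exact S.uA (fA k h)
    · exact S.uB (fB k h hk)
  have fBB : ∀ j k, 6 ≤ j → j < k → k < 12 → D s (fF s p e j) (fF s p e k) < 0 := by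
    intro j k h1 h2 h3
    rw [f2 j h1, f2 k (by omega), List.getD_eq_getElem _ _ (by omega),
      List.getD_eq_getElem _ _ (by omega)]
    exact List.pairwise_iff_getElem.1 hsort _ _ _ _ (by omega)
  have finj : ∀ j k, j < k → k < 12 → fF s p e j ≠ fF s p e k := by
    intro j k h1 h2
    rcases Nat.lt_or_ge k 6 with h | h
    · rw [f1 k (by omega) h]
      rcases Nat.eq_zero_or_pos j with rfl | h'
      · rw [f0]; exact (S.p_ne_s (by omega)).symm
      · rw [f1 j h' (by omega)]; exact S.p_ne (by omega) (by omega) (by omega)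
    · rcases Nat.lt_or_ge j 6 with h' | h'
      · exact S.neAB (fA j h') (fB k h h2)
      · exact (D_lt_ne (fBB j k h' h1 h2)).2.2
  have finj' : ∀ j k, j ≠ k → j < 12 → k < 12 → fF s p e j ≠ fF s p e k := by
    intro j k h1 h2 h3
    rcases lt_or_gt_of_ne h1 with h | h
    · exact finj j k h h3
    · exact (finj k j h h2).symm
  refine ⟨by omega, ?_, ?_, ?_, ?_⟩
  · intro a b d ha hb hd hab had hbd
    exact S.dne (by exact_mod_cast fC a ha) (by exact_mod_cast fC b hb)
      (by exact_mod_cast fC d hd) (finj' a b hab ha hb) (finj' a d had ha hd) (finj' b d hbd hb hd)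
  · refine ⟨v, c, fun k h1 h2 => S.hA _ (fA k h1), fun k h1 h2 => S.hB _ (fB k h1 h2)⟩
  · intro a b d ha hb hd hu
    have lf : ∀ x y, ¬ x < y → lt' x y = false := by
      intro x y h
      rw [← Bool.not_eq_true, lt'_iff]; exact h
    have lT : ∀ x y, x < y → lt' x y = true := fun x y h => (lt'_iff _ _).2 h
    rcases a with _ | a
    · unfold uF at hu
      simp only [Bool.and_eq_true, lt'_iff] at hu
      obtain ⟨b0, d0, hu⟩ := hu
      rw [f0]
      by_cases hb5 : b < 6
      · rw [lT _ _ hb5, cond_true] at hu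
        by_cases hd5 : d < 6
        · rw [lT _ _ hd5, cond_true] at hu
          simp only [Bool.or_eq_true, Bool.and_eq_true, Nat.beq_eq, lt'_iff,
            Bool.not_eq_true', Bool.and_eq_false_iff, ← Bool.not_eq_true] at hu
          rw [f1 b b0 hb5, f1 d d0 hd5]
          rcases hu with ⟨rfl, rfl⟩ | ⟨h1, h2⟩
          · exact S.spp0
          · exact S.spp _ _ (by omega) (by omega) (by omega)
        · rw [lf _ _ hd5, cond_false] at hu
          rw [f1 b b0 hb5]
          by_cases hd9 : d < 9
          · rw [lT _ _ hd9, cond_true, Nat.beq_eq] at hu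
            subst hu
            exact S.before (fB d (by omega) hd) (by omega) (by rw [r0 d (by omega) hd9]; omega)
          · rw [lf _ _ hd9, cond_false, Bool.and_eq_true, lt'_iff, lt'_iff] at hu
            exact S.before (fB d (by omega) hd) (by rw [r3 d (by omega) hd]; omega) (by omega)
      · rw [lf _ _ hb5, cond_false] at hu
        by_cases hd5 : d < 6
        · rw [lT _ _ hd5, cond_true] at hu
          rw [f1 d d0 hd5]
          by_cases hb9 : b < 9
          · rw [lT _ _ hb9, cond_true, Bool.and_eq_true, lt'_iff, lt'_iff] at hu
            exact S.after (fB b (by omega) hb) (by rw [r0 b (by omega) hb9]; omega) (by omega)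
              (by omega)
          · rw [lf _ _ hb9, cond_false, Nat.beq_eq] at hu
            subst hu
            exact S.after (fB b (by omega) hb) (by rw [r3 b (by omega) hb]; omega) (by omega)
              (by rw [r3 b (by omega) hb]; omega)
        · rw [lf _ _ hd5, cond_false, lt'_iff] at hu
          exact fBB b d (by omega) hu hd
    · unfold uF at hu
      simp only [Bool.and_eq_true, lt'_iff] at hu
      obtain ⟨a0, b0, b5, hu⟩ := hu
      rw [f1 (a + 1) (by omega) (by omega), f1 b b0 b5]
      by_cases hd5 : d < 6
      · rw [lT _ _ hd5, cond_true, Bool.and_eq_true, lt'_iff, lt'_iff] at hu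
        rw [f1 d (by omega) hd5]
        exact S.ppp _ _ _ (by omega) (by omega) (by omega)
      · rw [lf _ _ hd5, cond_false, Bool.or_eq_true, Bool.and_eq_true, Bool.and_eq_true,
          Nat.beq_eq, Nat.beq_eq, Nat.beq_eq] at hu
        rcases hu with ⟨rfl, rfl⟩ | ⟨rfl, hu⟩
        · exact S.edge _ (fB d (by omega) hd)
        · rw [← D_pos_iff_swap]
          have e1 : a + 1 - 1 = (a - 1) + 1 := by omega
          rw [e1]
          by_cases hd9 : d < 9
          · rw [lT _ _ hd9, cond_true, lt'_iff] at hu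
            have := r0 d (by omega) hd9
            exact S.claim (fB d (by omega) hd) (by omega) (by omega) (by omega)
          · rw [lf _ _ hd9, cond_false, lt'_iff] at hu
            have := r3 d (by omega) hd
            exact S.claim (fB d (by omega) hd) (by omega) (by omega) (by omega)
  · intro a1 a2 a3 a4 a5 l1 l2 l3 l4 l5 P hA' hB' hemp
    have hin : ∀ k, k < 12 → fF s p e k ≠ fF s p e a1 →
        fF s p e k ≠ fF s p e a2 → fF s p e k ≠ fF s p e a3 →
        fF s p e k ≠ fF s p e a4 → fF s p e k ≠ fF s p e a5 → fF s p e k ∉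
        convexHull ℝ ({fF s p e a1, fF s p e a2, fF s p e a3, fF s p e a4, fF s p e a5}
        : Set Pt) := by
      intro k hk n1 n2 n3 n4 n5
      exact hemp k hk (fun h => n1 (by rw [h])) (fun h => n2 (by rw [h])) (fun h => n3 (by rw [h]))
        (fun h => n4 (by rw [h])) (fun h => n5 (by rw [h]))
    refine S.contra P (fC _ l1) (fC _ l2) (fC _ l3) (fC _ l4) (fC _ l5) ?_ ?_ ?_ ?_ ?_
    · rcases hA' with h | h | h | h | h
      · exact Or.inl (fA _ h)
      · exact Or.inr (Or.inl (fA _ h))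
      · exact Or.inr (Or.inr (Or.inl (fA _ h)))
      · exact Or.inr (Or.inr (Or.inr (Or.inl (fA _ h))))
      · exact Or.inr (Or.inr (Or.inr (Or.inr (fA _ h))))
    · rcases hB' with h | h | h | h | h
      · exact Or.inl (fB _ h l1)
      · exact Or.inr (Or.inl (fB _ h l2))
      · exact Or.inr (Or.inr (Or.inl (fB _ h l3)))
      · exact Or.inr (Or.inr (Or.inr (Or.inl (fB _ h l4))))
      · exact Or.inr (Or.inr (Or.inr (Or.inr (fB _ h l5))))
    · have := hin 0 (by omega)
      rwa [f0] at this
    · intro j hj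
      have := hin (j + 1) (by omega)
      rw [f1 _ (by omega) (by omega), Nat.add_sub_cancel] at this
      exact this
    · intro x hx n1 n2 n3 n4 n5 hxx
      have h1 : x ∈ e := (heB x).2 hx
      obtain ⟨k, hk, rfl⟩ := List.getElem_of_mem h1
      have e1 : fF s p e (k + 6) = e[k] := by
        rw [f2 _ (by omega), List.getD_eq_getElem _ _ (by omega)]
        simp
      have := hin (k + 6) (by omega)
      rw [e1] at this
      exact this n1 n2 n3 n4 n5 hxx

lemma no_3003 (S : Sta v c A B s 3 p) (h0 : cnt s 3 p B 0 = 3) (h1 : cnt s 3 p B 1 = 0)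
    (h2 : cnt s 3 p B 2 = 0) (h3 : cnt s 3 p B 3 = 3) : False := by
  obtain ⟨L0, a0, b0, c0⟩ := S.exists_wedge_list (T := B) subset_rfl 0
  obtain ⟨L3, a3, b3, c3⟩ := S.exists_wedge_list (T := B) subset_rfl 3
  rw [h0] at c0
  rw [h3] at c3
  have hz : ∀ k, cnt s 3 p B k = 0 → ∀ x ∈ B, rk s 3 p x ≠ k := by
    intro k hk x hx hxr
    rw [cnt, Finset.card_eq_zero] at hk
    have : x ∈ B.filter (fun b => rk s 3 p b = k) := by rw [Finset.mem_filter]; exact ⟨hx, hxr⟩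
    rw [hk] at this
    simp at this
  refine chk_sound (S.all_cfg (e := L0 ++ L3) (by simp [c0, c3]) ?_ ?_ ?_ ?_) ct_full 0
    (MaskOK.zero _) ct_full_ok
  · rw [List.pairwise_append]
    refine ⟨a0, a3, ?_⟩
    intro x hx y hy
    rw [b0] at hx
    rw [b3] at hy
    exact S.factF hx.1 hy.1 (by omega)
  · intro x
    rw [List.mem_append, b0, b3]
    constructor
    · rintro (h | h) <;> exact h.1
    · intro hx
      have k1 := hz 1 h1 x hx
      have k2 := hz 2 h2 x hx
      have := rk_le s 3 p x
      have : rk s 3 p x = 0 ∨ rk s 3 p x = 3 := by omega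
      tauto
  · intro k hk
    rw [List.getD_append _ _ _ _ (by omega)]
    exact ((b0 _).1 (getD_mem' (by omega))).2
  · intro k h1 h2
    rw [List.getD_append_right _ _ _ _ (by omega)]
    exact ((b3 _).1 (getD_mem' (by omega))).2

end Sta


/-! ### Counting -/

/-- The state after `k` wedges. -/
def StW (w : ℕ → ℕ) (k : ℕ) : Prop :=
  ∑ i ∈ Finset.range k, w i ≤ k ∨ (∑ i ∈ Finset.range k, w i = k + 1 ∧
    ∃ i, i < k ∧ w i = 2 ∧ ∀ g, i < g → g < k → w g = 1)

lemma StW.step {w : ℕ → ℕ} {k : ℕ} (h : StW w k) (hw : w k ≤ 2)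
    (hc : ∀ i, i < k → w i = 2 → w k = 2 → (∀ g, i < g → g < k → w g = 1) → False) :
    StW w (k + 1) := by
  unfold StW
  rw [Finset.sum_range_succ]
  rcases h with h | ⟨h, i, hi, h2, h1⟩
  · by_cases hk : w k = 2
    · rcases Nat.lt_or_ge (∑ i ∈ Finset.range k, w i) k with h' | h'
      · left; omega
      · right
        exact ⟨by omega, k, by omega, hk, fun g h3 h4 => by omega⟩
    · left; omega
  · by_cases hk : w k = 2
    · exact (hc i hi h2 hk h1).elim
    · by_cases hk1 : w k = 1
      · right
        refine ⟨by omega, i, by omega, h2, fun g h3 h4 => ?_⟩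
        rcases Nat.lt_succ_iff_lt_or_eq.1 h4 with h5 | h5
        · exact h1 g h3 h5
        · rw [h5, hk1]
      · left; omega

lemma StW.le {w : ℕ → ℕ} {k : ℕ} (h : StW w k) : ∑ i ∈ Finset.range k, w i ≤ k + 1 := by
  rcases h with h | ⟨h, _⟩ <;> omega

lemma Sta.Feas.fst {a b d : ℕ} (h : Sta.Feas a b d) : a ≤ 3 ∧ (a = 3 → b = 0 ∧ d = 0) := by
  unfold Sta.Feas at h; omega
lemma Sta.Feas.thd {a b d : ℕ} (h : Sta.Feas a b d) : d ≤ 3 ∧ (d = 3 → a = 0 ∧ b = 0) := by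
  unfold Sta.Feas at h; omega
lemma Sta.Feas.snd {a b d : ℕ} (h : Sta.Feas a b d) : b ≤ 2 := by
  unfold Sta.Feas at h; omega

lemma arith {m : ℕ} (hm : 3 ≤ m) (w : ℕ → ℕ)
    (hf : ∀ i, i + 3 ≤ m + 1 → Sta.Feas (w i) (w (i + 1)) (w (i + 2)))
    (hc : ∀ i j, i < j → j ≤ m → w i = 2 → w j = 2 → (∀ g, i < g → g < j → w g = 1) → False)
    (h3 : m = 3 → w 0 = 3 → w 1 = 0 → w 2 = 0 → w 3 = 3 → False) :
    ∑ i ∈ Finset.range (m + 1), w i ≤ m + 2 := by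
  have mid : ∀ k, 1 ≤ k → k < m → w k ≤ 2 := by
    intro k h1 h2
    have := (hf (k - 1) (by omega)).snd
    rwa [Nat.sub_add_cancel h1] at this
  obtain ⟨f1, f2⟩ := (hf 0 (by omega)).fst
  obtain ⟨n, rfl⟩ : ∃ n, m = n + 2 := ⟨m - 2, by omega⟩
  obtain ⟨g1, g2⟩ := (hf n (by omega)).thd
  have steps : ∀ k0, (1 ≤ k0 ∨ w 0 ≤ 2) → StW w k0 → ∀ k, k0 ≤ k → k ≤ n + 2 → StW w k := by
    intro k0 h0 hs k hk
    induction k, hk using Nat.le_induction with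
    | base => intro _; exact hs
    | succ k hk ih =>
      intro hkm
      refine (ih (by omega)).step ?_ (fun i hi a b d => hc i k hi (by omega) a b d)
      rcases Nat.eq_zero_or_pos k with rfl | hp
      · rcases h0 with h0 | h0
        · omega
        · exact h0
      · exact mid k hp (by omega)
  have fin : StW w (n + 2) → w (n + 2) ≤ 2 → ∑ i ∈ Finset.range (n + 2 + 1), w i ≤ n + 2 + 2 := by
    intro h h'
    exact (h.step h' (fun i hi a b d => hc i (n + 2) hi (by omega) a b d)).le
  have fin3 : ∑ i ∈ Finset.range n, w i ≤ n + 1 → w (n + 2) = 3 →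
      ∑ i ∈ Finset.range (n + 2 + 1), w i ≤ n + 2 + 2 := by
    intro h h'
    obtain ⟨e1, e2⟩ := g2 h'
    rw [Finset.sum_range_succ, Finset.sum_range_succ, Finset.sum_range_succ, e1, e2, h']
    omega
  by_cases h0 : w 0 = 3
  · obtain ⟨e1, e2⟩ := f2 h0
    rw [zero_add] at e1 e2
    have s3 : StW w 3 := by
      left
      simp only [Finset.sum_range_succ, Finset.sum_range_zero, h0, e1, e2]
      norm_num
    by_cases hl : w (n + 2) = 3
    · apply fin3 _ hl
      rcases Nat.lt_or_ge n 3 with hn | hn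
      · have : n = 1 ∨ n = 2 := by omega
        rcases this with rfl | rfl
        · exact (h3 rfl h0 e1 e2 hl).elim
        · simp only [Finset.sum_range_succ, Finset.sum_range_zero, h0, e1]
          norm_num
      · exact (steps 3 (by omega) s3 n hn (by omega)).le
    · exact fin (steps 3 (by omega) s3 _ hm le_rfl) (by omega)
  · have s0 : StW w 0 := by left; simp
    by_cases hl : w (n + 2) = 3
    · exact fin3 (steps 0 (by omega) s0 n (by omega) (by omega)).le hl
    · exact fin (steps 0 (by omega) s0 _ (by omega) le_rfl) (by omega)

lemma Sta.card_B {v : Pt} {c : ℝ} {A B : Finset Pt} {s : Pt} {m : ℕ} {p : ℕ → Pt}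
    (S : Sta v c A B s m p) : B.card ≤ m + 2 := by
  have h1 : B.card = ∑ i ∈ Finset.range (m + 1), cnt s m p B i := by
    apply Finset.card_eq_sum_card_fiberwise
    intro x _
    have := rk_le s m p x
    simp
    omega
  rw [h1]
  refine arith S.hm _ (fun i hi => S.feas hi) ?_ ?_
  · intro i j h1 h2 h3 h4 h5
    exact S.no_chain h1 h2 h3 h4 h5
  · intro h
    subst h
    exact S.no_3003


/-! ### Building the structure -/

lemma mem_interior_tri {P : Finset Pt} {s x y z : Pt} (hx : x ∈ P) (hy : y ∈ P) (hz : z ∈ P)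
    (h1 : D s x y < 0) (h2 : D s y z < 0) (h3 : D s z x < 0) : ¬ OnHullBoundary P s := by
  intro hf
  unfold OnHullBoundary at hf
  refine hf.2 ?_
  rw [mem_interior]
  have cD : ∀ u w : Pt, Continuous (fun t : Pt => D u w t) := by
    intro u w; unfold D; fun_prop
  refine ⟨{t | D x y t < 0} ∩ {t | D y z t < 0} ∩ {t | D z x t < 0}, ?_, ?_, ?_⟩
  · rintro t ⟨⟨g1, g2⟩, g3⟩
    have g1' : D x y t < 0 := g1
    have g2' : D y z t < 0 := g2
    have g3' : D z x t < 0 := g3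
    have e : D x y z = D x y t + D y z t + D z x t := by unfold D; ring
    refine convexHull_mono ?_ (mem_tri g1'.le g2'.le g3'.le (by linarith))
    intro w hw
    simp only [Set.mem_insert_iff, Set.mem_singleton_iff] at hw
    rcases hw with rfl | rfl | rfl <;> assumption
  · exact ((isOpen_lt (cD _ _) continuous_const).inter
      (isOpen_lt (cD _ _) continuous_const)).inter (isOpen_lt (cD _ _) continuous_const)
  · exact ⟨⟨r1 h1, r1 h2⟩, r1 h3⟩

lemma conv4 {S : Set Pt} (hS : ConvexPos S) {w x y z : Pt} (hw : w ∈ S) (hx : x ∈ S) (hy : y ∈ S)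
    (hz : z ∈ S) (h1 : D w x y < 0) (h2 : D w y z < 0) (h3 : D w z x < 0) : False := by
  refine hS w hw ?_
  have e : D x y z = D w x y + D w y z + D w z x := by unfold D; ring
  refine convexHull_mono ?_ (mem_tri (r1 h1).le (r1 h2).le (r1 h3).le (by linarith))
  intro t ht
  simp only [Set.mem_insert_iff, Set.mem_singleton_iff] at ht
  rcases ht with rfl | rfl | rfl
  · exact ⟨hx, (D_lt_ne h1).1.symm⟩
  · exact ⟨hy, (D_lt_ne h2).1.symm⟩
  · exact ⟨hz, (D_lt_ne h3).1.symm⟩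

lemma tri_of_hull {P T : Set Pt} (hP : GenPos P) (hT : T ⊆ P) {s : Pt} (hs : s ∈ P) (hsT : s ∉ T)
    (h : s ∈ convexHull ℝ T) : ∃ x ∈ T, ∃ y ∈ T, ∃ z ∈ T,
      D s x y < 0 ∧ D s y z < 0 ∧ D s z x < 0 := by
  rw [convexHull_eq_union] at h
  simp only [Set.mem_iUnion] at h
  obtain ⟨t, htT, hind, hst⟩ := h
  have hcard : t.card ≤ 3 := by
    have h2 := hind.card_le_finrank_succ.trans (Nat.succ_le_succ (Submodule.finrank_le _))
    rw [Fintype.card_coe] at h2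
    simpa using h2
  have key : ∀ x ∈ T, ∀ y ∈ T, ∀ z ∈ T, x ≠ y → x ≠ z → y ≠ z → D x y z < 0 →
      s ∈ convexHull ℝ ({x, y, z} : Set Pt) → D s x y < 0 ∧ D s y z < 0 ∧ D s z x < 0 := by
    intro x hx y hy z hz hxy hxz hyz hD hsx
    have aux : ∀ u ∈ T, ∀ w ∈ T, u ≠ w → D u w x ≤ 0 → D u w y ≤ 0 → D u w z ≤ 0 →
        D s u w < 0 := by
      intro u hu w hw huw k1 k2 k3
      have k : D u w s ≤ 0 := by
        refine hull_D_le ?_ hsx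
        intro q hq
        simp only [Set.mem_insert_iff, Set.mem_singleton_iff] at hq
        rcases hq with rfl | rfl | rfl <;> assumption
      exact r2 (lt_of_le_of_ne k (hP.D_ne (hT hu) (hT hw) hs huw
        (by rintro rfl; exact hsT hu) (by rintro rfl; exact hsT hw)))
    refine ⟨aux x hx y hy hxy ?_ ?_ hD.le, aux y hy z hz hyz (r1 hD).le ?_ ?_,
      aux z hz x hx hxz.symm ?_ (r2 hD).le ?_⟩
    · rw [D_self3]
    · rw [D_self2]
    · rw [D_self3]
    · rw [D_self2]
    · rw [D_self2]
    · rw [D_self3]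
  have : t.card = 0 ∨ t.card = 1 ∨ t.card = 2 ∨ t.card = 3 := by omega
  rcases this with h | h | h | h
  · rw [Finset.card_eq_zero] at h
    subst h
    simp at hst
  · rw [Finset.card_eq_one] at h
    obtain ⟨x, rfl⟩ := h
    simp at hst
    subst hst
    exact (hsT (htT (by simp))).elim
  · rw [Finset.card_eq_two] at h
    obtain ⟨x, y, hxy, rfl⟩ := h
    have hx : x ∈ T := htT (by simp)
    have hy : y ∈ T := htT (by simp)
    have k1 : D x y s ≤ 0 := by
      refine hull_D_le ?_ hst
      intro q hq
      simp only [Finset.coe_insert, Finset.coe_singleton, Set.mem_insert_iff,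
        Set.mem_singleton_iff] at hq
      rcases hq with rfl | rfl
      · rw [D_self3]
      · rw [D_self2]
    have k2 : D y x s ≤ 0 := by
      refine hull_D_le ?_ hst
      intro q hq
      simp only [Finset.coe_insert, Finset.coe_singleton, Set.mem_insert_iff,
        Set.mem_singleton_iff] at hq
      rcases hq with rfl | rfl
      · rw [D_self2]
      · rw [D_self3]
    rw [D_swap] at k2
    exact (hP.D_ne (hT hx) (hT hy) hs hxy (by rintro rfl; exact hsT hx)
      (by rintro rfl; exact hsT hy) (by linarith)).elim
  · rw [Finset.card_eq_three] at h
    obtain ⟨x, y, z, hxy, hxz, hyz, rfl⟩ := h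
    have hx : x ∈ T := htT (by simp)
    have hy : y ∈ T := htT (by simp)
    have hz : z ∈ T := htT (by simp)
    have e : (↑({x, y, z} : Finset Pt) : Set Pt) = {x, y, z} := by simp
    rw [e] at hst
    rcases lt_or_gt_of_ne (hP.D_ne (hT hx) (hT hy) (hT hz) hxy hxz hyz) with h | h
    · exact ⟨x, hx, y, hy, z, hz, key x hx y hy z hz hxy hxz hyz h hst⟩
    · have e2 : ({x, y, z} : Set Pt) = {y, x, z} := Set.insert_comm x y {z}
      rw [e2] at hst
      exact ⟨y, hy, x, hx, z, hz, key y hy x hx z hz hxy.symm hyz hxz (sN h) hst⟩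

/-- A minimiser of a linear functional is on the boundary. -/
lemma boundary_of_min {P : Finset Pt} {a a' b : Pt} (hb : b ∈ P) (hneg : D a' a b < 0)
    (hmin : ∀ x ∈ P, D a' a b ≤ D a' a x) : OnHullBoundary P b := by
  unfold OnHullBoundary
  refine ⟨subset_closure (subset_convexHull ℝ _ hb), fun hi => ?_⟩
  have hlow : ∀ x ∈ convexHull ℝ (↑P : Set Pt), D a' a b ≤ D a' a x := by
    intro x hx
    have h := hull_D_le (u := b + (a - a')) (w := b) (S := (↑P : Set Pt)) (x := x) ?_ hx
    · have e : D (b + (a - a')) b x = D a' a b - D a' a x := by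
        unfold D; simp; ring
      linarith
    · intro y hy
      have e : D (b + (a - a')) b y = D a' a b - D a' a y := by
        unfold D; simp; ring
      have := hmin y hy
      linarith
  have hc : Filter.Tendsto (fun t : ℝ => b + t • (b - a)) (nhds 0) (nhds b) := by
    have : Continuous (fun t : ℝ => b + t • (b - a)) := by fun_prop
    have h := this.tendsto 0
    simpa using h
  have hev : ∀ᶠ t in nhds (0 : ℝ), b + t • (b - a) ∈ convexHull ℝ (↑P : Set Pt) :=
    hc (mem_interior_iff_mem_nhds.1 hi)
  have hev2 : ∀ᶠ t in nhdsWithin (0 : ℝ) (Set.Ioi 0), b + t • (b - a) ∈ convexHull ℝ (↑P : Set Pt) :=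
    nhdsWithin_le_nhds hev
  obtain ⟨t, ht, ht0⟩ := (hev2.and self_mem_nhdsWithin).exists
  have ht0' : 0 < t := ht0
  have h := hlow _ ht
  have e : D a' a (b + t • (b - a)) = (1 + t) * D a' a b := by
    unfold D; simp; ring
  rw [e] at h
  nlinarith

lemma core {v : Pt} {c : ℝ} {A B : Finset Pt} (hA : ∀ p ∈ A, dotp v p < c)
    (hB : ∀ p ∈ B, c < dotp v p) (hgen : GenPos (↑(A ∪ B) : Set Pt))
    (hnh : ¬ ∃ H : Finset Pt, DividedFiveHole A B H) (hAcard : 6 ≤ A.card)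
    {a a' s q : Pt} (ha : a ∈ A) (ha' : a' ∈ A) (hs : s ∈ A) (hq : q ∈ A)
    (hfa : OnHullBoundary (A ∪ B) a) (hfa' : OnHullBoundary (A ∪ B) a')
    (hf : ∀ x ∈ A, OnHullBoundary (A ∪ B) x → x = a ∨ x = a')
    (hca : ConvexPos (↑(A.erase a) : Set Pt)) (hca' : ConvexPos (↑(A.erase a') : Set Pt))
    (h1 : D s a q < 0) (h2 : D s q a' < 0) (h3 : D s a' a < 0) : B.card + 1 ≤ A.card := by
  have uA : ∀ x ∈ A, x ∈ A ∪ B := fun x hx => Finset.mem_union_left _ hx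
  have uB : ∀ x ∈ B, x ∈ A ∪ B := fun x hx => Finset.mem_union_right _ hx
  have dne : ∀ x ∈ A ∪ B, ∀ y ∈ A ∪ B, ∀ z ∈ A ∪ B, x ≠ y → x ≠ z → y ≠ z → D x y z ≠ 0 := by
    intro x hx y hy z hz
    exact hgen.D_ne (by exact_mod_cast hx) (by exact_mod_cast hy) (by exact_mod_cast hz)
  have sa : s ≠ a := (D_lt_ne h1).1
  have sa' : s ≠ a' := (D_lt_ne h3).1
  have aa' : a ≠ a' := (D_lt_ne h3).2.2.symm
  have qa : q ≠ a := (D_lt_ne h1).2.2.symm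
  have qa' : q ≠ a' := (D_lt_ne h2).2.2
  have mE : ∀ {x y : Pt}, x ∈ A → x ≠ y → x ∈ (↑(A.erase y) : Set Pt) := by
    intro x y hx hxy
    rw [Finset.mem_coe, Finset.mem_erase]; exact ⟨hxy, hx⟩
  have lt_or : ∀ x ∈ A, ∀ y ∈ A, x ≠ s → y ≠ s → x ≠ y → D s x y < 0 ∨ D s y x < 0 := by
    intro x hx y hy hxs hys hxy
    rcases lt_or_gt_of_ne (dne s (uA s hs) x (uA x hx) y (uA y hy) hxs.symm hys.symm hxy)
      with h | h
    · exact Or.inl h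
    · exact Or.inr (D_pos_iff_swap'.1 h)
  have k1 : ∀ x ∈ A, x ≠ s → x ≠ a → x ≠ a' → D s a x < 0 := by
    intro x hx xs xa xa'
    by_cases hxq : x = q
    · rw [hxq]; exact h1
    have qs : q ≠ s := (D_lt_ne h1).2.1.symm
    rcases lt_or x hx a ha xs sa.symm xa with g | g
    swap
    · exact g
    exfalso
    rcases lt_or q hq x hx qs xs (Ne.symm hxq) with g2 | g2
    · exact conv4 hca' (mE hs sa') (mE ha aa') (mE hq qa') (mE hx xa') h1 g2 g
    rcases lt_or a' ha' x hx sa'.symm xs xa'.symm with g3 | g3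
    · exact conv4 hca (mE hs sa) (mE hq qa) (mE ha' aa'.symm) (mE hx xa) h2 g3 g2
    · exact no_half h1 h2 h3 g g2 g3
  have k2 : ∀ x ∈ A, x ≠ s → x ≠ a → x ≠ a' → D s x a' < 0 := by
    intro x hx xs xa xa'
    by_cases hxq : x = q
    · rw [hxq]; exact h2
    have qs : q ≠ s := (D_lt_ne h1).2.1.symm
    rcases lt_or x hx a' ha' xs sa'.symm xa' with g | g
    · exact g
    exfalso
    rcases lt_or x hx q hq xs qs hxq with g2 | g2
    · exact conv4 hca (mE hs sa) (mE hq qa) (mE ha' aa'.symm) (mE hx xa) h2 g g2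
    · exact no_half' h1 h2 h3 (k1 x hx xs xa xa') g2 g
  -- the sorted list
  set T := A \ {s, a, a'} with hT
  have memT : ∀ x, x ∈ T ↔ x ∈ A ∧ x ≠ s ∧ x ≠ a ∧ x ≠ a' := by
    intro x
    rw [hT, Finset.mem_sdiff]
    simp
  have cardT : T.card + 3 = A.card := by
    have h : ({s, a, a'} : Finset Pt) ⊆ A := by
      intro x hx
      simp only [Finset.mem_insert, Finset.mem_singleton] at hx
      rcases hx with rfl | rfl | rfl <;> assumption
    have h' : ({s, a, a'} : Finset Pt).card = 3 := by
      rw [Finset.card_eq_three]; exact ⟨s, a, a', sa, sa', aa', rfl⟩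
    rw [hT, Finset.card_sdiff_of_subset h, h']
    omega
  obtain ⟨L, hL1, hL2, hL3⟩ := exists_sort (t := s) (u := a') T
    (by
      intro x hx
      obtain ⟨g1, g2, g3, g4⟩ := (memT x).1 hx
      exact D_pos_iff_swap'.2 (k2 x g1 g2 g3 g4))
    (by
      intro x hx y hy hxy
      obtain ⟨g1, g2, g3, g4⟩ := (memT x).1 hx
      obtain ⟨e1, e2, e3, e4⟩ := (memT y).1 hy
      exact dne s (uA s hs) x (uA x g1) y (uA y e1) g2.symm e2.symm hxy)
  obtain ⟨m, hm⟩ : ∃ m, T.card = m := ⟨_, rfl⟩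
  rw [hm] at hL3 cardT
  let p : ℕ → Pt := fun i => if i = 0 then a else if i ≤ m then L.getD (i - 1) s else a'
  have p0 : p 0 = a := by simp [p]
  have pm : p (m + 1) = a' := by simp [p]
  have pL : ∀ i, 1 ≤ i → i ≤ m → p i = L.getD (i - 1) s := by
    intro i g1 g2
    simp only [p]
    rw [if_neg (by omega), if_pos g2]
  have pT : ∀ i, 1 ≤ i → i ≤ m → p i ∈ A ∧ p i ≠ s ∧ p i ≠ a ∧ p i ≠ a' := by
    intro i g1 g2
    rw [← memT, pL i g1 g2, ← hL2]
    exact Sta.getD_mem' (by omega)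
  have pA : ∀ i, i ≤ m + 1 → p i ∈ A := by
    intro i hi
    rcases Nat.eq_zero_or_pos i with rfl | hp
    · rw [p0]; exact ha
    · rcases Nat.lt_or_ge m i with h | h
      · obtain rfl : i = m + 1 := by omega
        rw [pm]; exact ha'
      · exact (pT i hp h).1
  have spp : ∀ i j, i < j → j ≤ m + 1 → ¬ (i = 0 ∧ j = m + 1) → D s (p i) (p j) < 0 := by
    intro i j hij hj hn
    rcases Nat.eq_zero_or_pos i with rfl | hp
    · rw [p0]
      obtain ⟨g1, g2, g3, g4⟩ := pT j (by omega) (by omega)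
      exact k1 _ g1 g2 g3 g4
    · rcases Nat.lt_or_ge m j with h | h
      · obtain rfl : j = m + 1 := by omega
        rw [pm]
        obtain ⟨g1, g2, g3, g4⟩ := pT i (by omega) (by omega)
        exact k2 _ g1 g2 g3 g4
      · rw [pL i hp (by omega), pL j (by omega) h, List.getD_eq_getElem _ _ (by omega),
          List.getD_eq_getElem _ _ (by omega)]
        exact List.pairwise_iff_getElem.1 hL1 _ _ _ _ (by omega)
  have spp0 : D s (p (m + 1)) (p 0) < 0 := by rw [p0, pm]; exact h3
  have pna : ∀ i, 1 ≤ i → i ≤ m + 1 → p i ≠ a := by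
    intro i g1 g2
    rcases Nat.lt_or_ge m i with h | h
    · obtain rfl : i = m + 1 := by omega
      rw [pm]; exact aa'.symm
    · exact (pT i g1 h).2.2.1
  have pna' : ∀ i, i ≤ m → p i ≠ a' := by
    intro i g2
    rcases Nat.eq_zero_or_pos i with rfl | hp
    · rw [p0]; exact aa'
    · exact (pT i hp g2).2.2.2
  have ppp : ∀ i j k, i < j → j < k → k ≤ m + 1 → D (p i) (p j) (p k) < 0 := by
    intro i j k hij hjk hk
    by_cases hn : i = 0 ∧ k = m + 1
    · obtain ⟨rfl, rfl⟩ := hn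
      have e : D (p 0) (p j) (p (m + 1)) = D s (p 0) (p j) + D s (p j) (p (m + 1))
          + D s (p (m + 1)) (p 0) := by unfold D; ring
      have := spp 0 j hij (by omega) (by omega)
      have := spp j (m + 1) hjk (by omega) (by omega)
      linarith
    · have e1 := spp i j hij (by omega) (by omega)
      have e2 := spp j k hjk (by omega) (by omega)
      have e3 := spp i k (by omega) (by omega) hn
      rcases lt_or_gt_of_ne (dne _ (uA _ (pA i (by omega))) _ (uA _ (pA j (by omega))) _
        (uA _ (pA k hk)) (D_lt_ne e1).2.2 (D_lt_ne e3).2.2 (D_lt_ne e2).2.2) with h | h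
      · exact h
      · exfalso
        rcases Nat.eq_zero_or_pos i with hi | hi
        · exact conv4 hca' (mE (pA j (by omega)) (pna' j (by omega))) (mE hs sa')
            (mE (pA i (by omega)) (pna' i (by omega))) (mE (pA k (by omega)) (pna' k (by omega)))
            (r2 e1) (sN h) (r1 e2)
        · exact conv4 hca (mE (pA j (by omega)) (pna j (by omega) (by omega))) (mE hs sa)
            (mE (pA i (by omega)) (pna i (by omega) (by omega)))
            (mE (pA k (by omega)) (pna k (by omega) (by omega)))
            (r2 e1) (sN h) (r1 e2)
  have edge : ∀ b ∈ B, D (p (m + 1)) (p 0) b < 0 := by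
    rw [p0, pm]
    obtain ⟨bR, hbR, hmin⟩ := (A ∪ B).exists_min_image (fun x => D a' a x) ⟨s, uA s hs⟩
    have hbRneg : D a' a bR < 0 := lt_of_le_of_lt (hmin s (uA s hs)) (r1 h3)
    have hbRf := boundary_of_min hbR hbRneg hmin
    have hbRB : bR ∈ B := by
      rcases Finset.mem_union.1 hbR with h | h
      · rcases hf bR h hbRf with rfl | rfl
        · rw [D_self2] at hbRneg; exact (lt_irrefl _ hbRneg).elim
        · rw [D_self3] at hbRneg; exact (lt_irrefl _ hbRneg).elim
      · exact h
    have neAB : ∀ x ∈ A, ∀ y ∈ B, x ≠ y := by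
      rintro x hx y hy rfl
      have := hA x hx
      have := hB x hy
      linarith
    intro b hb
    rcases lt_or_gt_of_ne (dne a' (uA _ ha') a (uA _ ha) b (uB _ hb) aa'.symm (neAB a' ha' b hb)
      (neAB a ha b hb)) with h | h
    · exact h
    exfalso
    have bne : b ≠ bR := by rintro rfl; linarith
    have e1 : D a a' b < 0 := sN h
    rcases lt_or_gt_of_ne (dne a (uA _ ha) b (uB _ hb) bR hbR (neAB a ha b hb)
      (neAB a ha bR hbRB) bne) with g | g
    · exact mem_interior_tri (uA _ ha') (uB _ hb) hbR e1 g (r1 hbRneg) hfa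
    rcases lt_or_gt_of_ne (dne a' (uA _ ha') bR hbR b (uB _ hb) (neAB a' ha' bR hbRB)
      (neAB a' ha' b hb) bne.symm) with g' | g'
    · exact mem_interior_tri (uA _ ha) hbR (uB _ hb) hbRneg g' (r1 e1) hfa'
    exact sep_seg (hA a' ha') (hA a ha) (hB bR hbRB) (hB b hb) hbRneg e1
      (r1 (D_pos_iff_swap'.1 g')) (r1 (D_pos_iff_swap'.1 g))
  have S : Sta v c A B s m p :=
    { hA := hA, hB := hB, hgen := hgen, hnh := hnh, hm := by omega, sA := hs, pA := pA
      Aeq := by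
        intro x hx
        by_cases xs : x = s
        · exact Or.inl xs
        right
        by_cases xa : x = a
        · exact ⟨0, by omega, by rw [p0, xa]⟩
        by_cases xa' : x = a'
        · exact ⟨m + 1, le_rfl, by rw [pm, xa']⟩
        have : x ∈ L := (hL2 x).2 ((memT x).2 ⟨hx, xs, xa, xa'⟩)
        obtain ⟨k, hk, rfl⟩ := List.getElem_of_mem this
        refine ⟨k + 1, by omega, ?_⟩
        rw [pL _ (by omega) (by omega), Nat.add_sub_cancel, List.getD_eq_getElem _ _ hk]
      ppp := ppp, spp := spp, spp0 := spp0, edge := edge }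
  have := S.card_B
  omega

lemma main_thm {v : Pt} {c : ℝ} {A B : Finset Pt} (hA : ∀ p ∈ A, dotp v p < c)
    (hB : ∀ p ∈ B, c < dotp v p) (hgen : GenPos (↑(A ∪ B) : Set Pt)) (hcrit : LCritical A B)
    (hnh : ¬ ∃ H : Finset Pt, DividedFiveHole A B H) (hAcard : 6 ≤ A.card)
    (hbd : Set.ncard {p : Pt | p ∈ A ∧ OnHullBoundary (A ∪ B) p} = 2) :
    B.card + 1 ≤ A.card := by
  obtain ⟨a, a', haa', hset⟩ := Set.ncard_eq_two.1 hbd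
  have hmem : ∀ x, (x ∈ A ∧ OnHullBoundary (A ∪ B) x) ↔ (x = a ∨ x = a') := by
    intro x
    have : x ∈ {p : Pt | p ∈ A ∧ OnHullBoundary (A ∪ B) p} ↔ x ∈ ({a, a'} : Set Pt) := by rw [hset]
    simpa using this
  obtain ⟨ha, hfa⟩ := (hmem a).2 (Or.inl rfl)
  obtain ⟨ha', hfa'⟩ := (hmem a').2 (Or.inr rfl)
  obtain ⟨hnA, hnB, hcr⟩ := hcrit
  have conv : ∀ x ∈ A, OnHullBoundary (A ∪ B) x → ConvexPos (↑(A.erase x) : Set Pt) := by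
    intro x hx hfx
    rcases hcr x (Finset.mem_union_left _ hx) hfx with h | h
    · exact h
    · rw [Finset.erase_eq_of_notMem] at h
      · exact (hnB h).elim
      · intro hxB
        have := hA x hx
        have := hB x hxB
        linarith
  have hca := conv a ha hfa
  have hca' := conv a' ha' hfa'
  unfold ConvexPos at hnA
  push Not at hnA
  obtain ⟨s, hs, hsh⟩ := hnA
  have hs' : s ∈ A := by exact_mod_cast hs
  obtain ⟨x, hx, y, hy, z, hz, h1, h2, h3⟩ := tri_of_hull hgen
    (T := (↑A : Set Pt) \ {s}) (s := s)
    (by intro w hw; exact Finset.mem_coe.2 (Finset.mem_union_left _ (by exact_mod_cast hw.1)))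
    (Finset.mem_coe.2 (Finset.mem_union_left _ hs')) (by simp) hsh
  have xA : x ∈ A := by exact_mod_cast hx.1
  have yA : y ∈ A := by exact_mod_cast hy.1
  have zA : z ∈ A := by exact_mod_cast hz.1
  have hsf : ¬ OnHullBoundary (A ∪ B) s :=
    mem_interior_tri (Finset.mem_union_left _ xA) (Finset.mem_union_left _ yA)
      (Finset.mem_union_left _ zA) h1 h2 h3
  have mE : ∀ {x y : Pt}, x ∈ A → y ≠ x → x ∈ (↑(A.erase y) : Set Pt) := by
    intro x y hx hxy
    rw [Finset.mem_coe, Finset.mem_erase]; exact ⟨hxy.symm, hx⟩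
  have has : a ≠ s := by rintro rfl; exact hsf hfa
  have has' : a' ≠ s := by rintro rfl; exact hsf hfa'
  have ina : a = x ∨ a = y ∨ a = z := by
    by_contra hcon
    push Not at hcon
    exact conv4 hca (mE hs' has) (mE xA hcon.1) (mE yA hcon.2.1) (mE zA hcon.2.2) h1 h2 h3
  have ina' : a' = x ∨ a' = y ∨ a' = z := by
    by_contra hcon
    push Not at hcon
    exact conv4 hca' (mE hs' has') (mE xA hcon.1) (mE yA hcon.2.1) (mE zA hcon.2.2) h1 h2 h3
  have hf : ∀ x ∈ A, OnHullBoundary (A ∪ B) x → x = a ∨ x = a' :=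
    fun x hx hfx => (hmem x).1 ⟨hx, hfx⟩
  have hf' : ∀ x ∈ A, OnHullBoundary (A ∪ B) x → x = a' ∨ x = a :=
    fun x hx hfx => (hf x hx hfx).symm
  have c1 : ∀ q ∈ A, D s a q < 0 → D s q a' < 0 → D s a' a < 0 → B.card + 1 ≤ A.card :=
    fun q hq e1 e2 e3 => core hA hB hgen hnh hAcard ha ha' hs' hq hfa hfa' hf hca hca' e1 e2 e3
  have c2 : ∀ q ∈ A, D s a' q < 0 → D s q a < 0 → D s a a' < 0 → B.card + 1 ≤ A.card :=
    fun q hq e1 e2 e3 => core hA hB hgen hnh hAcard ha' ha hs' hq hfa' hfa hf' hca' hca e1 e2 e3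
  rcases ina with e | e | e <;> rcases ina' with e' | e' | e'
  · exact (haa' (e.trans e'.symm)).elim
  · rw [← e, ← e'] at h1; rw [← e'] at h2; rw [← e] at h3
    exact c2 z zA h2 h3 h1
  · rw [← e] at h1; rw [← e'] at h2; rw [← e, ← e'] at h3
    exact c1 y yA h1 h2 h3
  · rw [← e, ← e'] at h1; rw [← e] at h2; rw [← e'] at h3
    exact c1 z zA h2 h3 h1
  · exact (haa' (e.trans e'.symm)).elim
  · rw [← e] at h1; rw [← e, ← e'] at h2; rw [← e'] at h3
    exact c2 x xA h3 h1 h2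
  · rw [← e'] at h1; rw [← e] at h2; rw [← e, ← e'] at h3
    exact c2 y yA h1 h2 h3
  · rw [← e'] at h1; rw [← e, ← e'] at h2; rw [← e] at h3
    exact c1 x xA h3 h1 h2
  · exact (haa' (e.trans e'.symm)).elim

/-- **Proposition 15.** Let `C = A ∪ B` be an `ℓ`-critical set with no `ℓ`-divided
5-hole, `|A|, |B| ≥ 6`, and with exactly two points of `A` on the boundary of the
convex hull of `C`. Then `|B| ≤ |A| - 1`. -/
theorem critical_B_lt_A
    (v : Pt) (hv : v ≠ 0) (c : ℝ) (A B : Finset Pt)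
    (hA : ∀ p ∈ A, dotp v p < c) (hB : ∀ p ∈ B, c < dotp v p)
    (hgen : GenPos (↑(A ∪ B) : Set Pt))
    (hcrit : LCritical A B)
    (hnh : ¬ ∃ H : Finset Pt, DividedFiveHole A B H)
    (hAcard : 6 ≤ A.card) (hBcard : 6 ≤ B.card)
    (hbd : Set.ncard {p : Pt | p ∈ A ∧ OnHullBoundary (A ∪ B) p} = 2) :
    B.card + 1 ≤ A.card := by
  exact main_thm hA hB hgen hcrit hnh hAcard hbd

end
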